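/- Let p be one of the primes 3, 7, 11, 19, and let (c, d) be the minimal positive integer solution of c² − p·d² = 1. Let a and m be natural numbers such that the set of primes ℓ with ℓ ≡ a (mod m), ℓ ≡ 1 (mod 4), and −p a square in ℤ/ℓℤ is infinite. Then for all real numbers α, β with 0 ≤ α < β ≤ d/c, the set of primes ℓ satisfying ℓ ≡ a (mod m), ℓ ≡ 1 (mod 4), −p a square in ℤ/ℓℤ, and admitting a representation ℓ = A² − p·B² with integers A, B such that A > 0, B > 0, A odd, c·B < d·A, and α < B/A < β, is infinite. -/

import Mathlib

namespace Zsqrtd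

theorem prime_of_natAbs_norm_prime {d : ℤ} {x : ℤ√d} (h : x.norm.natAbs.Prime) : Prime x := by
  have : Fact x.norm.natAbs.Prime := ⟨h⟩
  set q := x.norm.natAbs with hq
  have hnq : (q : ℤ) ∣ x.norm := Int.natAbs_dvd.mpr dvd_rfl
  have hnorm : ((x.re : ZMod q)) ^ 2 = d * (x.im : ZMod q) ^ 2 := by
    have := (ZMod.intCast_zmod_eq_zero_iff_dvd x.norm q).2 hnq
    rw [norm_def] at this
    push_cast at this
    linear_combination this
  have him : (x.im : ZMod q) ≠ 0 := by
    intro h0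
    have h1 : (x.re : ZMod q) = 0 := by
      rw [h0] at hnorm
      simpa using hnorm
    rw [ZMod.intCast_zmod_eq_zero_iff_dvd] at h0 h1
    obtain ⟨a, ha⟩ := h0
    obtain ⟨b, hb⟩ := h1
    have : (q : ℤ) ^ 2 ∣ x.norm := ⟨b ^ 2 - d * a ^ 2, by rw [norm_def, ha, hb]; ring⟩
    have h2 := Int.natAbs_dvd_natAbs.2 this
    rw [Int.natAbs_pow, Int.natAbs_natCast, ← hq, pow_two] at h2
    have h3 := Nat.le_of_dvd h.pos h2
    nlinarith [h.two_le]
  let r : { r : ZMod q // r * r = ((d : ℤ) : ZMod q) } := ⟨-(x.re / x.im), by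
    field_simp
    linear_combination hnorm⟩
  have hr : (r : ZMod q) = -(x.re / x.im) := rfl
  have hker : ∀ y : ℤ√d, lift r y = 0 ↔ x ∣ y := by
    intro y
    have hval : lift r y = y.re + y.im * r := by simp [lift]
    constructor
    · intro hy
      rw [hval, hr] at hy
      have e1 : (y.re : ZMod q) * x.im = y.im * x.re := by
        field_simp at hy
        linear_combination hy
      have e2 : (x.im : ZMod q) * (y.re * x.re - d * y.im * x.im) = 0 := by
        linear_combination x.re * e1 + y.im * hnorm
      have e2' := (mul_eq_zero.1 e2).resolve_left him
      have d1 : (q : ℤ) ∣ y.im * x.re - y.re * x.im := by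
        rw [← ZMod.intCast_zmod_eq_zero_iff_dvd]
        push_cast
        linear_combination -e1
      have d2 : (q : ℤ) ∣ y.re * x.re - d * y.im * x.im := by
        rw [← ZMod.intCast_zmod_eq_zero_iff_dvd]
        push_cast
        exact e2'
      have hd : x.norm ∣ (y * star x).re ∧ x.norm ∣ (y * star x).im := by
        constructor
        · rw [← Int.natAbs_dvd]
          convert d2 using 1
          simp
          ring
        · rw [← Int.natAbs_dvd]
          convert d1 using 1
          simp
          ring
      obtain ⟨z, hz⟩ := (intCast_dvd _ _).2 hd
      have hx0 : x.norm ≠ 0 := by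
        intro h0
        rw [h0] at hq
        exact h.ne_zero hq
      refine ⟨z, Zsqrtd.eq_of_smul_eq_smul_left hx0 ?_⟩
      calc (x.norm : ℤ√d) * y = x * (y * star x) := by rw [norm_eq_mul_conj]; ring
        _ = x.norm * (x * z) := by rw [hz]; ring
    · rintro ⟨z, rfl⟩
      rw [map_mul]
      have : lift r x = 0 := by
        have hval : lift r x = x.re + x.im * r := by simp [lift]
        rw [hval, hr]
        field_simp
        ring
      rw [this, zero_mul]
  refine ⟨?_, ?_, ?_⟩
  · rintro rfl
    simp [hq] at h
    exact Nat.not_prime_zero h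
  · rw [← norm_eq_one_iff]
    exact h.ne_one
  · intro a b hab
    rw [← hker, map_mul, mul_eq_zero, hker, hker] at hab
    exact hab

theorem prime_natCast_of_not_isSquare {d : ℤ} {q : ℕ} (hq : q.Prime)
    (h : ¬ IsSquare (d : ZMod q)) : Prime (q : ℤ√d) := by
  have : Fact q.Prime := ⟨hq⟩
  have key : ∀ x : ℤ√d, (q : ℤ) ∣ x.norm → (q : ℤ√d) ∣ x := by
    intro x hx
    have h0 := (ZMod.intCast_zmod_eq_zero_iff_dvd _ q).2 hx
    rw [norm_def] at h0
    push_cast at h0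
    have him : (x.im : ZMod q) = 0 := by
      by_contra him
      exact h ⟨x.re / x.im, by field_simp; linear_combination -h0⟩
    have hre : (x.re : ZMod q) = 0 := by simpa [him] using h0
    rw [ZMod.intCast_zmod_eq_zero_iff_dvd] at him hre
    exact_mod_cast (intCast_dvd (q : ℤ) x).2 ⟨hre, him⟩
  refine ⟨by exact_mod_cast hq.ne_zero, ?_, ?_⟩
  · rw [← norm_eq_one_iff, norm_natCast, Int.natAbs_mul, Int.natAbs_natCast]
    have := hq.two_le
    nlinarith
  · rintro a b ⟨z, hz⟩
    have hn : (q : ℤ) ∣ a.norm * b.norm := by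
      rw [← norm_mul, hz, norm_mul, norm_natCast]
      exact ⟨q * z.norm, by ring⟩
    rcases (Nat.prime_iff_prime_int.1 hq).dvd_or_dvd hn with h1 | h1
    · exact Or.inl (key a h1)
    · exact Or.inr (key b h1)

theorem dvd_or_star_dvd_of_natAbs_norm_prime {d : ℤ} {x y : ℤ√d} (h : x.norm.natAbs.Prime)
    (hy : (x.norm.natAbs : ℤ) ∣ y.norm) : x ∣ y ∨ star x ∣ y := by
  have hx := prime_of_natAbs_norm_prime h
  have h1 : x ∣ y * star y := by
    rw [← norm_eq_mul_conj]
    refine dvd_trans ?_ ((intCast_dvd_intCast _ _).2 (Int.natAbs_dvd.1 hy))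
    rw [norm_eq_mul_conj]
    exact dvd_mul_right _ _
  rcases hx.dvd_or_dvd h1 with h2 | h2
  · exact Or.inl h2
  · obtain ⟨z, hz⟩ := h2
    exact Or.inr ⟨star z, by rw [← star_star y, hz, star_mul']⟩

theorem exists_natAbs_norm_eq_of_mul {d : ℤ} {x y : ℤ√d} {n : ℕ} (h : x.norm.natAbs.Prime)
    (hy : y.norm.natAbs = x.norm.natAbs * n) : ∃ z : ℤ√d, z.norm.natAbs = n := by
  have hd : (x.norm.natAbs : ℤ) ∣ y.norm := by
    rw [← Int.dvd_natAbs, hy]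
    exact_mod_cast dvd_mul_right _ _
  have aux : ∀ w z : ℤ√d, w.norm.natAbs = x.norm.natAbs → y = w * z → z.norm.natAbs = n := by
    intro w z hw hz
    rw [hz, norm_mul, Int.natAbs_mul, hw] at hy
    exact Nat.eq_of_mul_eq_mul_left h.pos hy
  rcases dvd_or_star_dvd_of_natAbs_norm_prime h hd with ⟨z, hz⟩ | ⟨z, hz⟩
  · exact ⟨z, aux x z rfl hz⟩
  · exact ⟨z, aux _ z (by rw [norm_conj]) hz⟩

theorem uniqueFactorizationMonoid_of_forall_prime {d : ℤ} [IsDomain (ℤ√d)]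
    (hd : ∀ n : ℤ, d ≠ n * n)
    (h : ∀ q : ℕ, q.Prime → IsSquare (d : ZMod q) → ∃ x : ℤ√d, x.norm.natAbs = q) :
    UniqueFactorizationMonoid (ℤ√d) := by
  refine UniqueFactorizationMonoid.of_exists_prime_factors fun a => ?_
  induction hn : a.norm.natAbs using Nat.strong_induction_on generalizing a with
  | _ n ih =>
    intro ha
    have hn0 : n ≠ 0 := by
      rw [← hn, Int.natAbs_ne_zero, Ne, norm_eq_zero hd]
      exact ha
    rcases eq_or_ne n 1 with h1 | h1
    · refine ⟨0, by simp, ?_⟩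
      rw [h1, norm_eq_one_iff] at hn
      simpa using (associated_one_iff_isUnit.2 hn).symm
    · obtain ⟨x, hx, hxa⟩ : ∃ x : ℤ√d, Prime x ∧ x ∣ a := by
        obtain ⟨q, hq, hqn⟩ := Nat.exists_prime_and_dvd h1
        have hqa : (q : ℤ) ∣ a.norm := by
          rw [← Int.dvd_natAbs, hn]
          exact_mod_cast hqn
        by_cases hs : IsSquare (d : ZMod q)
        · obtain ⟨x, rfl⟩ := h q hq hs
          rcases dvd_or_star_dvd_of_natAbs_norm_prime hq hqa with h2 | h2
          · exact ⟨x, prime_of_natAbs_norm_prime hq, h2⟩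
          · exact ⟨star x, prime_of_natAbs_norm_prime (by rwa [norm_conj]), h2⟩
        · have hp := prime_natCast_of_not_isSquare hq hs
          refine ⟨q, hp, ?_⟩
          have h2 : (q : ℤ√d) ∣ a * star a := by
            rw [← norm_eq_mul_conj]
            exact_mod_cast (intCast_dvd_intCast (d := d) _ _).2 hqa
          rcases hp.dvd_or_dvd h2 with h3 | ⟨z, hz⟩
          · exact h3
          · exact ⟨star z, by rw [← star_star a, hz, star_mul', star_natCast]⟩
      obtain ⟨b, rfl⟩ := hxa
      have hb : b ≠ 0 := right_ne_zero_of_mul ha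
      have hlt : b.norm.natAbs < n := by
        rw [← hn, norm_mul, Int.natAbs_mul]
        have hb1 : 0 < b.norm.natAbs := by
          rw [Int.natAbs_pos, Ne, norm_eq_zero hd]
          exact hb
        have hx1 : x.norm.natAbs ≠ 1 := by
          rw [Ne, norm_eq_one_iff]
          exact hx.not_isUnit
        have hx0 : x.norm.natAbs ≠ 0 := by
          rw [Int.natAbs_ne_zero, Ne, norm_eq_zero hd]
          exact hx.ne_zero
        have : 2 ≤ x.norm.natAbs := by omega
        nlinarith
      obtain ⟨s, hs, hsb⟩ := ih _ hlt b rfl hb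
      refine ⟨x ::ₘ s, ?_, ?_⟩
      · intro y hy
        rcases Multiset.mem_cons.1 hy with rfl | hy
        · exact hx
        · exact hs y hy
      · rw [Multiset.prod_cons]
        exact hsb.mul_left x

/-- Thue's lemma, with unequal boxes. -/
theorem _root_.exists_modEq_mul_of_lt_mul {q S T : ℕ} (hq : 0 < q) (hST : q < (S + 1) * (T + 1))
    (r : ℤ) : ∃ a b : ℤ, (a ≠ 0 ∨ b ≠ 0) ∧ |a| ≤ S ∧ |b| ≤ T ∧ (q : ℤ) ∣ a - r * b := by
  have : NeZero q := ⟨hq.ne'⟩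
  let f : ℕ × ℕ → ZMod q := fun x => (x.1 : ZMod q) - r * (x.2 : ZMod q)
  have hcard : (Finset.univ : Finset (ZMod q)).card
      < (Finset.range (S + 1) ×ˢ Finset.range (T + 1)).card := by
    simpa [ZMod.card] using hST
  obtain ⟨x, hx, y, hy, hxy, hf⟩ := Finset.exists_ne_map_eq_of_card_lt_of_maps_to hcard
    (f := f) (fun _ _ => Finset.mem_coe.2 (Finset.mem_univ _))
  simp only [Finset.mem_product, Finset.mem_range] at hx hy
  refine ⟨x.1 - y.1, x.2 - y.2, ?_, ?_, ?_, ?_⟩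
  · by_contra! h
    exact hxy (Prod.ext (by omega) (by omega))
  · rw [abs_le]; omega
  · rw [abs_le]; omega
  · rw [← ZMod.intCast_zmod_eq_zero_iff_dvd]
    push_cast
    simp only [f] at hf
    linear_combination hf

theorem exists_natAbs_norm_eq {p : ℕ} (hp : p = 3 ∨ p = 7 ∨ p = 11 ∨ p = 19) {q : ℕ}
    (hq : q.Prime) (hs : IsSquare ((p : ℤ) : ZMod q)) :
    ∃ x : ℤ√(p : ℤ), x.norm.natAbs = q := by
  have two : ∃ x : ℤ√(p : ℤ), x.norm.natAbs = 2 := by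
    rcases hp with rfl | rfl | rfl | rfl
    · exact ⟨⟨1, 1⟩, by decide⟩
    · exact ⟨⟨3, 1⟩, by decide⟩
    · exact ⟨⟨3, 1⟩, by decide⟩
    · exact ⟨⟨13, 3⟩, by decide⟩
  have three : (∃ x : ℤ√(p : ℤ), x.norm.natAbs = 3) ∨ ¬ IsSquare ((p : ℤ) : ZMod 3) := by
    rcases hp with rfl | rfl | rfl | rfl
    · exact Or.inl ⟨⟨0, 1⟩, by decide⟩
    · exact Or.inl ⟨⟨2, 1⟩, by decide⟩
    · exact Or.inr (by decide)
    · exact Or.inl ⟨⟨4, 1⟩, by decide⟩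
  have : Fact q.Prime := ⟨hq⟩
  obtain ⟨e, he, hpe, hpn⟩ : ∃ e : ℕ, 0 < e ∧ e ≤ 4 ∧ p < 5 * e := by
    rcases hp with rfl | rfl | rfl | rfl
    · exact ⟨4, by norm_num⟩
    · exact ⟨4, by norm_num⟩
    · exact ⟨4, by norm_num⟩
    · exact ⟨4, by norm_num⟩
  have hnsq : ∀ n : ℤ, (p : ℤ) ≠ n * n := by
    intro n hn
    have : |n| < 5 := by
      rw [abs_lt]
      rcases hp with rfl | rfl | rfl | rfl <;> push_cast at hn <;> constructor <;> nlinarith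
    rw [abs_lt] at this
    obtain ⟨h1, h2⟩ := this
    rcases hp with rfl | rfl | rfl | rfl <;> interval_cases n <;> omega
  obtain ⟨r, hr⟩ := hs
  obtain ⟨r, rfl⟩ := ZMod.intCast_surjective r
  obtain ⟨a, b, hab, ha, hb, hdvd⟩ := exists_modEq_mul_of_lt_mul (S := (e * q).sqrt)
    (T := (q / e).sqrt) hq.pos (by
      have h1 := Nat.lt_succ_sqrt (e * q)
      have h2 := Nat.lt_succ_sqrt (q / e)
      have h3 : q < e * ((q / e).sqrt.succ * (q / e).sqrt.succ) := by
        have := Nat.lt_mul_div_succ q he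
        calc q < e * (q / e + 1) := this
          _ ≤ _ := Nat.mul_le_mul_left _ h2
      simp only [Nat.succ_eq_add_one] at *
      set S := (e * q).sqrt + 1
      set T := (q / e).sqrt + 1
      by_contra! hcon
      have : (e * q) * q < (S * S) * (e * (T * T)) := by
        apply Nat.mul_lt_mul'' h1 h3
      have h4 : (S * T) * (S * T) ≤ q * q := Nat.mul_le_mul hcon hcon
      have h5 : (S * S) * (e * (T * T)) = e * ((S * T) * (S * T)) := by ring
      have h6 := Nat.mul_le_mul_left e h4
      rw [h5, mul_assoc] at this
      omega) r
  set x : ℤ√(p : ℤ) := ⟨a, b⟩ with hx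
  have hxn : x.norm = a ^ 2 - p * b ^ 2 := by rw [norm_def]; ring
  have hx0 : x.norm ≠ 0 := by
    rw [Ne, norm_eq_zero hnsq, Zsqrtd.ext_iff]
    rintro ⟨h1, h2⟩
    rcases hab with h | h
    · exact h h1
    · exact h h2
  have hqx : (q : ℤ) ∣ x.norm := by
    rw [← ZMod.intCast_zmod_eq_zero_iff_dvd] at hdvd ⊢
    rw [hxn]
    push_cast at hdvd ⊢
    push_cast at hr
    rw [hr]
    linear_combination (a + r * b) * hdvd
  have ha2 : a ^ 2 ≤ 4 * q := by
    have h1 : a ^ 2 ≤ ((e * q).sqrt : ℤ) ^ 2 := sq_le_sq' (by linarith [abs_le.1 ha]) (abs_le.1 ha).2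
    have h2 : (((e * q).sqrt : ℤ)) ^ 2 ≤ e * q := by exact_mod_cast Nat.sqrt_le' (e * q)
    have : (e : ℤ) ≤ 4 := by exact_mod_cast hpe
    nlinarith
  have hb2 : p * b ^ 2 < 5 * q := by
    have h1 : b ^ 2 ≤ ((q / e).sqrt : ℤ) ^ 2 := sq_le_sq' (by linarith [abs_le.1 hb]) (abs_le.1 hb).2
    have h2 : (((q / e).sqrt : ℤ)) ^ 2 ≤ ((q / e : ℕ) : ℤ) := by exact_mod_cast Nat.sqrt_le' (q / e)
    have h3 : ((q / e : ℕ) : ℤ) * e ≤ q := by exact_mod_cast Nat.div_mul_le_self q e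
    have h4 : (p : ℤ) < 5 * e := by exact_mod_cast hpn
    have h5 : (0 : ℤ) < q := by exact_mod_cast hq.pos
    have h6 : b ^ 2 * e ≤ q := by nlinarith
    rcases eq_or_ne b 0 with rfl | hb0
    · simpa using h5
    · have : 0 < b ^ 2 := by positivity
      nlinarith
  obtain ⟨k, hk⟩ : q ∣ x.norm.natAbs := by exact_mod_cast Int.dvd_natAbs.2 hqx
  have hk0 : k ≠ 0 := by
    rintro rfl
    simp at hk
    exact hx0 hk
  have hk4 : k ≤ 4 := by
    have h1 : |x.norm| < 5 * q := by
      have h5 : (0 : ℤ) < q := by exact_mod_cast hq.pos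
      rw [hxn, abs_lt]
      constructor
      · nlinarith [sq_nonneg a]
      · nlinarith [mul_nonneg (Int.natCast_nonneg p) (sq_nonneg b)]
    rw [Int.abs_eq_natAbs, hk] at h1
    have h2 : q * k < 5 * q := by exact_mod_cast h1
    by_contra! h3
    nlinarith [hq.pos]
  obtain ⟨y, hy⟩ := two
  interval_cases k
  · exact absurd rfl hk0
  · exact ⟨x, by omega⟩
  · exact exists_natAbs_norm_eq_of_mul (x := y) (y := x) (by rw [hy]; norm_num) (by rw [hk, hy, mul_comm])
  · rcases three with ⟨z, hz⟩ | h3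
    · exact exists_natAbs_norm_eq_of_mul (x := z) (y := x) (by rw [hz]; norm_num)
        (by rw [hk, hz, mul_comm])
    · have hp3 := prime_natCast_of_not_isSquare Nat.prime_three h3
      have hdx : ((3 : ℕ) : ℤ√(p : ℤ)) ∣ x * star x := by
        rw [← norm_eq_mul_conj]
        have : ((3 : ℕ) : ℤ) ∣ x.norm := by
          rw [← Int.dvd_natAbs, hk]
          exact_mod_cast dvd_mul_left _ _
        exact_mod_cast (intCast_dvd_intCast (d := (p : ℤ)) _ _).2 this
      have h9 : (9 : ℤ) ∣ x.norm := by
        have : ∀ y : ℤ√(p : ℤ), ((3 : ℕ) : ℤ√(p : ℤ)) ∣ y → (9 : ℤ) ∣ y.norm := by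
          rintro y ⟨z, rfl⟩
          rw [norm_mul, norm_natCast]
          exact Dvd.intro _ rfl
        rcases hp3.dvd_or_dvd hdx with h | h
        · exact this _ h
        · rw [← norm_conj]
          exact this _ h
      have h9' : 9 ∣ q * 3 := by
        rw [← hk]
        exact_mod_cast Int.dvd_natAbs.2 h9
      have h3q : 3 ∣ q := by omega
      have : 3 = q := (Nat.prime_dvd_prime_iff_eq Nat.prime_three hq).1 h3q
      subst this
      exact absurd ⟨_, hr⟩ h3
  · obtain ⟨z, hz⟩ := exists_natAbs_norm_eq_of_mul (x := y) (y := x) (n := 2 * q)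
      (by rw [hy]; norm_num) (by rw [hk, hy]; ring)
    exact exists_natAbs_norm_eq_of_mul (x := y) (y := z) (by rw [hy]; norm_num) (by rw [hz, hy])

end Zsqrtd

section UFM

variable {M : Type*} [CommMonoidWithZero M] [UniqueFactorizationMonoid M]

theorem Prime.finiteMultiplicity_of_ne_zero {P x : M} (hP : Prime P) (hx : x ≠ 0) :
    FiniteMultiplicity P x :=
  FiniteMultiplicity.of_not_isUnit hP.not_isUnit hx

theorem Prime.multiplicity_self_mul {P x : M} (hP : Prime P) (hx : x ≠ 0) :
    multiplicity P (P * x) = multiplicity P x + 1 := by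
  rw [multiplicity_mul hP (hP.finiteMultiplicity_of_ne_zero (mul_ne_zero hP.ne_zero hx)),
    multiplicity_self, add_comm]

theorem Prime.multiplicity_mul_of_ne [Subsingleton Mˣ] {P Q x : M} (hP : Prime P)
    (hQ : Prime Q) (hPQ : P ≠ Q) (hx : x ≠ 0) : multiplicity P (Q * x) = multiplicity P x := by
  rw [multiplicity_mul hP (hP.finiteMultiplicity_of_ne_zero (mul_ne_zero hQ.ne_zero hx)),
    multiplicity_eq_zero.2, zero_add]
  intro h
  exact hPQ (associated_iff_eq.1 (hP.associated_of_dvd hQ h))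

theorem hasSum_multiplicity_mul_log [Subsingleton Mˣ] (N : M →*₀ ℕ)
    (hN : ∀ x, x ≠ 0 → N x ≠ 0) {x : M} (hx : x ≠ 0) :
    HasSum (fun P : {P : M // Prime P} => (multiplicity P.1 x : ℝ) * Real.log (N P.1))
      (Real.log (N x)) := by
  classical
  induction x using UniqueFactorizationMonoid.induction_on_prime with
  | h₁ => exact absurd rfl hx
  | h₂ x hu =>
    have hx1 : x = 1 := by
      obtain ⟨u, rfl⟩ := hu
      simp [Subsingleton.elim u 1]
    subst hx1
    have : (fun P : {P : M // Prime P} => (multiplicity P.1 (1 : M) : ℝ) * Real.log (N P.1))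
        = fun _ => 0 := by
      funext P
      rw [multiplicity_eq_zero.2 (fun h => P.2.not_isUnit (isUnit_of_dvd_one h))]
      simp
    rw [this]
    simp [hasSum_zero]
  | h₃ x Q hx0 hQ ih =>
    have h1 := (ih hx0).add (hasSum_ite_eq (⟨Q, hQ⟩ : {P : M // Prime P}) (Real.log (N Q)))
    rw [map_mul, Nat.cast_mul, Real.log_mul (by exact_mod_cast hN _ hQ.ne_zero)
      (by exact_mod_cast hN _ hx0), add_comm (Real.log _)]
    refine h1.congr_fun ?_
    intro P
    by_cases hPQ : P = ⟨Q, hQ⟩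
    · subst hPQ
      rw [hQ.multiplicity_self_mul hx0]
      simp
      ring
    · rw [if_neg hPQ, P.2.multiplicity_mul_of_ne hQ (fun h => hPQ (Subtype.ext h)) hx0]
      simp

theorem tsum_mul_multiplicity {f : M →*₀ ℂ} (hf : Summable f) {P : M} (hP : Prime P)
    (hfP : f P ≠ 1) (hs : Summable fun x => f x * (multiplicity P x : ℂ)) :
    ∑' x, f x * (multiplicity P x : ℂ) = (∑' x, f x) * (f P / (1 - f P)) := by
  have hinj : Function.Injective (fun x => P * x) := mul_right_injective₀ hP.ne_zero
  have h1 : ∑' x, f (P * x) * (multiplicity P (P * x) : ℂ)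
      = ∑' x, f x * (multiplicity P x : ℂ) := by
    refine hinj.tsum_eq (f := fun x => f x * (multiplicity P x : ℂ)) ?_
    intro x hx
    rw [Function.mem_support] at hx
    have : P ∣ x := by
      by_contra hd
      rw [multiplicity_eq_zero.2 hd] at hx
      simp at hx
    obtain ⟨y, rfl⟩ := this
    exact ⟨y, rfl⟩
  have h2 : ∀ x, f (P * x) * (multiplicity P (P * x) : ℂ)
      = f P * (f x * (multiplicity P x : ℂ)) + f P * f x := by
    intro x
    rcases eq_or_ne x 0 with rfl | hx
    · simp
    · rw [hP.multiplicity_self_mul hx, map_mul]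
      push_cast
      ring
  simp only [h2] at h1
  rw [(hs.mul_left _).tsum_add (hf.mul_left _), tsum_mul_left, tsum_mul_left] at h1
  have h3 : 1 - f P ≠ 0 := sub_ne_zero.2 (Ne.symm hfP)
  field_simp
  linear_combination -h1

theorem tsum_mul_log_eq_tsum_mul_tsum_prime [Subsingleton Mˣ] (N : M →*₀ ℕ)
    (hN : ∀ x, x ≠ 0 → N x ≠ 0) (hN1 : ∀ P, Prime P → 1 < N P) {f : M →*₀ ℂ} (hf : Summable f)
    (hfl : Summable fun x => ‖f x‖ * Real.log (N x)) (hf1 : ∀ P, Prime P → f P ≠ 1) :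
    ∑' x, f x * (Real.log (N x) : ℂ)
      = (∑' x, f x) * ∑' P : {P : M // Prime P}, Real.log (N P.1) * (f P.1 / (1 - f P.1)) := by
  obtain ⟨F, hFd⟩ : ∃ F : M × {P : M // Prime P} → ℂ, ∀ x P, F (x, P) =
    f x * (multiplicity P.1 x : ℂ) * Real.log (N P.1) :=
    ⟨fun y => f y.1 * (multiplicity y.2.1 y.1 : ℂ) * Real.log (N y.2.1), fun _ _ => rfl⟩
  have hlog : ∀ x, 0 ≤ Real.log (N x) := fun x => Real.log_natCast_nonneg _
  have hnorm : ∀ x P, ‖F (x, P)‖ = ‖f x‖ * ((multiplicity P.1 x : ℝ) * Real.log (N P.1)) := by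
    intro x P
    simp only [hFd, norm_mul, Complex.norm_real, Complex.norm_natCast, Real.norm_eq_abs,
      abs_of_nonneg (hlog _)]
    ring
  have hrow : ∀ x, HasSum (fun P => ‖F (x, P)‖) (‖f x‖ * Real.log (N x)) := by
    intro x
    rcases eq_or_ne x 0 with rfl | hx
    · simp [hFd, hasSum_zero]
    · simp only [hnorm]
      exact (hasSum_multiplicity_mul_log N hN hx).mul_left _
  have hF : Summable F := by
    refine Summable.of_norm ?_
    rw [summable_prod_of_nonneg (fun _ => norm_nonneg _)]
    refine ⟨fun x => (hrow x).summable, ?_⟩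
    simpa only [(hrow _).tsum_eq] using hfl
  have hcol : ∀ P : {P : M // Prime P}, Summable fun x => f x * (multiplicity P.1 x : ℂ) := by
    intro P
    have h1 : Summable fun x => F (x, P) := (hF.prod_symm).prod_factor P
    simp only [hFd] at h1
    have h2 : (Real.log (N P.1) : ℂ) ≠ 0 := by
      have := Real.log_pos (show (1 : ℝ) < N P.1 by exact_mod_cast hN1 _ P.2)
      exact_mod_cast this.ne'
    exact (summable_mul_right_iff h2).1 h1
  calc ∑' x, f x * (Real.log (N x) : ℂ) = ∑' x, ∑' P, F (x, P) := by
        refine tsum_congr fun x => ?_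
        rcases eq_or_ne x 0 with rfl | hx
        · simp [hFd]
        · have := (Complex.hasSum_ofReal.2 (hasSum_multiplicity_mul_log N hN hx)).mul_left (f x)
          rw [← this.tsum_eq]
          refine tsum_congr fun P => ?_
          simp only [hFd]
          push_cast
          ring
    _ = ∑' P, ∑' x, F (x, P) :=
        (Summable.tsum_comm (f := fun x P => F (x, P)) hF).symm
    _ = ∑' P : {P : M // Prime P}, (∑' x, f x) *
          (Real.log (N P.1) * (f P.1 / (1 - f P.1))) := by
        refine tsum_congr fun P => ?_
        simp only [hFd]
        rw [tsum_mul_right, tsum_mul_multiplicity hf P.2 (hf1 _ P.2) (hcol P)]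
        ring
    _ = _ := tsum_mul_left

end UFM

section ThreeFourOne

theorem re_three_four_one_nonneg {r : ℝ} (hr0 : 0 ≤ r) (hr1 : r < 1) {z : ℂ} (hz : ‖z‖ = 1) :
    0 ≤ (3 * ((r : ℂ) / (1 - r)) + 4 * (r * z / (1 - r * z))
      + r * z ^ 2 / (1 - r * z ^ 2)).re := by
  have key : ∀ w : ℂ, ‖w‖ = 1 → HasSum (fun n : ℕ => (r : ℂ) ^ (n + 1) * w ^ (n + 1))
      (r * w / (1 - r * w)) := by
    intro w hw
    have h1 : ‖(r : ℂ) * w‖ < 1 := by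
      rw [norm_mul, hw, Complex.norm_real, Real.norm_of_nonneg hr0]
      linarith
    have := (hasSum_geometric_of_norm_lt_one h1).mul_left ((r : ℂ) * w)
    rw [← div_eq_mul_inv] at this
    refine this.congr_fun fun n => ?_
    rw [← mul_pow, pow_succ']
  have h := (((key 1 (by simp)).mul_left 3).add ((key z hz).mul_left 4)).add
    (key (z ^ 2) (by simp [hz]))
  rw [mul_one] at h
  refine (Complex.hasSum_re h).nonneg fun n => ?_
  set w := z ^ (n + 1) with hw
  have hw1 : ‖w‖ = 1 := by simp [hw, hz]
  have h2 : (z ^ 2) ^ (n + 1) = w ^ 2 := by rw [hw]; ring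
  rw [h2]
  have h3 : w.re ^ 2 + w.im ^ 2 = 1 := by
    have := Complex.sq_norm w
    rw [hw1, Complex.normSq_apply] at this
    linarith
  have h4 : (3 * ((r : ℂ) ^ (n + 1) * 1 ^ (n + 1)) + 4 * ((r : ℂ) ^ (n + 1) * w)
      + (r : ℂ) ^ (n + 1) * w ^ 2).re = r ^ (n + 1) * (2 * (1 + w.re) ^ 2) := by
    have : (3 * ((r : ℂ) ^ (n + 1) * 1 ^ (n + 1)) + 4 * ((r : ℂ) ^ (n + 1) * w)
      + (r : ℂ) ^ (n + 1) * w ^ 2) = ((r ^ (n + 1) : ℝ) : ℂ) * (3 + 4 * w + w * w) := by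
      push_cast
      ring
    rw [this, Complex.re_ofReal_mul]
    congr 1
    simp
    nlinarith
  rw [h4]
  positivity

end ThreeFourOne

section NormSeries

variable {M : Type*} [CommMonoidWithZero M]

/-- The completely multiplicative function `x ↦ ψ x * N x ^ (-s)`. -/
noncomputable def normTwist (N : M →*₀ ℕ) (ψ : M →*₀ ℂ) (s : ℝ) : M →*₀ ℂ where
  toFun x := ψ x * ((N x : ℝ) ^ (-s) : ℝ)
  map_zero' := by simp
  map_one' := by simp
  map_mul' x y := by
    rw [map_mul, map_mul, Nat.cast_mul, Real.mul_rpow (by positivity) (by positivity)]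
    push_cast
    ring

variable {N : M →*₀ ℕ} {ψ : M →*₀ ℂ}

theorem normTwist_apply (s : ℝ) (x : M) :
    normTwist N ψ s x = ψ x * ((N x : ℝ) ^ (-s) : ℝ) := rfl

theorem norm_normTwist (s : ℝ) (x : M) :
    ‖normTwist N ψ s x‖ = ‖ψ x‖ * (N x : ℝ) ^ (-s) := by
  rw [normTwist_apply, norm_mul, Complex.norm_real, Real.norm_of_nonneg (by positivity)]

theorem rpow_neg_mul_log_le {n : ℕ} {s σ : ℝ} (hσ : σ < s) :
    (n : ℝ) ^ (-s) * Real.log n ≤ (s - σ)⁻¹ * (n : ℝ) ^ (-σ) := by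
  rcases Nat.eq_zero_or_pos n with rfl | hn
  · simp
    exact mul_nonneg (by simpa using hσ.le) (Real.rpow_nonneg le_rfl _)
  have hn' : (0 : ℝ) < n := by exact_mod_cast hn
  have h := Real.log_le_rpow_div hn'.le (sub_pos.2 hσ)
  calc (n : ℝ) ^ (-s) * Real.log n ≤ (n : ℝ) ^ (-s) * ((n : ℝ) ^ (s - σ) / (s - σ)) := by
        gcongr
    _ = (s - σ)⁻¹ * ((n : ℝ) ^ (-s) * (n : ℝ) ^ (s - σ)) := by ring
    _ = _ := by
        rw [← Real.rpow_add hn']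
        congr 2
        ring

theorem summable_norm_mul_rpow_mul_log
    (hs : ∀ s : ℝ, 1 < s → Summable fun x => ‖ψ x‖ * (N x : ℝ) ^ (-s)) {s : ℝ} (h1 : 1 < s) : Summable fun x => ‖ψ x‖ * (N x : ℝ) ^ (-s) * Real.log (N x) := by
  obtain ⟨σ, hσ1, hσ⟩ := exists_between h1
  refine Summable.of_nonneg_of_le (fun x => by
    have := Real.log_natCast_nonneg (N x)
    positivity) (fun x => ?_) ((hs σ hσ1).mul_left (s - σ)⁻¹)
  rw [mul_assoc]
  calc ‖ψ x‖ * ((N x : ℝ) ^ (-s) * Real.log (N x))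
      ≤ ‖ψ x‖ * ((s - σ)⁻¹ * (N x : ℝ) ^ (-σ)) :=
        mul_le_mul_of_nonneg_left (rpow_neg_mul_log_le hσ) (norm_nonneg _)
    _ = _ := by ring

theorem hasDerivAt_tsum_normTwist (hN : ∀ x, x ≠ 0 → N x ≠ 0)
    (hs : ∀ s : ℝ, 1 < s → Summable fun x => ‖ψ x‖ * (N x : ℝ) ^ (-s))
    {s : ℝ} (h1 : 1 < s) :
    HasDerivAt (fun s => ∑' x, normTwist N ψ s x)
      (-∑' x, normTwist N ψ s x * (Real.log (N x) : ℂ)) s := by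
  obtain ⟨σ, hσ1, hσ⟩ := exists_between h1
  have hder : ∀ x, ∀ t : ℝ, HasDerivAt (fun t => normTwist N ψ t x)
      (-(normTwist N ψ t x * (Real.log (N x) : ℂ))) t := by
    intro x t
    rcases eq_or_ne x 0 with rfl | hx
    · simpa using hasDerivAt_const t (0 : ℂ)
    have hpos : (0 : ℝ) < N x := by exact_mod_cast Nat.pos_of_ne_zero (hN x hx)
    have h := ((hasDerivAt_id t).neg.const_rpow hpos).ofReal_comp.const_mul (ψ x)
    refine h.congr_deriv ?_
    rw [normTwist_apply]
    simp
    ring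
  rw [← tsum_neg]
  refine hasDerivAt_tsum_of_isPreconnected (summable_norm_mul_rpow_mul_log hs hσ1)
    isOpen_Ioi isPreconnected_Ioi (fun x t _ => hder x t) ?_ (Set.mem_Ioi.2 hσ) ?_
    (Set.mem_Ioi.2 hσ)
  · intro x t ht
    rw [norm_neg, norm_mul, norm_normTwist, Complex.norm_real,
      Real.norm_of_nonneg (Real.log_natCast_nonneg _)]
    rcases Nat.eq_zero_or_pos (N x) with h0 | h0
    · simp [h0]
    have : (1 : ℝ) ≤ N x := by exact_mod_cast h0
    have h3 := Real.log_natCast_nonneg (N x)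
    gcongr
    exact (Set.mem_Ioi.1 ht).le
  · refine Summable.of_norm ?_
    simpa only [norm_normTwist] using hs s h1

end NormSeries

section NormSeries

variable {M : Type*} [CommMonoidWithZero M] {N : M →*₀ ℕ} {ψ : M →*₀ ℂ}

theorem tendsto_tsum_normTwist (hN : ∀ x, N x = 1 → x = 1)
    (hs : ∀ s : ℝ, 1 < s → Summable fun x => ‖ψ x‖ * (N x : ℝ) ^ (-s)) :
    Filter.Tendsto (fun s : ℝ => ∑' x, normTwist N ψ s x) Filter.atTop (nhds 1) := by
  classical
  have h1 : ∑' x : M, (if x = 1 then (1 : ℂ) else 0) = 1 := tsum_ite_eq 1 _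
  rw [← h1]
  refine tendsto_tsum_of_dominated_convergence (hs 2 one_lt_two) (fun x => ?_) ?_
  · by_cases hx : x = 1
    · simp [hx]
    rw [if_neg hx]
    rcases Nat.lt_trichotomy (N x) 1 with h | h | h
    · refine tendsto_const_nhds.congr' ?_
      filter_upwards [Filter.eventually_gt_atTop 0] with s hs0
      rw [normTwist_apply, Nat.lt_one_iff.1 h, Nat.cast_zero, Real.zero_rpow (by linarith)]
      simp
    · exact absurd (hN x h) hx
    · have h2 : Filter.Tendsto (fun s : ℝ => (N x : ℝ) ^ (-s)) Filter.atTop (nhds 0) := by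
        have h3 : (1 : ℝ) < N x := by exact_mod_cast h
        have := tendsto_rpow_atTop_of_base_gt_one _ h3
        have h4 := tendsto_rpow_atBot_of_base_gt_one _ h3
        exact h4.comp Filter.tendsto_neg_atTop_atBot
      have h3 := (Complex.continuous_ofReal.tendsto 0).comp h2
      simpa [normTwist_apply] using h3.const_mul (ψ x)
  · filter_upwards [Filter.eventually_ge_atTop 2] with s hs2 x
    rw [norm_normTwist]
    rcases Nat.eq_zero_or_pos (N x) with h0 | h0
    · rw [h0, Nat.cast_zero, Real.zero_rpow (by linarith), Real.zero_rpow (by norm_num)]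
    have : (1 : ℝ) ≤ N x := by exact_mod_cast h0
    gcongr

/-- The values of minus the logarithmic derivative of the Dirichlet series of `ψ`. -/
noncomputable def primeLogSeries (N : M →*₀ ℕ) (ψ : M →*₀ ℂ) (s : ℝ) : ℂ :=
  ∑' P : {P : M // Prime P}, Real.log (N P.1) *
    (normTwist N ψ s P.1 / (1 - normTwist N ψ s P.1))

theorem norm_normTwist_prime_le (hN1 : ∀ P, Prime P → 1 < N P) (hψ : ∀ x, ‖ψ x‖ ≤ 1) {s : ℝ}
    (hs : 1 < s) {P : M} (hP : Prime P) : ‖normTwist N ψ s P‖ ≤ 1 / 2 := by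
  rw [norm_normTwist]
  have h1 : (2 : ℝ) ≤ N P := by exact_mod_cast hN1 P hP
  calc ‖ψ P‖ * (N P : ℝ) ^ (-s) ≤ 1 * (N P : ℝ) ^ (-1 : ℝ) := by
        gcongr
        · exact hψ P
        · linarith
    _ ≤ 1 / 2 := by
        rw [one_mul, Real.rpow_neg_one, one_div]
        gcongr

theorem half_le_norm_one_sub {z : ℂ} (hz : ‖z‖ ≤ 1 / 2) : 1 / 2 ≤ ‖1 - z‖ := by
  have := norm_sub_norm_le (1 : ℂ) z
  rw [norm_one] at this
  linarith

theorem hasDerivAt_tsum_normTwist_eq_mul [UniqueFactorizationMonoid M] [Subsingleton Mˣ]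
    (hN : ∀ x, x ≠ 0 → N x ≠ 0) (hN1 : ∀ P, Prime P → 1 < N P) (hψ : ∀ x, ‖ψ x‖ ≤ 1)
    (hs : ∀ s : ℝ, 1 < s → Summable fun x => ‖ψ x‖ * (N x : ℝ) ^ (-s))
    {s : ℝ} (h1 : 1 < s) :
    HasDerivAt (fun s => ∑' x, normTwist N ψ s x)
      (-((∑' x, normTwist N ψ s x) * primeLogSeries N ψ s)) s := by
  rw [primeLogSeries, ← tsum_mul_log_eq_tsum_mul_tsum_prime N hN hN1]
  · exact hasDerivAt_tsum_normTwist hN hs h1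
  · refine Summable.of_norm ?_
    simpa only [norm_normTwist] using hs s h1
  · simpa only [norm_normTwist] using summable_norm_mul_rpow_mul_log hs h1
  · intro P hP h
    have := norm_normTwist_prime_le hN1 hψ h1 hP
    rw [h, norm_one] at this
    norm_num at this

theorem summable_prime_norm_mul_rpow_mul_log
    (hs : ∀ s : ℝ, 1 < s → Summable fun x => ‖ψ x‖ * (N x : ℝ) ^ (-s)) {s : ℝ} (h1 : 1 < s) :
    Summable fun P : {P : M // Prime P} =>
      ‖ψ P.1‖ * (N P.1 : ℝ) ^ (-s) * Real.log (N P.1) :=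
  (summable_norm_mul_rpow_mul_log hs h1).comp_injective Subtype.val_injective

theorem summable_primeLogSeries (hN1 : ∀ P, Prime P → 1 < N P) (hψ : ∀ x, ‖ψ x‖ ≤ 1)
    (hs : ∀ s : ℝ, 1 < s → Summable fun x => ‖ψ x‖ * (N x : ℝ) ^ (-s))
    {s : ℝ} (h1 : 1 < s) :
    Summable fun P : {P : M // Prime P} => (Real.log (N P.1) : ℂ) *
      (normTwist N ψ s P.1 / (1 - normTwist N ψ s P.1)) := by
  refine Summable.of_norm_bounded
    ((summable_prime_norm_mul_rpow_mul_log hs h1).mul_left 2) fun P => ?_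
  have h2 := half_le_norm_one_sub (norm_normTwist_prime_le hN1 hψ h1 P.2)
  have h3 := Real.log_natCast_nonneg (N P.1)
  rw [norm_mul, norm_div, Complex.norm_real, Real.norm_of_nonneg h3, ← norm_normTwist]
  calc Real.log (N P.1) * (‖normTwist N ψ s P.1‖ / ‖1 - normTwist N ψ s P.1‖)
      ≤ Real.log (N P.1) * (‖normTwist N ψ s P.1‖ / (1 / 2)) := by gcongr
    _ = _ := by ring

theorem norm_primeLogSeries_sub_le (hN1 : ∀ P, Prime P → 1 < N P) (hψ : ∀ x, ‖ψ x‖ ≤ 1)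
    (hs : ∀ s : ℝ, 1 < s → Summable fun x => ‖ψ x‖ * (N x : ℝ) ^ (-s))
    {s : ℝ} (h1 : 1 < s) :
    ‖primeLogSeries N ψ s -
      ∑' P : {P : M // Prime P}, (Real.log (N P.1) : ℂ) * normTwist N ψ s P.1‖ ≤
      2 * ∑' P : {P : M // Prime P}, ‖ψ P.1‖ * (N P.1 : ℝ) ^ (-2 : ℝ) * Real.log (N P.1) := by
  have hsum : Summable fun P : {P : M // Prime P} =>
      (Real.log (N P.1) : ℂ) * normTwist N ψ s P.1 := by
    refine Summable.of_norm_bounded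
      (summable_prime_norm_mul_rpow_mul_log hs h1) fun P => ?_
    have h3 := Real.log_natCast_nonneg (N P.1)
    rw [norm_mul, Complex.norm_real, Real.norm_of_nonneg h3, norm_normTwist]
    rw [mul_comm]
  rw [primeLogSeries, ← (summable_primeLogSeries hN1 hψ hs h1).tsum_sub hsum, ← tsum_mul_left]
  refine tsum_of_norm_bounded ((summable_prime_norm_mul_rpow_mul_log hs one_lt_two).mul_left 2).hasSum fun P => ?_
  have h2 := norm_normTwist_prime_le hN1 hψ h1 P.2
  have h3 := half_le_norm_one_sub h2
  have h4 := Real.log_natCast_nonneg (N P.1)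
  have h5 : 1 - normTwist N ψ s P.1 ≠ 0 := by
    intro h
    rw [h, norm_zero] at h3
    norm_num at h3
  have h6 : (Real.log (N P.1) : ℂ) * (normTwist N ψ s P.1 / (1 - normTwist N ψ s P.1))
      - (Real.log (N P.1) : ℂ) * normTwist N ψ s P.1
      = (Real.log (N P.1) : ℂ) * (normTwist N ψ s P.1 ^ 2 / (1 - normTwist N ψ s P.1)) := by
    field_simp
    ring
  have h7 : ‖normTwist N ψ s P.1‖ ^ 2 ≤ ‖ψ P.1‖ * (N P.1 : ℝ) ^ (-2 : ℝ) := by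
    have h8 : (1 : ℝ) ≤ N P.1 := by exact_mod_cast (hN1 _ P.2).le
    rw [norm_normTwist, mul_pow, ← Real.rpow_natCast, ← Real.rpow_natCast,
      ← Real.rpow_mul (by positivity), Real.rpow_natCast]
    have h9 : ‖ψ P.1‖ ^ 2 ≤ ‖ψ P.1‖ := by
      nlinarith [hψ P.1, norm_nonneg (ψ P.1)]
    gcongr
    push_cast
    linarith
  rw [h6, norm_mul, norm_div, Complex.norm_real, Real.norm_of_nonneg h4, norm_pow]
  calc Real.log (N P.1) * (‖normTwist N ψ s P.1‖ ^ 2 / ‖1 - normTwist N ψ s P.1‖)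
      ≤ Real.log (N P.1) * ((‖ψ P.1‖ * (N P.1 : ℝ) ^ (-2 : ℝ)) / (1 / 2)) := by gcongr
    _ = _ := by ring

end NormSeries

section NormSeries

variable {M : Type*} [CommMonoidWithZero M] {N : M →*₀ ℕ} {ψ ψ₀ ψ₂ : M →*₀ ℂ}

theorem re_three_four_one_primeLogSeries_nonneg (hN1 : ∀ P, Prime P → 1 < N P)
    (hψ : ∀ x, ψ x = 0 ∨ ‖ψ x‖ = 1) (hψ₀ : ∀ x, ψ₀ x = (‖ψ x‖ : ℂ)) (hψ₂ : ∀ x, ψ₂ x = ψ x ^ 2)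
    (hs : ∀ s : ℝ, 1 < s → Summable fun x => ‖ψ x‖ * (N x : ℝ) ^ (-s)) {s : ℝ} (h1 : 1 < s) :
    0 ≤ (3 * primeLogSeries N ψ₀ s + 4 * primeLogSeries N ψ s + primeLogSeries N ψ₂ s).re := by
  have hle : ∀ x, ‖ψ x‖ ≤ 1 := fun x => by rcases hψ x with h | h <;> simp [h]
  have e0 : ∀ x, ‖ψ₀ x‖ = ‖ψ x‖ := fun x => by simp [hψ₀]
  have e2 : ∀ x, ‖ψ₂ x‖ = ‖ψ x‖ := fun x => by rcases hψ x with h | h <;> simp [hψ₂, h]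
  have s0 := (summable_primeLogSeries (ψ := ψ₀) hN1 (by simpa only [e0] using hle)
    (by simpa only [e0] using hs) h1).hasSum
  have s1 := (summable_primeLogSeries hN1 hle hs h1).hasSum
  have s2 := (summable_primeLogSeries (ψ := ψ₂) hN1 (by simpa only [e2] using hle)
    (by simpa only [e2] using hs) h1).hasSum
  refine (Complex.hasSum_re (((s0.mul_left 3).add (s1.mul_left 4)).add s2)).nonneg fun P => ?_
  have hN2 : (1 : ℝ) < N P.1 := by exact_mod_cast hN1 _ P.2
  have hlog := Real.log_natCast_nonneg (N P.1)
  simp only [normTwist_apply, hψ₀, hψ₂]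
  rcases hψ P.1 with h | h
  · simp [h]
  have hr : (N P.1 : ℝ) ^ (-s) < 1 := Real.rpow_lt_one_of_one_lt_of_neg hN2 (by linarith)
  have key := re_three_four_one_nonneg (by positivity) hr h
  rw [h]
  rw [show ∀ l a b c : ℂ, 3 * (l * a) + 4 * (l * b) + l * c = l * (3 * a + 4 * b + c) by
    intros; ring, Complex.re_ofReal_mul]
  refine mul_nonneg hlog ?_
  simpa only [mul_comm _ (((N P.1 : ℝ) ^ (-s) : ℝ) : ℂ), Complex.ofReal_one, mul_one] using key

variable [UniqueFactorizationMonoid M] [Subsingleton Mˣ]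

theorem exists_pos_le_norm_three_four_one (hN : ∀ x, x ≠ 0 → N x ≠ 0)
    (hN1 : ∀ P, Prime P → 1 < N P) (hNone : ∀ x, N x = 1 → x = 1)
    (hψ : ∀ x, ψ x = 0 ∨ ‖ψ x‖ = 1) (hψ₀ : ∀ x, ψ₀ x = (‖ψ x‖ : ℂ)) (hψ₂ : ∀ x, ψ₂ x = ψ x ^ 2)
    (hs : ∀ s : ℝ, 1 < s → Summable fun x => ‖ψ x‖ * (N x : ℝ) ^ (-s)) :
    ∃ δ > 0, ∀ s : ℝ, 1 < s → s ≤ 2 → δ ≤ ‖∑' x, normTwist N ψ₀ s x‖ ^ 3 *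
      ‖∑' x, normTwist N ψ s x‖ ^ 4 * ‖∑' x, normTwist N ψ₂ s x‖ := by
  have hle : ∀ x, ‖ψ x‖ ≤ 1 := fun x => by rcases hψ x with h | h <;> simp [h]
  have e0 : ∀ x, ‖ψ₀ x‖ = ‖ψ x‖ := fun x => by simp [hψ₀]
  have e2 : ∀ x, ‖ψ₂ x‖ = ‖ψ x‖ := fun x => by rcases hψ x with h | h <;> simp [hψ₂, h]
  have hle0 : ∀ x, ‖ψ₀ x‖ ≤ 1 := by simpa only [e0] using hle
  have hle2 : ∀ x, ‖ψ₂ x‖ ≤ 1 := by simpa only [e2] using hle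
  have hs0 : ∀ s : ℝ, 1 < s → Summable fun x => ‖ψ₀ x‖ * (N x : ℝ) ^ (-s) := by
    simpa only [e0] using hs
  have hs2 : ∀ s : ℝ, 1 < s → Summable fun x => ‖ψ₂ x‖ * (N x : ℝ) ^ (-s) := by
    simpa only [e2] using hs
  set Φ : ℝ → ℂ := fun s => (∑' x, normTwist N ψ₀ s x) ^ 3 * (∑' x, normTwist N ψ s x) ^ 4 *
    ∑' x, normTwist N ψ₂ s x with hΦ
  have hder : ∀ s : ℝ, 1 < s → HasDerivAt Φ (Φ s * -(3 * primeLogSeries N ψ₀ s +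
      4 * primeLogSeries N ψ s + primeLogSeries N ψ₂ s)) s := by
    intro s h1
    have h := (((hasDerivAt_tsum_normTwist_eq_mul hN hN1 hle0 hs0 h1).pow 3).mul
      ((hasDerivAt_tsum_normTwist_eq_mul hN hN1 hle hs h1).pow 4)).mul
      (hasDerivAt_tsum_normTwist_eq_mul hN hN1 hle2 hs2 h1)
    refine h.congr_deriv ?_
    simp only [hΦ, Pi.mul_apply, Pi.pow_apply]
    push_cast
    ring
  have hder2 : ∀ s : ℝ, 1 < s → HasDerivAt (fun s => ‖Φ s‖ ^ 2)
      (-(2 * ‖Φ s‖ ^ 2 * (3 * primeLogSeries N ψ₀ s +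
      4 * primeLogSeries N ψ s + primeLogSeries N ψ₂ s).re)) s := by
    intro s h1
    refine (hder s h1).norm_sq.congr_deriv ?_
    rw [Complex.inner, ← Complex.normSq_eq_norm_sq, mul_comm (Φ s), mul_assoc, Complex.mul_conj,
      Complex.re_mul_ofReal, Complex.neg_re]
    ring
  have hanti : AntitoneOn (fun s => ‖Φ s‖ ^ 2) (Set.Ioi 1) := by
    refine antitoneOn_of_deriv_nonpos (convex_Ioi 1)
      (fun s h1 => (hder2 s h1).continuousAt.continuousWithinAt)
      (fun s h1 => (hder2 s (by simpa using h1)).differentiableAt.differentiableWithinAt) ?_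
    intro s h1
    have h1 : 1 < s := by simpa using h1
    rw [(hder2 s h1).deriv, neg_nonpos]
    have := re_three_four_one_primeLogSeries_nonneg hN1 hψ hψ₀ hψ₂ hs h1
    positivity
  have hlim : Filter.Tendsto Φ Filter.atTop (nhds 1) := by
    have := (((tendsto_tsum_normTwist hNone hs0).pow 3).mul
      ((tendsto_tsum_normTwist hNone hs).pow 4)).mul (tendsto_tsum_normTwist hNone hs2)
    simpa using this
  obtain ⟨S, hS, hS2⟩ := ((hlim.eventually_ne one_ne_zero).and
    (Filter.eventually_ge_atTop 2)).exists
  refine ⟨‖Φ S‖, norm_pos_iff.2 hS, fun s h1 h2 => ?_⟩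
  rw [← norm_pow, ← norm_pow, ← norm_mul, ← norm_mul]
  exact (sq_le_sq₀ (norm_nonneg _) (norm_nonneg _)).1
    (hanti h1 (Set.mem_Ioi.2 (by linarith)) (h2.trans hS2))

/-- A non-vanishing theorem: if the Dirichlet series of `|ψ|` has at most a simple pole at `1`,
and those of `ψ` and `ψ ^ 2` are Lipschitz near `1`, then the sum over primes of `ψ` is bounded
near `1`. -/
theorem exists_norm_tsum_prime_normTwist_le (hN : ∀ x, x ≠ 0 → N x ≠ 0)
    (hN1 : ∀ P, Prime P → 1 < N P) (hNone : ∀ x, N x = 1 → x = 1)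
    (hψ : ∀ x, ψ x = 0 ∨ ‖ψ x‖ = 1) (hψ₀ : ∀ x, ψ₀ x = (‖ψ x‖ : ℂ)) (hψ₂ : ∀ x, ψ₂ x = ψ x ^ 2)
    (hs : ∀ s : ℝ, 1 < s → Summable fun x => ‖ψ x‖ * (N x : ℝ) ^ (-s))
    (h0 : ∃ C : ℝ, ∀ s : ℝ, 1 < s → s ≤ 2 →
      ∑' x, ‖ψ x‖ * (N x : ℝ) ^ (-s) ≤ C / (s - 1))
    (h1 : ∃ C : ℝ, ∀ s : ℝ, 1 < s → s ≤ 2 →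
      ‖∑' x, normTwist N ψ s x * (Real.log (N x) : ℂ)‖ ≤ C)
    (h2 : ∃ C : ℝ, ∀ s : ℝ, 1 < s → s ≤ 2 →
      ‖∑' x, normTwist N ψ₂ s x * (Real.log (N x) : ℂ)‖ ≤ C) :
    ∃ C : ℝ, ∃ δ > 0, ∀ s : ℝ, 1 < s → s < 1 + δ →
      ‖∑' P : {P : M // Prime P}, (Real.log (N P.1) : ℂ) * normTwist N ψ s P.1‖ ≤ C := by
  have hle : ∀ x, ‖ψ x‖ ≤ 1 := fun x => by rcases hψ x with h | h <;> simp [h]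
  have e0 : ∀ x, ‖ψ₀ x‖ = ‖ψ x‖ := fun x => by simp [hψ₀]
  have e2 : ∀ x, ‖ψ₂ x‖ = ‖ψ x‖ := fun x => by rcases hψ x with h | h <;> simp [hψ₂, h]
  have hs2 : ∀ s : ℝ, 1 < s → Summable fun x => ‖ψ₂ x‖ * (N x : ℝ) ^ (-s) := by
    simpa only [e2] using hs
  obtain ⟨C₀, hC₀⟩ := h0
  obtain ⟨C, hC⟩ := h1
  obtain ⟨C₂, hC₂⟩ := h2
  have hCn : 0 ≤ C := (norm_nonneg _).trans (hC 2 one_lt_two le_rfl)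
  have lip : ∀ (φ : M →*₀ ℂ) (K : ℝ),
      (∀ s : ℝ, 1 < s → Summable fun x => ‖φ x‖ * (N x : ℝ) ^ (-s)) →
      (∀ s : ℝ, 1 < s → s ≤ 2 → ‖∑' x, normTwist N φ s x * (Real.log (N x) : ℂ)‖ ≤ K) →
      ∀ s t : ℝ, 1 < s → s ≤ t → t ≤ 2 →
      ‖∑' x, normTwist N φ t x - ∑' x, normTwist N φ s x‖ ≤ K * (t - s) := by
    intro φ K hφ hK s t h1 h12 h2
    refine norm_image_sub_le_of_norm_deriv_le_segment'
      (f := fun s => ∑' x, normTwist N φ s x)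
      (f' := fun s => -∑' x, normTwist N φ s x * (Real.log (N x) : ℂ)) (a := s) (b := t)
      (fun u hu => (hasDerivAt_tsum_normTwist hN hφ (h1.trans_le hu.1)).hasDerivWithinAt)
      (fun u hu => ?_) t ⟨h12, le_rfl⟩
    rw [norm_neg]
    exact hK u (h1.trans_le hu.1) (hu.2.le.trans h2)
  obtain ⟨B₂, hB₂, hL₂⟩ : ∃ B > 0, ∀ s : ℝ, 1 < s → s ≤ 2 →
      ‖∑' x, normTwist N ψ₂ s x‖ ≤ B := by
    have hC₂n : 0 ≤ C₂ := (norm_nonneg _).trans (hC₂ 2 one_lt_two le_rfl)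
    refine ⟨‖∑' x, normTwist N ψ₂ 2 x‖ + C₂ + 1, by positivity, fun s h1 h2 => ?_⟩
    have := lip ψ₂ C₂ hs2 hC₂ s 2 h1 h2 le_rfl
    have h3 := norm_sub_norm_le (∑' x, normTwist N ψ₂ s x) (∑' x, normTwist N ψ₂ 2 x)
    rw [norm_sub_rev] at h3
    nlinarith
  obtain ⟨η, hη, hΦ⟩ := exists_pos_le_norm_three_four_one hN hN1 hNone hψ hψ₀ hψ₂ hs
  have hL0 : ∀ s : ℝ, 1 < s → s ≤ 2 → ‖∑' x, normTwist N ψ₀ s x‖ * (s - 1) ≤ |C₀| + 1 := by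
    intro s h1 h2
    have h3 : ‖∑' x, normTwist N ψ₀ s x‖ ≤ ∑' x, ‖ψ x‖ * (N x : ℝ) ^ (-s) := by
      refine tsum_of_norm_bounded (hs s h1).hasSum fun x => ?_
      rw [norm_normTwist, e0]
    have h4 := h3.trans (hC₀ s h1 h2)
    rw [le_div_iff₀ (by linarith)] at h4
    linarith [le_abs_self C₀]
  set A := |C₀| + 1 with hA
  have hApos : 0 < A := by positivity
  have hlow : ∀ t : ℝ, 1 < t → t ≤ 2 →
      η * (t - 1) ^ 3 ≤ A ^ 3 * B₂ * ‖∑' x, normTwist N ψ t x‖ ^ 4 := by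
    intro t h1 h2
    have h3 := hΦ t h1 h2
    have h4 : 0 < t - 1 := by linarith
    calc η * (t - 1) ^ 3 ≤ (‖∑' x, normTwist N ψ₀ t x‖ ^ 3 * ‖∑' x, normTwist N ψ t x‖ ^ 4 *
          ‖∑' x, normTwist N ψ₂ t x‖) * (t - 1) ^ 3 := by gcongr
      _ = (‖∑' x, normTwist N ψ₀ t x‖ * (t - 1)) ^ 3 * ‖∑' x, normTwist N ψ₂ t x‖ *
          ‖∑' x, normTwist N ψ t x‖ ^ 4 := by ring
      _ ≤ A ^ 3 * B₂ * ‖∑' x, normTwist N ψ t x‖ ^ 4 := by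
        gcongr
        · exact hL0 t h1 h2
        · exact hL₂ t h1 h2
  obtain ⟨K, hK, hKC⟩ : ∃ K : ℝ, 0 < K ∧ C ≤ K := ⟨C + 1, by positivity, by linarith⟩
  obtain ⟨ε, hε, hε1, hεη⟩ : ∃ ε : ℝ, 0 < ε ∧ ε ≤ 1 ∧ A ^ 3 * B₂ * (2 * K) ^ 4 * ε ≤ η := by
    refine ⟨min 1 (η / (A ^ 3 * B₂ * (2 * K) ^ 4)), by positivity, min_le_left _ _, ?_⟩
    rw [← le_div_iff₀' (by positivity)]
    exact min_le_right _ _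
  have hLt : 2 * K * ε ≤ ‖∑' x, normTwist N ψ (1 + ε) x‖ := by
    have h3 := hlow (1 + ε) (by linarith) (by linarith)
    rw [add_sub_cancel_left] at h3
    have h4 : A ^ 3 * B₂ * (2 * K * ε) ^ 4 ≤
        A ^ 3 * B₂ * ‖∑' x, normTwist N ψ (1 + ε) x‖ ^ 4 := by
      refine le_trans ?_ h3
      calc A ^ 3 * B₂ * (2 * K * ε) ^ 4 = (A ^ 3 * B₂ * (2 * K) ^ 4 * ε) * ε ^ 3 := by ring
        _ ≤ _ := by gcongr
    exact (pow_le_pow_iff_left₀ (by positivity) (norm_nonneg _) (by norm_num)).1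
      (le_of_mul_le_mul_left h4 (by positivity))
  refine ⟨1 / ε + 2 * ∑' P : {P : M // Prime P},
    ‖ψ P.1‖ * (N P.1 : ℝ) ^ (-2 : ℝ) * Real.log (N P.1), ε, hε, fun s h1 h2 => ?_⟩
  have h3 : K * ε ≤ ‖∑' x, normTwist N ψ s x‖ := by
    have h4 := lip ψ C hs hC s (1 + ε) h1 h2.le (by linarith)
    have h5 := norm_sub_norm_le (∑' x, normTwist N ψ (1 + ε) x) (∑' x, normTwist N ψ s x)
    nlinarith
  have h6 : ‖primeLogSeries N ψ s‖ ≤ 1 / ε := by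
    have h7 := (hasDerivAt_tsum_normTwist hN hs h1).unique
      (hasDerivAt_tsum_normTwist_eq_mul hN hN1 hle hs h1)
    have h8 := hC s h1 (by linarith)
    rw [neg_injective h7, norm_mul] at h8
    rw [le_div_iff₀ hε]
    have h9 : ‖primeLogSeries N ψ s‖ * (K * ε) ≤ K := by
      nlinarith [norm_nonneg (primeLogSeries N ψ s)]
    nlinarith
  have h10 := norm_primeLogSeries_sub_le hN1 hle hs h1
  have h11 := norm_sub_norm_le (∑' P : {P : M // Prime P},
    (Real.log (N P.1) : ℂ) * normTwist N ψ s P.1) (primeLogSeries N ψ s)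
  rw [norm_sub_rev] at h11
  linarith

end NormSeries

section PeriodicSums

theorem norm_sum_mul_sub_le {b β g I : ℕ → ℂ} {b₀ : ℂ} {B : ℝ} {K : ℕ → ℝ} {n : ℕ}
    (hβ : ∀ i, β (i + 1) - β i = b i - b₀) (hB : ∀ i, ‖β i‖ ≤ B) (hb₀ : ‖b₀‖ ≤ 1)
    (hI : ∀ i < n, ‖I i - g i‖ ≤ K i) (hg : ∀ i < n, ‖g (i + 1) - g i‖ ≤ K i) :
    ‖∑ i ∈ Finset.range n, b i * g i - b₀ * ∑ i ∈ Finset.range n, I i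
      - (β n * g n - β 0 * g 0)‖ ≤ (B + 1) * ∑ i ∈ Finset.range n, K i := by
  induction n with
  | zero => simp
  | succ n ih =>
    have h := ih (fun i hi => hI i (by omega)) (fun i hi => hg i (by omega))
    have e : ∑ i ∈ Finset.range (n + 1), b i * g i - b₀ * ∑ i ∈ Finset.range (n + 1), I i
        - (β (n + 1) * g (n + 1) - β 0 * g 0)
        = (∑ i ∈ Finset.range n, b i * g i - b₀ * ∑ i ∈ Finset.range n, I i
          - (β n * g n - β 0 * g 0)) - (β (n + 1) * (g (n + 1) - g n) + b₀ * (I n - g n)) := by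
      rw [Finset.sum_range_succ, Finset.sum_range_succ]
      linear_combination -g n * hβ n
    rw [e, Finset.sum_range_succ, mul_add]
    refine (norm_sub_le _ _).trans (add_le_add h ((norm_add_le _ _).trans ?_))
    rw [norm_mul, norm_mul]
    have h1 := hI n (by omega)
    have h2 := hg n (by omega)
    have h3 : 0 ≤ B := (norm_nonneg _).trans (hB 0)
    calc _ ≤ B * K n + 1 * K n := by
          gcongr
          exact hB _
      _ = _ := by ring

variable {Q : ℕ} [NeZero Q]

theorem ZMod.sum_range_add_natCast (a : ZMod Q → ℂ) (x : ZMod Q) :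
    ∑ i ∈ Finset.range Q, a (x + i) = ∑ r, a r := by
  rw [← Equiv.sum_comp (Equiv.addLeft x) a]
  refine Finset.sum_nbij (fun i : ℕ => (i : ZMod Q)) (fun _ _ => Finset.mem_univ _) ?_ ?_
    (fun _ _ => rfl)
  · intro i hi j hj h
    have h1 := congrArg ZMod.val h
    simp only at h1
    rwa [ZMod.val_natCast_of_lt (Finset.mem_range.1 hi),
      ZMod.val_natCast_of_lt (Finset.mem_range.1 hj)] at h1
  · intro r _
    exact ⟨r.val, Finset.mem_coe.2 (Finset.mem_range.2 (ZMod.val_lt r)), by simp⟩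

/-- The mean value of a function on `ZMod Q`. -/
noncomputable def zmodMean (a : ZMod Q → ℂ) : ℂ := (∑ r, a r) / Q

theorem norm_zmodMean_le {a : ZMod Q → ℂ} (ha : ∀ r, ‖a r‖ ≤ 1) : ‖zmodMean a‖ ≤ 1 := by
  have hQ : (0 : ℝ) < Q := by exact_mod_cast Nat.pos_of_neZero Q
  rw [zmodMean, norm_div, Complex.norm_natCast, div_le_one hQ]
  refine (norm_sum_le _ _).trans ((Finset.sum_le_sum fun r _ => ha r).trans ?_)
  simp [ZMod.card]

theorem exists_discrete_primitive {a : ZMod Q → ℂ} (ha : ∀ r, ‖a r‖ ≤ 1) (x : ZMod Q) :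
    ∃ β : ℕ → ℂ, β 0 = 0 ∧ (∀ i, β (i + 1) - β i = a (x + i) - zmodMean a) ∧
      ∀ i, ‖β i‖ ≤ 2 * Q := by
  have hQ : (Q : ℂ) ≠ 0 := by exact_mod_cast NeZero.ne Q
  refine ⟨fun n => ∑ i ∈ Finset.range n, (a (x + i) - zmodMean a), by simp,
    fun i => by simp only [Finset.sum_range_succ, add_sub_cancel_left], fun n => ?_⟩
  induction n using Nat.strong_induction_on with
  | _ n ih =>
    rcases lt_or_ge n Q with h | h
    · calc ‖∑ i ∈ Finset.range n, (a (x + i) - zmodMean a)‖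
          ≤ ∑ i ∈ Finset.range n, (2 : ℝ) := by
            refine (norm_sum_le _ _).trans (Finset.sum_le_sum fun i _ => ?_)
            have := norm_zmodMean_le ha
            linarith [norm_sub_le (a (x + i)) (zmodMean a), ha (x + i)]
        _ = n * 2 := by simp
        _ ≤ 2 * Q := by
            have : (n : ℝ) ≤ Q := by exact_mod_cast h.le
            linarith
    · obtain ⟨k, rfl⟩ := Nat.exists_eq_add_of_le h
      have h1 : ∑ i ∈ Finset.range (Q + k), (a (x + i) - zmodMean a)
          = ∑ i ∈ Finset.range k, (a (x + i) - zmodMean a) := by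
        rw [Finset.sum_range_add, Finset.sum_sub_distrib, ZMod.sum_range_add_natCast]
        simp [zmodMean]
        field_simp
        ring
      refine (congrArg norm h1).trans_le ?_
      exact ih k (by have := Nat.pos_of_neZero Q; omega)

theorem norm_sum_Icc_sub_integral_le {w K : ℝ} (hw : 0 < w) {a : ZMod Q → ℂ}
    (ha : ∀ r, ‖a r‖ ≤ 1) {φ : ℝ → ℂ} (hφ : ∀ u ∈ Set.Icc (-w) w, ‖φ u‖ ≤ K)
    (hlip : ∀ u ∈ Set.Icc (-w) w, ∀ v ∈ Set.Icc (-w) w, ‖φ u - φ v‖ ≤ K * |u - v|)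
    {X : ℕ} (hX : 0 < X) :
    ‖∑ Y ∈ Finset.Icc (-(⌊w * X⌋₊ : ℤ)) ⌊w * X⌋₊, a Y * φ (Y / X)
      - X * zmodMean a * ∫ u in (-w)..w, φ u‖ ≤ (2 * w * (2 * Q + 1) + 2 * Q + 3) * K := by
  have hX' : (0 : ℝ) < X := by exact_mod_cast hX
  have hK : 0 ≤ K := (norm_nonneg _).trans (hφ 0 ⟨by linarith, hw.le⟩)
  set M : ℕ := ⌊w * X⌋₊ with hM
  have hMw : (M : ℝ) ≤ w * X := Nat.floor_le (by positivity)
  have hwM : w * X < M + 1 := Nat.lt_floor_add_one _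
  set u : ℕ → ℝ := fun i => (-(M : ℝ) + i) / X with hu
  have hmem : ∀ i ≤ 2 * M, u i ∈ Set.Icc (-w) w := by
    intro i hi
    have : (i : ℝ) ≤ 2 * M := by exact_mod_cast hi
    have h0 : (0 : ℝ) ≤ i := by positivity
    simp only [hu]
    constructor
    · rw [le_div_iff₀ hX']; linarith
    · rw [div_le_iff₀ hX']; linarith
  have hstep : ∀ i, u (i + 1) - u i = 1 / X := by
    intro i
    simp only [hu]
    push_cast
    ring
  have hcont : ContinuousOn φ (Set.Icc (-w) w) := by
    have : LipschitzOnWith (Real.toNNReal K) φ (Set.Icc (-w) w) := by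
      refine LipschitzOnWith.of_dist_le_mul fun x hx y hy => ?_
      rw [dist_eq_norm, Real.dist_eq, Real.coe_toNNReal _ hK]
      exact hlip x hx y hy
    exact this.continuousOn
  have hcontInt : ∀ x ∈ Set.Icc (-w) w, ∀ y ∈ Set.Icc (-w) w,
      IntervalIntegrable φ MeasureTheory.volume x y := fun x hx y hy =>
    (hcont.mono (Set.uIcc_subset_Icc hx hy)).intervalIntegrable
  obtain ⟨β, hβ0, hβ, hβB⟩ := exists_discrete_primitive ha ((-(M : ℤ) : ℤ) : ZMod Q)
  have hsum : ∑ Y ∈ Finset.Icc (-(M : ℤ)) M, a Y * φ (Y / X)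
      = ∑ i ∈ Finset.range (2 * M + 1), a (((-(M : ℤ) : ℤ) : ZMod Q) + i) * φ (u i) := by
    symm
    refine Finset.sum_nbij (fun i : ℕ => -(M : ℤ) + i) ?_ ?_ ?_ ?_
    · intro i hi
      have := Finset.mem_range.1 hi
      rw [Finset.mem_Icc]
      omega
    · intro i _ j _ h
      simpa using h
    · intro Y hY
      have := Finset.mem_Icc.1 (Finset.mem_coe.1 hY)
      refine ⟨(Y + M).toNat, ?_, ?_⟩
      · rw [Finset.mem_coe, Finset.mem_range]
        omega
      · simp only
        omega
    · intro i _
      simp only [hu]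
      push_cast
      rfl
  have key := norm_sum_mul_sub_le (n := 2 * M) (g := fun i => φ (u i))
    (I := fun i => X * ∫ t in (u i)..(u (i + 1)), φ t) (K := fun _ => K / X)
    hβ hβB (norm_zmodMean_le ha) ?_ ?_
  · rw [Finset.sum_const, Finset.card_range, ← Finset.mul_sum,
      intervalIntegral.sum_integral_adjacent_intervals (fun i hi => hcontInt _ (hmem _ (by omega))
        _ (hmem _ (by omega))), hβ0, zero_mul, sub_zero] at key
    have hu0 : u 0 = -(M / X) := by simp [hu, neg_div]
    have hun : u (2 * M) = M / X := by simp [hu]; ring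
    have hsplit : ∫ t in (-w)..w, φ t = (∫ t in (-w)..(u 0), φ t) + (∫ t in (u 0)..(u (2 * M)), φ t)
        + ∫ t in (u (2 * M))..w, φ t := by
      have m0 := hmem 0 (by omega)
      have m1 := hmem (2 * M) le_rfl
      have mw : w ∈ Set.Icc (-w) w := ⟨by linarith, le_rfl⟩
      have mw' : -w ∈ Set.Icc (-w) w := ⟨le_rfl, by linarith⟩
      rw [intervalIntegral.integral_add_adjacent_intervals (hcontInt _ mw' _ m0) (hcontInt _ m0 _ m1),
        intervalIntegral.integral_add_adjacent_intervals (hcontInt _ mw' _ m1) (hcontInt _ m1 _ mw)]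
    have hXw : X * (w - M / X) ≤ 1 := by
      rw [mul_sub, mul_div_cancel₀ _ hX'.ne']
      linarith
    have hMX : (M : ℝ) / X ≤ w := by rwa [div_le_iff₀ hX']
    have hMX0 : (0 : ℝ) ≤ M / X := by positivity
    have e1 : ‖∫ t in (-w)..(u 0), φ t‖ ≤ K * (w - M / X) := by
      refine (intervalIntegral.norm_integral_le_of_norm_le_const (C := K) fun t ht => ?_).trans_eq ?_
      · rw [hu0, Set.uIoc_of_le (by linarith)] at ht
        exact hφ t ⟨ht.1.le, by linarith [ht.2]⟩
      · rw [hu0, abs_of_nonneg (by linarith)]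
        ring
    have e2 : ‖∫ t in (u (2 * M))..w, φ t‖ ≤ K * (w - M / X) := by
      refine (intervalIntegral.norm_integral_le_of_norm_le_const (C := K) fun t ht => ?_).trans_eq ?_
      · rw [hun, Set.uIoc_of_le (by linarith)] at ht
        exact hφ t ⟨by linarith [ht.1], ht.2⟩
      · rw [hun, abs_of_nonneg (by linarith)]
    rw [hsum, Finset.sum_range_succ]
    have hmean := norm_zmodMean_le ha
    set S := ∑ i ∈ Finset.range (2 * M), a (((-(M : ℤ) : ℤ) : ZMod Q) + i) * φ (u i)
    set J := ∫ t in (u 0)..(u (2 * M)), φ t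
    have hdecomp : S + a (((-(M : ℤ) : ℤ) : ZMod Q) + (2 * M : ℕ)) * φ (u (2 * M))
        - X * zmodMean a * ∫ t in (-w)..w, φ t
        = (S - zmodMean a * (X * J) - β (2 * M) * φ (u (2 * M)))
          + (a (((-(M : ℤ) : ℤ) : ZMod Q) + (2 * M : ℕ)) + β (2 * M)) * φ (u (2 * M))
          - X * zmodMean a * ((∫ t in (-w)..(u 0), φ t) + ∫ t in (u (2 * M))..w, φ t) := by
      rw [hsplit]
      ring
    rw [hdecomp]
    have t1 : ‖(a (((-(M : ℤ) : ℤ) : ZMod Q) + (2 * M : ℕ)) + β (2 * M)) * φ (u (2 * M))‖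
        ≤ (1 + 2 * Q) * K := by
      rw [norm_mul]
      exact mul_le_mul ((norm_add_le _ _).trans (add_le_add (ha _) (hβB _)))
        (hφ _ (hmem _ le_rfl)) (norm_nonneg _) (by positivity)
    have t2 : ‖(X : ℂ) * zmodMean a *
        ((∫ t in (-w)..(u 0), φ t) + ∫ t in (u (2 * M))..w, φ t)‖ ≤ 2 * K := by
      rw [norm_mul, norm_mul, Complex.norm_natCast]
      calc (X : ℝ) * ‖zmodMean a‖ * ‖(∫ t in (-w)..(u 0), φ t) + ∫ t in (u (2 * M))..w, φ t‖
          ≤ X * 1 * (K * (w - M / X) + K * (w - M / X)) := by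
            gcongr
            exact (norm_add_le _ _).trans (add_le_add e1 e2)
        _ = 2 * K * (X * (w - M / X)) := by ring
        _ ≤ 2 * K * 1 := by gcongr
        _ = 2 * K := by ring
    have t3 : (2 * (Q : ℝ) + 1) * ((2 * M) • (K / X)) ≤ 2 * w * (2 * Q + 1) * K := by
      rw [nsmul_eq_mul]
      push_cast
      calc (2 * (Q : ℝ) + 1) * (2 * M * (K / X)) = (2 * Q + 1) * 2 * K * (M / X) := by ring
        _ ≤ (2 * Q + 1) * 2 * K * w := by gcongr
        _ = _ := by ring
    refine (norm_sub_le _ _).trans ((add_le_add (norm_add_le _ _) le_rfl).trans ?_)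
    linarith
  · intro i hi
    have h1 : (X : ℂ) * (∫ t in (u i)..(u (i + 1)), φ t) - φ (u i)
        = X * ∫ t in (u i)..(u (i + 1)), (φ t - φ (u i)) := by
      rw [intervalIntegral.integral_sub (hcontInt _ (hmem _ (by omega)) _ (hmem _ (by omega)))
        intervalIntegrable_const, intervalIntegral.integral_const, hstep, mul_sub]
      congr 1
      rw [Complex.real_smul]
      have hXC : (X : ℂ) ≠ 0 := by exact_mod_cast hX.ne'
      push_cast
      field_simp
    rw [h1, norm_mul, Complex.norm_natCast]
    have h2 : u i ≤ u (i + 1) := by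
      have := hstep i
      have h3 : (0 : ℝ) < 1 / X := by positivity
      linarith
    have h4 : ‖∫ t in (u i)..(u (i + 1)), (φ t - φ (u i))‖ ≤ K * (1 / X) * |u (i + 1) - u i| := by
      refine intervalIntegral.norm_integral_le_of_norm_le_const fun t ht => ?_
      rw [Set.uIoc_of_le h2] at ht
      have m1 := hmem i (by omega)
      have m2 := hmem (i + 1) (by omega)
      refine (hlip t ⟨by linarith [m1.1, ht.1], by linarith [m2.2, ht.2]⟩ _ m1).trans ?_
      rw [abs_of_nonneg (by linarith [ht.1]), ← hstep i]
      gcongr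
      exact ht.2
    rw [hstep, abs_of_nonneg (by positivity)] at h4
    calc (X : ℝ) * ‖∫ t in (u i)..(u (i + 1)), (φ t - φ (u i))‖
        ≤ X * (K * (1 / X) * (1 / X)) := by gcongr
      _ = K / X := by field_simp
  · intro i hi
    refine (hlip _ (hmem _ (by omega)) _ (hmem _ (by omega))).trans_eq ?_
    rw [hstep, abs_of_nonneg (by positivity)]
    ring

end PeriodicSums

section PeriodicSums

open Filter

variable {Q : ℕ} [NeZero Q]

theorem norm_tsum_zmod_mul_sub_le {a : ZMod Q → ℂ} (ha : ∀ r, ‖a r‖ ≤ 1) {G g g' : ℝ → ℝ}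
    {K G' : ℝ} (hG : ∀ x, 1 ≤ x → HasDerivAt G (g x) x) (hg : ∀ x, 1 ≤ x → HasDerivAt g (g' x) x)
    (hK : ∀ x, 1 ≤ x → |g' x| ≤ K * x ^ (-(3 / 2) : ℝ)) (hG1 : G 1 = 0)
    (hGlim : Tendsto G atTop (nhds G')) (hglim : Tendsto g atTop (nhds 0))
    (hsum : Summable fun i : ℕ => a ((i + 1 : ℕ) : ZMod Q) * (g (i + 1 : ℕ) : ℂ)) :
    ‖∑' i : ℕ, a ((i + 1 : ℕ) : ZMod Q) * (g (i + 1 : ℕ) : ℂ) - zmodMean a * G'‖ ≤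
      (2 * Q + 1) * (K * ∑' i : ℕ, ((i + 1 : ℕ) : ℝ) ^ (-(3 / 2) : ℝ)) := by
  have hK0 : 0 ≤ K := by simpa using (abs_nonneg _).trans (hK 1 le_rfl)
  obtain ⟨β, hβ0, hβ, hβB⟩ := exists_discrete_primitive ha 1
  have hnear : ∀ i : ℕ, ∀ x ∈ Set.Icc ((i + 1 : ℕ) : ℝ) ((i + 1 : ℕ) + 1),
      |g x - g (i + 1 : ℕ)| ≤ K * ((i + 1 : ℕ) : ℝ) ^ (-(3 / 2) : ℝ) := by
    intro i x hx
    have hi : (1 : ℝ) ≤ ((i + 1 : ℕ) : ℝ) := by simp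
    have := norm_image_sub_le_of_norm_deriv_le_segment' (f := g) (f' := g')
      (a := ((i + 1 : ℕ) : ℝ)) (b := (i + 1 : ℕ) + 1)
      (C := K * ((i + 1 : ℕ) : ℝ) ^ (-(3 / 2) : ℝ))
      (fun y hy => (hg y (hi.trans hy.1)).hasDerivWithinAt) (fun y hy => by
        refine (hK y (hi.trans hy.1)).trans (mul_le_mul_of_nonneg_left ?_ hK0)
        exact Real.rpow_le_rpow_of_nonpos (by linarith) hy.1 (by norm_num)) x hx
    rw [Real.norm_eq_abs] at this
    refine this.trans (mul_le_of_le_one_right (by positivity) (by linarith [hx.2]))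
  have hsumK : Summable fun i : ℕ => ((i + 1 : ℕ) : ℝ) ^ (-(3 / 2) : ℝ) :=
    (summable_nat_add_iff 1).2 (Real.summable_nat_rpow.2 (by norm_num))
  have key : ∀ n : ℕ, ‖∑ i ∈ Finset.range n, a ((i + 1 : ℕ) : ZMod Q) * (g (i + 1 : ℕ) : ℂ)
      - zmodMean a * G (n + 1 : ℕ) - β n * g (n + 1 : ℕ)‖ ≤
      (2 * Q + 1) * (K * ∑' i : ℕ, ((i + 1 : ℕ) : ℝ) ^ (-(3 / 2) : ℝ)) := by
    intro n
    have h := norm_sum_mul_sub_le (n := n) (g := fun i => (g (i + 1 : ℕ) : ℂ))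
      (I := fun i => ((G ((i + 1 : ℕ) + 1) - G (i + 1 : ℕ) : ℝ) : ℂ))
      (K := fun i => K * ((i + 1 : ℕ) : ℝ) ^ (-(3 / 2) : ℝ)) hβ hβB (norm_zmodMean_le ha) ?_ ?_
    · have h1 : ∑ i ∈ Finset.range n, ((G ((i + 1 : ℕ) + 1) - G (i + 1 : ℕ) : ℝ) : ℂ)
          = G (n + 1 : ℕ) := by
        rw [← Complex.ofReal_sum]
        have := Finset.sum_range_sub (fun i : ℕ => G ((i + 1 : ℕ))) n
        simp only [zero_add, Nat.cast_one, hG1, sub_zero] at this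
        rw [← this]
        congr 1
        refine Finset.sum_congr rfl fun i _ => ?_
        push_cast
        rfl
      rw [h1, hβ0, zero_mul, sub_zero] at h
      have h2 : ∑ i ∈ Finset.range n, a (1 + (i : ZMod Q)) * (g (i + 1 : ℕ) : ℂ)
          = ∑ i ∈ Finset.range n, a ((i + 1 : ℕ) : ZMod Q) * (g (i + 1 : ℕ) : ℂ) := by
        refine Finset.sum_congr rfl fun i _ => ?_
        rw [show 1 + (i : ZMod Q) = ((i + 1 : ℕ) : ZMod Q) by push_cast; ring]
      rw [h2] at h
      refine h.trans ?_
      rw [← Finset.mul_sum]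
      gcongr
      exact hsumK.sum_le_tsum _ (fun i _ => by positivity)
    · intro i _
      have hi : (1 : ℝ) ≤ ((i + 1 : ℕ) : ℝ) := by simp
      rw [← Complex.ofReal_sub, Complex.norm_real]
      have := norm_image_sub_le_of_norm_deriv_le_segment'
        (f := fun x => G x - x * g (i + 1 : ℕ)) (f' := fun x => g x - g (i + 1 : ℕ))
        (a := ((i + 1 : ℕ) : ℝ)) (b := (i + 1 : ℕ) + 1)
        (C := K * ((i + 1 : ℕ) : ℝ) ^ (-(3 / 2) : ℝ))
        (fun y hy => ((hG y (hi.trans hy.1)).sub (by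
          simpa using (hasDerivAt_id y).mul_const (g (i + 1 : ℕ)))).hasDerivWithinAt)
        (fun y hy => hnear i y ⟨hy.1, hy.2.le⟩) ((i + 1 : ℕ) + 1) ⟨by linarith, le_rfl⟩
      refine le_trans (le_of_eq ?_) (this.trans_eq (by ring))
      congr 1
      ring
    · intro i _
      rw [← Complex.ofReal_sub, Complex.norm_real]
      have := hnear i (((i + 1 : ℕ) : ℝ) + 1) ⟨by linarith, le_rfl⟩
      rw [Real.norm_eq_abs]
      push_cast at this ⊢
      exact this
  have htop : Tendsto (fun n : ℕ => ((n + 1 : ℕ) : ℝ)) atTop atTop :=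
    tendsto_natCast_atTop_atTop.comp (tendsto_add_atTop_nat 1)
  have l1 : Tendsto (fun n : ℕ => zmodMean a * (G (n + 1 : ℕ) : ℂ)) atTop
      (nhds (zmodMean a * G')) :=
    ((Complex.continuous_ofReal.tendsto _).comp (hGlim.comp htop)).const_mul _
  have l2 : Tendsto (fun n : ℕ => β n * (g (n + 1 : ℕ) : ℂ)) atTop (nhds 0) := by
    refine squeeze_zero_norm (a := fun n : ℕ => 2 * Q * |g (n + 1 : ℕ)|) (fun n => ?_) ?_
    · rw [norm_mul, Complex.norm_real, Real.norm_eq_abs]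
      gcongr
      exact hβB n
    · simpa using ((hglim.comp htop).abs).const_mul (2 * (Q : ℝ))
  have l3 := ((hsum.hasSum.tendsto_sum_nat.sub l1).sub l2).norm
  rw [sub_zero] at l3
  exact le_of_tendsto l3 (Eventually.of_forall key)

end PeriodicSums

section PeriodicSums

open Filter

variable {Q : ℕ} [NeZero Q]

/-- The constant in the comparison of a sum over the positive integers with an integral. -/
noncomputable def zmodSumConst (Q : ℕ) : ℝ :=
  (2 * Q + 1) * (14 * ∑' i : ℕ, ((i + 1 : ℕ) : ℝ) ^ (-(3 / 2) : ℝ))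

theorem rpow_neg_two_mul_log_le {x : ℝ} (hx : 1 ≤ x) :
    x ^ (-2 : ℝ) * Real.log x ≤ 2 * x ^ (-(3 / 2) : ℝ) := by
  have hx0 : 0 < x := by linarith
  have h := Real.log_le_rpow_div hx0.le (show (0 : ℝ) < 1 / 2 by norm_num)
  calc x ^ (-2 : ℝ) * Real.log x ≤ x ^ (-2 : ℝ) * (x ^ (1 / 2 : ℝ) / (1 / 2)) := by gcongr
    _ = 2 * (x ^ (-2 : ℝ) * x ^ (1 / 2 : ℝ)) := by ring
    _ = _ := by
      rw [← Real.rpow_add hx0]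
      norm_num

theorem hasDerivAt_rpow_of_one_le {x : ℝ} (hx : 1 ≤ x) (r : ℝ) :
    HasDerivAt (fun x => x ^ r) (r * x ^ (r - 1)) x :=
  Real.hasDerivAt_rpow_const (Or.inl (by linarith))

theorem norm_tsum_zmod_mul_rpow_sub_le {a : ZMod Q → ℂ} (ha : ∀ r, ‖a r‖ ≤ 1) {s : ℝ}
    (h1 : 1 < s) (h2 : s ≤ 2)
    (hsum : Summable fun i : ℕ =>
      a ((i + 1 : ℕ) : ZMod Q) * (((i + 1 : ℕ) : ℝ) ^ (1 - 2 * s) : ℝ)) :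
    ‖∑' i : ℕ, a ((i + 1 : ℕ) : ZMod Q) * (((i + 1 : ℕ) : ℝ) ^ (1 - 2 * s) : ℝ)
      - zmodMean a * (1 / (2 * (s - 1)) : ℝ)‖ ≤ zmodSumConst Q := by
  have hs0 : s - 1 ≠ 0 := by linarith
  refine norm_tsum_zmod_mul_sub_le ha (g := fun x => x ^ (1 - 2 * s))
    (G := fun x => (1 - x ^ (2 - 2 * s)) / (2 * (s - 1)))
    (g' := fun x => (1 - 2 * s) * x ^ (1 - 2 * s - 1)) (K := 14) ?_
    (fun x hx => hasDerivAt_rpow_of_one_le hx _) ?_ (by simp) ?_ ?_ hsum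
  · intro x hx
    refine (((hasDerivAt_rpow_of_one_le hx (2 - 2 * s)).const_sub 1).div_const _).congr_deriv ?_
    rw [show 2 - 2 * s - 1 = 1 - 2 * s by ring]
    field_simp
    ring
  · intro x hx
    rw [abs_mul, abs_of_nonneg (Real.rpow_nonneg (by linarith) _)]
    refine mul_le_mul (abs_le.2 ⟨by linarith, by linarith⟩)
      (Real.rpow_le_rpow_of_exponent_le hx (by linarith)) (Real.rpow_nonneg (by linarith) _)
      (by norm_num)
  · have := (tendsto_rpow_neg_atTop (show 0 < 2 * s - 2 by linarith)).const_sub 1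
    have h3 := this.div_const (2 * (s - 1))
    rw [sub_zero] at h3
    simpa only [neg_sub] using h3
  · simpa only [neg_sub] using tendsto_rpow_neg_atTop (show 0 < 2 * s - 1 by linarith)

theorem tendsto_log_mul_rpow_neg_atTop {r : ℝ} (hr : 0 < r) :
    Tendsto (fun x => Real.log x * x ^ (-r)) atTop (nhds 0) := by
  refine (isLittleO_log_rpow_atTop hr).tendsto_div_nhds_zero.congr' ?_
  filter_upwards [eventually_gt_atTop 0] with x hx
  rw [Real.rpow_neg hx.le, div_eq_mul_inv]

theorem norm_tsum_zmod_mul_log_mul_rpow_sub_le {a : ZMod Q → ℂ} (ha : ∀ r, ‖a r‖ ≤ 1) {s : ℝ}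
    (h1 : 1 < s) (h2 : s ≤ 2)
    (hsum : Summable fun i : ℕ => a ((i + 1 : ℕ) : ZMod Q) *
      (2 * Real.log (i + 1 : ℕ) * ((i + 1 : ℕ) : ℝ) ^ (1 - 2 * s) : ℝ)) :
    ‖∑' i : ℕ, a ((i + 1 : ℕ) : ZMod Q) *
      (2 * Real.log (i + 1 : ℕ) * ((i + 1 : ℕ) : ℝ) ^ (1 - 2 * s) : ℝ)
      - zmodMean a * (1 / (2 * (s - 1) ^ 2) : ℝ)‖ ≤ zmodSumConst Q := by
  have hs0 : s - 1 ≠ 0 := by linarith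
  refine norm_tsum_zmod_mul_sub_le ha (g := fun x => 2 * Real.log x * x ^ (1 - 2 * s))
    (G := fun x => (1 - x ^ (2 - 2 * s) * (1 + 2 * (s - 1) * Real.log x)) / (2 * (s - 1) ^ 2))
    (g' := fun x => (2 + 2 * (1 - 2 * s) * Real.log x) * x ^ (- 2 * s)) (K := 14) ?_ ?_ ?_
    (by simp) ?_ ?_ hsum
  · intro x hx
    have hx0 : 0 < x := by linarith
    have hlog := (((Real.hasDerivAt_log hx0.ne').const_mul (2 * (s - 1))).const_add 1)
    refine ((((hasDerivAt_rpow_of_one_le hx (2 - 2 * s)).mul hlog).const_sub 1).div_const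
      _).congr_deriv ?_
    rw [show 2 - 2 * s - 1 = 1 - 2 * s by ring, show 2 - 2 * s = (1 - 2 * s) + 1 by ring,
      Real.rpow_add_one hx0.ne']
    field_simp
    ring
  · intro x hx
    have hx0 : 0 < x := by linarith
    refine (((Real.hasDerivAt_log hx0.ne').const_mul 2).mul
      (hasDerivAt_rpow_of_one_le hx (1 - 2 * s))).congr_deriv ?_
    rw [show 1 - 2 * s - 1 = -2 * s by ring, show 1 - 2 * s = -2 * s + 1 by ring,
      Real.rpow_add_one hx0.ne']
    field_simp
  · intro x hx
    have hx0 : 0 < x := by linarith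
    have hl := Real.log_nonneg hx
    have h3 := rpow_neg_two_mul_log_le hx
    rw [abs_mul, abs_of_nonneg (Real.rpow_nonneg hx0.le _)]
    have h4 : |2 + 2 * (1 - 2 * s) * Real.log x| ≤ 2 + 6 * Real.log x :=
      abs_le.2 ⟨by nlinarith, by nlinarith⟩
    calc _ ≤ (2 + 6 * Real.log x) * x ^ (-2 : ℝ) :=
          mul_le_mul h4 (Real.rpow_le_rpow_of_exponent_le hx (by linarith))
            (Real.rpow_nonneg hx0.le _) (by positivity)
      _ = 2 * x ^ (-2 : ℝ) + 6 * (x ^ (-2 : ℝ) * Real.log x) := by ring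
      _ ≤ 2 * x ^ (-(3 / 2) : ℝ) + 6 * (2 * x ^ (-(3 / 2) : ℝ)) := by
        gcongr
        norm_num
      _ = _ := by ring
  · have hr : 0 < 2 * s - 2 := by linarith
    have h3 := (((tendsto_rpow_neg_atTop hr).add
      ((tendsto_log_mul_rpow_neg_atTop hr).const_mul (2 * (s - 1)))).const_sub 1).div_const
      (2 * (s - 1) ^ 2)
    rw [mul_zero, add_zero, sub_zero] at h3
    refine h3.congr fun x => ?_
    rw [neg_sub]
    ring
  · have h3 := (tendsto_log_mul_rpow_neg_atTop (show 0 < 2 * s - 1 by linarith)).const_mul 2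
    rw [mul_zero] at h3
    refine h3.congr fun x => ?_
    rw [neg_sub]
    ring

end PeriodicSums

section ConeSums

variable {Q : ℕ} [NeZero Q]

theorem norm_exp_neg_mul_one_add_sub_one_le {z : ℝ} : |Real.exp (-z) * (1 + z) - 1| ≤
    z ^ 2 * Real.exp |z| := by
  have h1 := Real.add_one_le_exp z
  have h2 := Real.add_one_le_exp (-z)
  have h3 : Real.exp (-z) * (1 + z) ≤ 1 := by
    calc _ ≤ Real.exp (-z) * Real.exp z := by gcongr; linarith
      _ = 1 := by rw [← Real.exp_add]; simp
  rw [abs_of_nonpos (by linarith)]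
  have h4 : 1 ≤ Real.exp |z| := Real.one_le_exp (abs_nonneg z)
  rcases le_or_gt (-1) z with hz | hz
  · have : (1 - z) * (1 + z) ≤ Real.exp (-z) * (1 + z) := by
      apply mul_le_mul_of_nonneg_right _ (by linarith)
      linarith
    nlinarith [sq_nonneg z]
  · rw [abs_of_neg (by linarith)] at h4 ⊢
    nlinarith [Real.exp_pos (-z)]

theorem summable_nat_add_one_rpow {r : ℝ} (hr : r < -1) :
    Summable fun i : ℕ => ((i + 1 : ℕ) : ℝ) ^ r :=
  (summable_nat_add_iff 1).2 (Real.summable_nat_rpow.2 hr)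

theorem summable_log_mul_nat_add_one_rpow {r : ℝ} (hr : r < -1) :
    Summable fun i : ℕ => 2 * Real.log (i + 1 : ℕ) * ((i + 1 : ℕ) : ℝ) ^ r := by
  obtain ⟨t, ht1, ht⟩ := exists_between hr
  refine Summable.of_nonneg_of_le (fun i => by
      have := Real.log_natCast_nonneg (i + 1)
      positivity) (fun i => ?_)
    ((summable_nat_add_one_rpow ht).mul_left (2 / (t - r)))
  have hi : (0 : ℝ) < ((i + 1 : ℕ) : ℝ) := by positivity
  have h := Real.log_le_rpow_div hi.le (sub_pos.2 ht1)
  calc _ ≤ 2 * (((i + 1 : ℕ) : ℝ) ^ (t - r) / (t - r)) * ((i + 1 : ℕ) : ℝ) ^ r := by gcongr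
    _ = 2 / (t - r) * (((i + 1 : ℕ) : ℝ) ^ (t - r) * ((i + 1 : ℕ) : ℝ) ^ r) := by ring
    _ = _ := by
      rw [← Real.rpow_add hi]
      ring_nf

theorem norm_image_sub_le_mul_abs {w C : ℝ} {φ φ' : ℝ → ℂ}
    (hd : ∀ u ∈ Set.Icc (-w) w, HasDerivAt φ (φ' u) u)
    (hb : ∀ u ∈ Set.Icc (-w) w, ‖φ' u‖ ≤ C) :
    ∀ u ∈ Set.Icc (-w) w, ∀ v ∈ Set.Icc (-w) w, ‖φ u - φ v‖ ≤ C * |u - v| := by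
  intro u hu v hv
  rw [← Real.norm_eq_abs]
  exact (convex_Icc (-w) w).norm_image_sub_le_of_norm_hasDerivWithin_le
    (fun x hx => (hd x hx).hasDerivWithinAt) hb hv hu

theorem exists_norm_tsum_cone_le_of_profiles {w E B : ℝ} (hw : 0 < w) {φ₀ φ₁ : ℝ → ℝ → ℂ}
    (hφ₀ : ∀ s : ℝ, 1 < s → s ≤ 2 → ∀ u ∈ Set.Icc (-w) w, ‖φ₀ s u‖ ≤ E)
    (hφ₁ : ∀ s : ℝ, 1 < s → s ≤ 2 → ∀ u ∈ Set.Icc (-w) w, ‖φ₁ s u‖ ≤ E)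
    (hlip₀ : ∀ s : ℝ, 1 < s → s ≤ 2 → ∀ u ∈ Set.Icc (-w) w, ∀ v ∈ Set.Icc (-w) w,
      ‖φ₀ s u - φ₀ s v‖ ≤ E * |u - v|)
    (hlip₁ : ∀ s : ℝ, 1 < s → s ≤ 2 → ∀ u ∈ Set.Icc (-w) w, ∀ v ∈ Set.Icc (-w) w,
      ‖φ₁ s u - φ₁ s v‖ ≤ E * |u - v|)
    (hcontInt : ∀ s : ℝ, 1 < s → s ≤ 2 →
      ‖(∫ u in (-w)..w, φ₀ s u) + (s - 1 : ℝ) * ∫ u in (-w)..w, φ₁ s u‖ ≤ B * (s - 1) ^ 2)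
    {a : ZMod Q → ZMod Q → ℂ} (ha : ∀ x y, ‖a x y‖ ≤ 1) :
    ∃ C : ℝ, ∀ s : ℝ, 1 < s → s ≤ 2 →
      ‖∑' i : ℕ, ∑ Y ∈ Finset.Icc (-(⌊w * (i + 1 : ℕ)⌋₊ : ℤ)) ⌊w * (i + 1 : ℕ)⌋₊,
        a ((i + 1 : ℕ) : ZMod Q) Y * ((((i + 1 : ℕ) : ℝ) ^ (-2 * s) : ℝ) *
          ((2 * Real.log (i + 1 : ℕ) : ℝ) * φ₀ s (Y / (i + 1 : ℕ)) +
            φ₁ s (Y / (i + 1 : ℕ))))‖ ≤ C := by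
  set m : ZMod Q → ℂ := fun x => zmodMean (a x) with hm
  have hm1 : ∀ x, ‖m x‖ ≤ 1 := fun x => norm_zmodMean_le (ha x)
  set D : ℝ := (2 * w * (2 * Q + 1) + 2 * Q + 3) * E with hD
  have hE0 : 0 ≤ E := (norm_nonneg _).trans (hφ₀ 2 (by norm_num) le_rfl 0 (by simp [hw.le]))
  have hD0 : 0 ≤ D := by positivity
  have hR := ((summable_log_mul_nat_add_one_rpow (r := -2) (by norm_num)).add
    (summable_nat_add_one_rpow (r := -2) (by norm_num))).mul_left D
  refine ⟨B / 2 + E * (2 * w) * zmodSumConst Q + E * (2 * w) * zmodSumConst Q +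
    ∑' i : ℕ, D * (2 * Real.log (i + 1 : ℕ) * ((i + 1 : ℕ) : ℝ) ^ (-2 : ℝ) +
      ((i + 1 : ℕ) : ℝ) ^ (-2 : ℝ)), fun s h1 h2 => ?_⟩
  set I₀ : ℂ := ∫ u in (-w)..w, φ₀ s u with hI₀
  set I₁ : ℂ := ∫ u in (-w)..w, φ₁ s u with hI₁
  have hI₀b : ‖I₀‖ ≤ E * (2 * w) := by
    have := intervalIntegral.norm_integral_le_of_norm_le_const (a := -w) (b := w)
      (f := φ₀ s) (C := E) fun u hu => hφ₀ s h1 h2 u (by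
        rw [Set.uIoc_of_le (by linarith)] at hu
        exact ⟨hu.1.le, hu.2⟩)
    rwa [abs_of_nonneg (by linarith), show w - -w = 2 * w by ring] at this
  have hI₁b : ‖I₁‖ ≤ E * (2 * w) := by
    have := intervalIntegral.norm_integral_le_of_norm_le_const (a := -w) (b := w)
      (f := φ₁ s) (C := E) fun u hu => hφ₁ s h1 h2 u (by
        rw [Set.uIoc_of_le (by linarith)] at hu
        exact ⟨hu.1.le, hu.2⟩)
    rwa [abs_of_nonneg (by linarith), show w - -w = 2 * w by ring] at this
  have hs0 : Summable fun i : ℕ =>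
      m ((i + 1 : ℕ) : ZMod Q) * (((i + 1 : ℕ) : ℝ) ^ (1 - 2 * s) : ℝ) := by
    refine Summable.of_norm_bounded (summable_nat_add_one_rpow (r := 1 - 2 * s) (by linarith))
      fun i => ?_
    rw [norm_mul, Complex.norm_real, Real.norm_of_nonneg (by positivity)]
    exact mul_le_of_le_one_left (by positivity) (hm1 _)
  have hs1 : Summable fun i : ℕ => m ((i + 1 : ℕ) : ZMod Q) *
      (2 * Real.log (i + 1 : ℕ) * ((i + 1 : ℕ) : ℝ) ^ (1 - 2 * s) : ℝ) := by
    refine Summable.of_norm_bounded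
      (summable_log_mul_nat_add_one_rpow (r := 1 - 2 * s) (by linarith)) fun i => ?_
    have hp : 0 ≤ 2 * Real.log (i + 1 : ℕ) * ((i + 1 : ℕ) : ℝ) ^ (1 - 2 * s) := by
      have := Real.log_natCast_nonneg (i + 1)
      positivity
    rw [norm_mul, Complex.norm_real, Real.norm_of_nonneg hp]
    exact mul_le_of_le_one_left hp (hm1 _)
  have hA0 := norm_tsum_zmod_mul_rpow_sub_le hm1 h1 h2 hs0
  have hA1 := norm_tsum_zmod_mul_log_mul_rpow_sub_le hm1 h1 h2 hs1
  set A₀ := ∑' i : ℕ, m ((i + 1 : ℕ) : ZMod Q) * (((i + 1 : ℕ) : ℝ) ^ (1 - 2 * s) : ℝ)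
  set A₁ := ∑' i : ℕ, m ((i + 1 : ℕ) : ZMod Q) *
      (2 * Real.log (i + 1 : ℕ) * ((i + 1 : ℕ) : ℝ) ^ (1 - 2 * s) : ℝ)
  set T : ℕ → ℂ := fun i =>
    ∑ Y ∈ Finset.Icc (-(⌊w * (i + 1 : ℕ)⌋₊ : ℤ)) ⌊w * (i + 1 : ℕ)⌋₊,
        a ((i + 1 : ℕ) : ZMod Q) Y * ((((i + 1 : ℕ) : ℝ) ^ (-2 * s) : ℝ) *
          ((2 * Real.log (i + 1 : ℕ) : ℝ) * φ₀ s (Y / (i + 1 : ℕ)) +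
            φ₁ s (Y / (i + 1 : ℕ)))) with hT
  set M : ℕ → ℂ := fun i =>
    m ((i + 1 : ℕ) : ZMod Q) *
      (2 * Real.log (i + 1 : ℕ) * ((i + 1 : ℕ) : ℝ) ^ (1 - 2 * s) : ℝ) * I₀ +
    m ((i + 1 : ℕ) : ZMod Q) * (((i + 1 : ℕ) : ℝ) ^ (1 - 2 * s) : ℝ) * I₁ with hM
  have hMs : HasSum M (A₁ * I₀ + A₀ * I₁) :=
    (hs1.hasSum.mul_right _).add (hs0.hasSum.mul_right _)
  have hdiff : ∀ i, ‖T i - M i‖ ≤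
      D * (2 * Real.log (i + 1 : ℕ) * ((i + 1 : ℕ) : ℝ) ^ (-2 : ℝ) +
      ((i + 1 : ℕ) : ℝ) ^ (-2 : ℝ)) := by
    intro i
    have hX : 0 < i + 1 := Nat.succ_pos i
    have hXr : (0 : ℝ) < ((i + 1 : ℕ) : ℝ) := by positivity
    have k0 := norm_sum_Icc_sub_integral_le hw (ha ((i + 1 : ℕ) : ZMod Q)) (hφ₀ s h1 h2)
      (hlip₀ s h1 h2) hX
    have k1 := norm_sum_Icc_sub_integral_le hw (ha ((i + 1 : ℕ) : ZMod Q)) (hφ₁ s h1 h2)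
      (hlip₁ s h1 h2) hX
    have hlog := Real.log_natCast_nonneg (i + 1)
    have hpow : ((i + 1 : ℕ) : ℝ) ^ (1 - 2 * s) = ((i + 1 : ℕ) : ℝ) ^ (-2 * s) * (i + 1 : ℕ) := by
      rw [← Real.rpow_add_one hXr.ne']
      ring_nf
    set S₀ := ∑ Y ∈ Finset.Icc (-(⌊w * (i + 1 : ℕ)⌋₊ : ℤ)) ⌊w * (i + 1 : ℕ)⌋₊,
      a ((i + 1 : ℕ) : ZMod Q) Y * φ₀ s (Y / (i + 1 : ℕ))
    set S₁ := ∑ Y ∈ Finset.Icc (-(⌊w * (i + 1 : ℕ)⌋₊ : ℤ)) ⌊w * (i + 1 : ℕ)⌋₊,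
      a ((i + 1 : ℕ) : ZMod Q) Y * φ₁ s (Y / (i + 1 : ℕ))
    have hTe : T i = (((i + 1 : ℕ) : ℝ) ^ (-2 * s) : ℝ) *
        ((2 * Real.log (i + 1 : ℕ) : ℝ) * S₀ + S₁) := by
      simp only [hT, S₀, S₁, Finset.mul_sum, ← Finset.sum_add_distrib]
      exact Finset.sum_congr rfl fun _ _ => by ring
    have : T i - M i = (((i + 1 : ℕ) : ℝ) ^ (-2 * s) : ℝ) *
        ((2 * Real.log (i + 1 : ℕ) : ℝ) *
          (S₀ - (i + 1 : ℕ) * m ((i + 1 : ℕ) : ZMod Q) * I₀) +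
          (S₁ - (i + 1 : ℕ) * m ((i + 1 : ℕ) : ZMod Q) * I₁)) := by
      rw [hTe]
      simp only [hM, hpow]
      push_cast
      ring
    rw [this, norm_mul, Complex.norm_real, Real.norm_of_nonneg (by positivity)]
    calc _ ≤ ((i + 1 : ℕ) : ℝ) ^ (-2 : ℝ) * (2 * Real.log (i + 1 : ℕ) * D + D) := by
          apply mul_le_mul _ _ (norm_nonneg _) (by positivity)
          · exact Real.rpow_le_rpow_of_exponent_le (by exact_mod_cast hX) (by linarith)
          · refine (norm_add_le _ _).trans (add_le_add ?_ k1)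
            rw [norm_mul, Complex.norm_real, Real.norm_of_nonneg (by positivity)]
            exact mul_le_mul_of_nonneg_left k0 (by positivity)
      _ = _ := by ring
  have hTMs : Summable fun i => T i - M i := Summable.of_norm_bounded hR hdiff
  have hsum : ∑' i, T i = A₁ * I₀ + A₀ * I₁ + ∑' i, (T i - M i) := by
    rw [← (hMs.add hTMs.hasSum).tsum_eq]
    simp
  rw [hsum]
  have hbR : ‖∑' i, (T i - M i)‖ ≤ _ := tsum_of_norm_bounded hR.hasSum hdiff
  have hs' : (0 : ℝ) < s - 1 := by linarith
  have hmm : ‖zmodMean m‖ ≤ 1 := norm_zmodMean_le hm1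
  have hmain : A₁ * I₀ + A₀ * I₁ =
      zmodMean m * (1 / (2 * (s - 1) ^ 2) : ℝ) * (I₀ + (s - 1 : ℝ) * I₁) +
      (A₁ - zmodMean m * (1 / (2 * (s - 1) ^ 2) : ℝ)) * I₀ +
      (A₀ - zmodMean m * (1 / (2 * (s - 1)) : ℝ)) * I₁ := by
    have e : ((1 / (2 * (s - 1)) : ℝ) : ℂ) = (1 / (2 * (s - 1) ^ 2) : ℝ) * (s - 1 : ℝ) := by
      rw [← Complex.ofReal_mul]
      congr 1
      field_simp
    rw [e]
    ring
  have hZ : 0 ≤ zmodSumConst Q := (norm_nonneg _).trans hA0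
  rw [hmain]
  refine (norm_add_le _ _).trans (add_le_add ((norm_add_le _ _).trans (add_le_add
    ((norm_add_le _ _).trans (add_le_add ?_ ?_)) ?_)) hbR)
  · rw [norm_mul, norm_mul, Complex.norm_real, Real.norm_of_nonneg (by positivity)]
    calc _ ≤ 1 * (1 / (2 * (s - 1) ^ 2)) * (B * (s - 1) ^ 2) := by
          gcongr
          exact hcontInt s h1 h2
      _ = _ := by field_simp
  · rw [norm_mul, mul_comm]
    gcongr
  · rw [norm_mul, mul_comm]
    gcongr

theorem exists_norm_tsum_cone_le {w K : ℝ} (hw : 0 < w) (hK : 1 ≤ K) {f f' : ℝ → ℂ}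
    {l l' : ℝ → ℝ} (hf : ∀ u ∈ Set.Icc (-w) w, HasDerivAt f (f' u) u)
    (hl : ∀ u ∈ Set.Icc (-w) w, HasDerivAt l (l' u) u)
    (hfK : ∀ u ∈ Set.Icc (-w) w, ‖f u‖ ≤ K) (hf'K : ∀ u ∈ Set.Icc (-w) w, ‖f' u‖ ≤ K)
    (hlK : ∀ u ∈ Set.Icc (-w) w, |l u| ≤ K) (hl'K : ∀ u ∈ Set.Icc (-w) w, |l' u| ≤ K)
    (h0 : ∫ u in (-w)..w, f u * (Real.exp (-l u) : ℂ) = 0)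
    {a : ZMod Q → ZMod Q → ℂ} (ha : ∀ x y, ‖a x y‖ ≤ 1) {N : ℕ → ℤ → ℝ}
    (hN : ∀ X : ℕ, 0 < X → ∀ Y ∈ Finset.Icc (-(⌊w * X⌋₊ : ℤ)) ⌊w * X⌋₊,
      N X Y = (X : ℝ) ^ 2 * Real.exp (l (Y / X))) :
    ∃ C : ℝ, ∀ s : ℝ, 1 < s → s ≤ 2 →
      ‖∑' i : ℕ, ∑ Y ∈ Finset.Icc (-(⌊w * (i + 1 : ℕ)⌋₊ : ℤ)) ⌊w * (i + 1 : ℕ)⌋₊,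
        a ((i + 1 : ℕ) : ZMod Q) Y * f (Y / (i + 1 : ℕ)) *
          (N (i + 1) Y ^ (-s) * Real.log (N (i + 1) Y) : ℝ)‖ ≤ C := by
  have hKl : ∀ u ∈ Set.Icc (-w) w, ∀ s : ℝ, 1 < s → s ≤ 2 →
      Real.exp (-s * l u) ≤ Real.exp (2 * K) := by
    intro u hu s h1 h2
    have := abs_le.1 (hlK u hu)
    exact Real.exp_le_exp.2 (by nlinarith)
  set E : ℝ := 4 * K ^ 3 * Real.exp (2 * K) with hE
  have hexp : ∀ u ∈ Set.Icc (-w) w, ∀ s : ℝ, HasDerivAt (fun u => (Real.exp (-s * l u) : ℂ))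
      (((-s * l' u) * Real.exp (-s * l u) : ℝ) : ℂ) u := by
    intro u hu s
    have := (((hl u hu).const_mul (-s)).exp).ofReal_comp
    refine this.congr_deriv ?_
    rw [mul_comm]
  -- uniform bounds for the two profile functions
  have hφ₀ : ∀ s : ℝ, 1 < s → s ≤ 2 → ∀ u ∈ Set.Icc (-w) w,
      ‖f u * (Real.exp (-s * l u) : ℂ)‖ ≤ E := by
    intro s h1 h2 u hu
    rw [norm_mul, Complex.norm_real, Real.norm_of_nonneg (Real.exp_nonneg _)]
    calc _ ≤ K * Real.exp (2 * K) :=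
          mul_le_mul (hfK u hu) (hKl u hu s h1 h2) (Real.exp_nonneg _) (by linarith)
      _ ≤ _ := by
          refine mul_le_mul_of_nonneg_right ?_ (Real.exp_nonneg _)
          nlinarith [mul_nonneg (show 0 ≤ K by linarith) (show 0 ≤ K ^ 2 - 1 by nlinarith)]
  have hφ₁ : ∀ s : ℝ, 1 < s → s ≤ 2 → ∀ u ∈ Set.Icc (-w) w,
      ‖f u * (l u : ℂ) * (Real.exp (-s * l u) : ℂ)‖ ≤ E := by
    intro s h1 h2 u hu
    rw [norm_mul, norm_mul, Complex.norm_real, Complex.norm_real,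
      Real.norm_of_nonneg (Real.exp_nonneg _), Real.norm_eq_abs]
    calc _ ≤ K * K * Real.exp (2 * K) :=
          mul_le_mul (mul_le_mul (hfK u hu) (hlK u hu) (abs_nonneg _) (by linarith))
            (hKl u hu s h1 h2) (Real.exp_nonneg _) (by positivity)
      _ ≤ _ := by
          refine mul_le_mul_of_nonneg_right ?_ (Real.exp_nonneg _)
          nlinarith [mul_nonneg (show 0 ≤ K ^ 2 by positivity) (show 0 ≤ K - 1 by linarith),
            sq_nonneg K]
  have hlip₀ : ∀ s : ℝ, 1 < s → s ≤ 2 → ∀ u ∈ Set.Icc (-w) w, ∀ v ∈ Set.Icc (-w) w,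
      ‖f u * (Real.exp (-s * l u) : ℂ) - f v * (Real.exp (-s * l v) : ℂ)‖ ≤ E * |u - v| := by
    intro s h1 h2
    refine norm_image_sub_le_mul_abs (φ := fun u => f u * (Real.exp (-s * l u) : ℂ))
      (fun u hu => (hf u hu).mul (hexp u hu s)) fun u hu => ?_
    rw [show f' u * (Real.exp (-s * l u) : ℂ) + f u * ((-s * l' u * Real.exp (-s * l u) : ℝ) : ℂ)
      = (f' u + f u * ((-s * l' u : ℝ) : ℂ)) * (Real.exp (-s * l u) : ℂ) by push_cast; ring,
      norm_mul, Complex.norm_real, Real.norm_of_nonneg (Real.exp_nonneg _)]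
    have e1 : ‖f' u + f u * ((-s * l' u : ℝ) : ℂ)‖ ≤ K + K * (2 * K) := by
      refine (norm_add_le _ _).trans (add_le_add (hf'K u hu) ?_)
      rw [norm_mul, Complex.norm_real, Real.norm_eq_abs, abs_mul, abs_neg,
        abs_of_nonneg (by linarith : 0 ≤ s)]
      gcongr
      exacts [hfK u hu, hl'K u hu]
    calc _ ≤ (K + K * (2 * K)) * Real.exp (2 * K) :=
          mul_le_mul e1 (hKl u hu s h1 h2) (Real.exp_nonneg _) (by positivity)
      _ ≤ _ := by
          refine mul_le_mul_of_nonneg_right ?_ (Real.exp_nonneg _)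
          nlinarith [mul_nonneg (show 0 ≤ K by linarith) (show 0 ≤ K ^ 2 - 1 by nlinarith),
            mul_nonneg (show 0 ≤ K ^ 2 by positivity) (show 0 ≤ K - 1 by linarith)]
  have hlip₁ : ∀ s : ℝ, 1 < s → s ≤ 2 → ∀ u ∈ Set.Icc (-w) w, ∀ v ∈ Set.Icc (-w) w,
      ‖f u * (l u : ℂ) * (Real.exp (-s * l u) : ℂ)
        - f v * (l v : ℂ) * (Real.exp (-s * l v) : ℂ)‖ ≤ E * |u - v| := by
    intro s h1 h2
    refine norm_image_sub_le_mul_abs (φ := fun u => f u * (l u : ℂ) * (Real.exp (-s * l u) : ℂ))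
      (fun u hu => ((hf u hu).mul (hl u hu).ofReal_comp).mul (hexp u hu s)) fun u hu => ?_
    change ‖(f' u * (l u : ℂ) + f u * (l' u : ℂ)) * (Real.exp (-s * l u) : ℂ) +
        f u * (l u : ℂ) * ((-s * l' u * Real.exp (-s * l u) : ℝ) : ℂ)‖ ≤ E
    rw [show ∀ A B C D : ℂ, (A + B) * (Real.exp (-s * l u) : ℂ) +
        C * D * ((-s * l' u * Real.exp (-s * l u) : ℝ) : ℂ)
      = (A + B + C * D * ((-s * l' u : ℝ) : ℂ)) * (Real.exp (-s * l u) : ℂ) by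
        intros; push_cast; ring,
      norm_mul, Complex.norm_real, Real.norm_of_nonneg (Real.exp_nonneg _)]
    have e1 : ‖f' u * (l u : ℂ) + f u * (l' u : ℂ) + f u * (l u : ℂ) * ((-s * l' u : ℝ) : ℂ)‖
        ≤ K * K + K * K + K * K * (2 * K) := by
      refine (norm_add_le _ _).trans (add_le_add ((norm_add_le _ _).trans (add_le_add ?_ ?_)) ?_)
      · rw [norm_mul, Complex.norm_real, Real.norm_eq_abs]
        gcongr
        exacts [hf'K u hu, hlK u hu]
      · rw [norm_mul, Complex.norm_real, Real.norm_eq_abs]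
        gcongr
        exacts [hfK u hu, hl'K u hu]
      · rw [norm_mul, norm_mul, Complex.norm_real, Complex.norm_real, Real.norm_eq_abs,
          Real.norm_eq_abs, abs_mul, abs_neg, abs_of_nonneg (by linarith : 0 ≤ s)]
        gcongr
        exacts [hfK u hu, hlK u hu, hl'K u hu]
    calc _ ≤ (K * K + K * K + K * K * (2 * K)) * Real.exp (2 * K) :=
          mul_le_mul e1 (hKl u hu s h1 h2) (Real.exp_nonneg _) (by positivity)
      _ ≤ _ := by
          refine mul_le_mul_of_nonneg_right ?_ (Real.exp_nonneg _)
          nlinarith [mul_nonneg (show 0 ≤ K ^ 2 by positivity) (show 0 ≤ K - 1 by linarith),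
            sq_nonneg K]
  have hcontInt : ∀ s : ℝ, 1 < s → s ≤ 2 →
      ‖(∫ u in (-w)..w, f u * (Real.exp (-s * l u) : ℂ)) +
        (s - 1 : ℝ) * ∫ u in (-w)..w, f u * (l u : ℂ) * (Real.exp (-s * l u) : ℂ)‖
        ≤ K * Real.exp K * (K ^ 2 * Real.exp K) * (2 * w) * (s - 1) ^ 2 := by
    intro s h1 h2
    have hcf : ContinuousOn f (Set.uIcc (-w) w) := by
      rw [Set.uIcc_of_le (by linarith)]
      exact fun u hu => (hf u hu).continuousAt.continuousWithinAt
    have hcl : ContinuousOn l (Set.uIcc (-w) w) := by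
      rw [Set.uIcc_of_le (by linarith)]
      exact fun u hu => (hl u hu).continuousAt.continuousWithinAt
    have i1 : IntervalIntegrable (fun u => f u * (Real.exp (-s * l u) : ℂ))
        MeasureTheory.volume (-w) w := ContinuousOn.intervalIntegrable (by fun_prop)
    have i2 : IntervalIntegrable (fun u => f u * (l u : ℂ) * (Real.exp (-s * l u) : ℂ))
        MeasureTheory.volume (-w) w := ContinuousOn.intervalIntegrable (by fun_prop)
    have i3 : IntervalIntegrable (fun u => f u * (Real.exp (-l u) : ℂ))
        MeasureTheory.volume (-w) w := ContinuousOn.intervalIntegrable (by fun_prop)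
    rw [← intervalIntegral.integral_const_mul, ← intervalIntegral.integral_add i1
      (i2.const_mul _), ← sub_zero (intervalIntegral _ _ _ _), ← h0,
      ← intervalIntegral.integral_sub (i1.add (i2.const_mul _)) i3]
    have := intervalIntegral.norm_integral_le_of_norm_le_const (a := -w) (b := w)
      (f := fun u => f u * (Real.exp (-s * l u) : ℂ) +
        (s - 1 : ℝ) * (f u * (l u : ℂ) * (Real.exp (-s * l u) : ℂ)) -
          f u * (Real.exp (-l u) : ℂ))
      (C := K * Real.exp K * (K ^ 2 * Real.exp K) * (s - 1) ^ 2) fun u hu => ?_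
    · rw [abs_of_nonneg (by linarith), show w - -w = 2 * w by ring] at this
      exact this.trans_eq (by ring)
    · rw [Set.uIoc_of_le (by linarith)] at hu
      have hu' : u ∈ Set.Icc (-w) w := ⟨hu.1.le, hu.2⟩
      have hl' := hlK u hu'
      have e : f u * (Real.exp (-s * l u) : ℂ) +
          (s - 1 : ℝ) * (f u * (l u : ℂ) * (Real.exp (-s * l u) : ℂ)) -
            f u * (Real.exp (-l u) : ℂ) =
          f u * ((Real.exp (-l u) * (Real.exp (-((s - 1) * l u)) * (1 + (s - 1) * l u) - 1) : ℝ) :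
            ℂ) := by
        rw [show -s * l u = -l u + -((s - 1) * l u) by ring, Real.exp_add]
        push_cast
        ring
      rw [e, norm_mul, Complex.norm_real, Real.norm_eq_abs, abs_mul, abs_of_pos (Real.exp_pos _)]
      have hz : |(s - 1) * l u| ≤ K := by
        rw [abs_mul, abs_of_pos (by linarith : 0 < s - 1)]
        nlinarith [abs_nonneg (l u)]
      have b1 : Real.exp (-l u) ≤ Real.exp K := Real.exp_le_exp.2 (by linarith [(abs_le.1 hl').1])
      have b2 : |Real.exp (-((s - 1) * l u)) * (1 + (s - 1) * l u) - 1|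
          ≤ (s - 1) ^ 2 * K ^ 2 * Real.exp K := by
        refine norm_exp_neg_mul_one_add_sub_one_le.trans ?_
        refine mul_le_mul ?_ (Real.exp_le_exp.2 hz) (Real.exp_nonneg _) (by positivity)
        rw [mul_pow]
        exact mul_le_mul_of_nonneg_left (sq_le_sq' (abs_le.1 hl').1 (abs_le.1 hl').2)
          (sq_nonneg _)
      calc _ ≤ K * (Real.exp K * ((s - 1) ^ 2 * K ^ 2 * Real.exp K)) :=
            mul_le_mul (hfK u hu') (mul_le_mul b1 b2 (abs_nonneg _) (Real.exp_nonneg _))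
              (by positivity) (by linarith)
        _ = _ := by ring
  obtain ⟨C, hC⟩ := exists_norm_tsum_cone_le_of_profiles hw hφ₀ hφ₁ hlip₀ hlip₁ hcontInt ha
  refine ⟨C, fun s h1 h2 => ?_⟩
  convert hC s h1 h2 using 5 with i Y hY
  have hX : (0 : ℝ) < ((i + 1 : ℕ) : ℝ) := by positivity
  rw [hN (i + 1) i.succ_pos Y hY, Real.mul_rpow (by positivity) (Real.exp_nonneg _),
    Real.log_mul (by positivity) (Real.exp_pos _).ne', Real.log_exp, Real.log_pow,
    ← Real.rpow_natCast, ← Real.rpow_mul hX.le, ← Real.exp_mul]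
  push_cast
  ring_nf

end ConeSums

section ConeSummability

theorem exists_tsum_nat_add_one_rpow_le : ∃ C : ℝ, ∀ s : ℝ, 1 < s → s ≤ 2 →
    ∑' i : ℕ, ((i + 1 : ℕ) : ℝ) ^ (1 - 2 * s) ≤ C / (s - 1) := by
  refine ⟨1 / 2 + zmodSumConst 1, fun s h1 h2 => ?_⟩
  have hs := summable_nat_add_one_rpow (r := 1 - 2 * s) (by linarith)
  have h := norm_tsum_zmod_mul_rpow_sub_le (Q := 1) (a := fun _ => 1) (by simp) h1 h2
    (by simpa using Complex.ofRealCLM.summable hs)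
  have hm : zmodMean (Q := 1) (fun _ => 1) = 1 := by simp [zmodMean]
  simp only [hm, one_mul] at h
  rw [← Complex.ofReal_tsum, ← Complex.ofReal_sub, Complex.norm_real, Real.norm_eq_abs] at h
  have hs' : 0 < s - 1 := by linarith
  have h3 := (abs_le.1 h).2
  have hZ := (abs_nonneg _).trans h
  rw [le_div_iff₀ hs']
  have : 1 / (2 * (s - 1)) * (s - 1) = 1 / 2 := by field_simp
  nlinarith

variable {w : ℝ} {F : ℕ × ℤ → ℝ}

theorem card_Icc_floor_le (hw : 0 < w) (i : ℕ) :
    ((Finset.Icc (-(⌊w * (i + 1 : ℕ)⌋₊ : ℤ)) ⌊w * (i + 1 : ℕ)⌋₊).card : ℝ) ≤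
      (2 * w + 1) * (i + 1 : ℕ) := by
  rw [Int.card_Icc]
  have e : ((⌊w * (i + 1 : ℕ)⌋₊ : ℤ) + 1 - -(⌊w * (i + 1 : ℕ)⌋₊ : ℤ)).toNat =
    2 * ⌊w * (i + 1 : ℕ)⌋₊ + 1 := by omega
  have h := Nat.floor_le (show 0 ≤ w * (i + 1 : ℕ) by positivity)
  rw [e]
  push_cast at h ⊢
  nlinarith [(Nat.cast_nonneg i : (0 : ℝ) ≤ i)]

theorem summable_cone {K r : ℝ} (hw : 0 < w) (hr : 1 < r) (hK : 0 ≤ K) (hF : ∀ x, 0 ≤ F x)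
    (hF0 : ∀ i Y, Y ∉ Finset.Icc (-(⌊w * (i + 1 : ℕ)⌋₊ : ℤ)) ⌊w * (i + 1 : ℕ)⌋₊ → F (i, Y) = 0)
    (hFK : ∀ i Y, F (i, Y) ≤ K * ((i + 1 : ℕ) : ℝ) ^ (-2 * r)) :
    Summable F ∧ ∑' x, F x ≤ K * (2 * w + 1) * ∑' i : ℕ, ((i + 1 : ℕ) : ℝ) ^ (1 - 2 * r) := by
  have hs := (summable_nat_add_one_rpow (r := 1 - 2 * r) (by linarith)).mul_left (K * (2 * w + 1))
  have hi : ∀ i, HasSum (fun Y => F (i, Y))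
      (∑ Y ∈ Finset.Icc (-(⌊w * (i + 1 : ℕ)⌋₊ : ℤ)) ⌊w * (i + 1 : ℕ)⌋₊, F (i, Y)) := fun i =>
    hasSum_sum_of_ne_finset_zero fun Y hY => hF0 i Y hY
  have hle : ∀ i, ∑' Y, F (i, Y) ≤ K * (2 * w + 1) * ((i + 1 : ℕ) : ℝ) ^ (1 - 2 * r) := by
    intro i
    have hX : (0 : ℝ) < ((i + 1 : ℕ) : ℝ) := by positivity
    rw [(hi i).tsum_eq]
    calc _ ≤ _ := Finset.sum_le_card_nsmul _ _ _ fun Y _ => hFK i Y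
      _ ≤ (2 * w + 1) * (i + 1 : ℕ) * (K * ((i + 1 : ℕ) : ℝ) ^ (-2 * r)) := by
          rw [nsmul_eq_mul]
          exact mul_le_mul_of_nonneg_right (card_Icc_floor_le hw i) (by positivity)
      _ = K * (2 * w + 1) * (((i + 1 : ℕ) : ℝ) ^ (-2 * r) * (i + 1 : ℕ)) := by ring
      _ = _ := by
          rw [← Real.rpow_add_one hX.ne']
          ring_nf
  have hsum : Summable F := (summable_prod_of_nonneg hF).2 ⟨fun i => (hi i).summable,
    Summable.of_nonneg_of_le (fun i => tsum_nonneg fun Y => hF _) hle hs⟩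
  refine ⟨hsum, ?_⟩
  rw [hsum.tsum_prod' fun i => (hi i).summable, ← tsum_mul_left]
  exact Summable.tsum_le_tsum hle
    (Summable.of_nonneg_of_le (fun i => tsum_nonneg fun Y => hF _) hle hs) hs

theorem tsum_cone {G : ℕ × ℤ → ℂ} (hG : Summable G)
    (hG0 : ∀ i Y, Y ∉ Finset.Icc (-(⌊w * (i + 1 : ℕ)⌋₊ : ℤ)) ⌊w * (i + 1 : ℕ)⌋₊ → G (i, Y) = 0) :
    ∑' x, G x = ∑' i : ℕ, ∑ Y ∈ Finset.Icc (-(⌊w * (i + 1 : ℕ)⌋₊ : ℤ)) ⌊w * (i + 1 : ℕ)⌋₊,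
      G (i, Y) := by
  rw [hG.tsum_prod]
  exact tsum_congr fun i => tsum_eq_sum fun Y hY => hG0 i Y hY

end ConeSummability

section Hyperbola

/-- The logarithmic angle on the hyperbolic sector `|u| ≤ w`. -/
noncomputable def hypAngle (α β u : ℝ) : ℝ := Real.log (α + β * u) - Real.log (α - β * u)

variable {α β w : ℝ}

theorem sector_pos (hβ : 0 < β) (hw : β * w < α) {u : ℝ} (hu : u ∈ Set.Icc (-w) w) :
    0 < α + β * u ∧ 0 < α - β * u := by
  constructor
  · nlinarith [hu.1]
  · nlinarith [hu.2]

theorem hasDerivAt_hypAngle (hβ : 0 < β) (hw : β * w < α) {u : ℝ} (hu : u ∈ Set.Icc (-w) w) :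
    HasDerivAt (hypAngle α β) (2 * α * β / ((α + β * u) * (α - β * u))) u := by
  obtain ⟨h1, h2⟩ := sector_pos hβ hw hu
  have d1 : HasDerivAt (fun u => α + β * u) β u := by
    simpa using ((hasDerivAt_id u).const_mul β).const_add α
  have d2 : HasDerivAt (fun u => α - β * u) (-β) u := by
    simpa using ((hasDerivAt_id u).const_mul β).const_sub α
  refine ((d1.log h1.ne').sub (d2.log h2.ne')).congr_deriv ?_
  field_simp
  ring

theorem hasDerivAt_log_sector (hβ : 0 < β) (hw : β * w < α) {u : ℝ} (hu : u ∈ Set.Icc (-w) w) :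
    HasDerivAt (fun u => Real.log ((α + β * u) * (α - β * u)))
      (-(2 * β ^ 2 * u) / ((α + β * u) * (α - β * u))) u := by
  obtain ⟨h1, h2⟩ := sector_pos hβ hw hu
  have d1 : HasDerivAt (fun u => α + β * u) β u := by
    simpa using ((hasDerivAt_id u).const_mul β).const_add α
  have d2 : HasDerivAt (fun u => α - β * u) (-β) u := by
    simpa using ((hasDerivAt_id u).const_mul β).const_sub α
  refine ((d1.mul d2).log (mul_pos h1 h2).ne').congr_deriv ?_
  congr 1
  ring

theorem hasDerivAt_exp_hypAngle (hβ : 0 < β) (hw : β * w < α) (κ : ℝ) {u : ℝ}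
    (hu : u ∈ Set.Icc (-w) w) :
    HasDerivAt (fun u => Complex.exp ((κ * hypAngle α β u : ℝ) * Complex.I))
      (Complex.exp ((κ * hypAngle α β u : ℝ) * Complex.I) *
        ((κ * (2 * α * β / ((α + β * u) * (α - β * u))) : ℝ) * Complex.I)) u :=
  ((((hasDerivAt_hypAngle hβ hw hu).const_mul κ).ofReal_comp).mul_const Complex.I).cexp

theorem integral_exp_hypAngle_eq_zero (hα : 0 < α) (hβ : 0 < β) (hw0 : 0 < w) (hw : β * w < α)
    {κ : ℝ} (hκ : κ ≠ 0)
    (hper : Complex.exp ((2 * κ * hypAngle α β w : ℝ) * Complex.I) = 1) :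
    ∫ u in (-w)..w, Complex.exp ((κ * hypAngle α β u : ℝ) * Complex.I) *
      (Real.exp (-Real.log ((α + β * u) * (α - β * u))) : ℂ) = 0 := by
  set C : ℂ := (κ * (2 * α * β) : ℝ) * Complex.I with hC
  have hC0 : C ≠ 0 := by
    simp [hC, hκ, hα.ne', hβ.ne']
  have hle : -w ≤ w := by linarith
  have hd : ∀ u ∈ Set.uIcc (-w) w, HasDerivAt
      (fun u => Complex.exp ((κ * hypAngle α β u : ℝ) * Complex.I) / C)
      (Complex.exp ((κ * hypAngle α β u : ℝ) * Complex.I) *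
        (Real.exp (-Real.log ((α + β * u) * (α - β * u))) : ℂ)) u := by
    intro u hu
    rw [Set.uIcc_of_le hle] at hu
    obtain ⟨h1, h2⟩ := sector_pos hβ hw hu
    refine ((hasDerivAt_exp_hypAngle hβ hw κ hu).div_const C).congr_deriv ?_
    rw [Real.exp_neg, Real.exp_log (mul_pos h1 h2), mul_div_assoc]
    congr 1
    rw [div_eq_iff hC0, hC, ← mul_assoc, ← Complex.ofReal_mul]
    congr 2
    ring
  have hcont : ContinuousOn (fun u => Complex.exp ((κ * hypAngle α β u : ℝ) * Complex.I) *
      (Real.exp (-Real.log ((α + β * u) * (α - β * u))) : ℂ)) (Set.uIcc (-w) w) := by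
    rw [Set.uIcc_of_le hle]
    intro u hu
    apply ContinuousAt.continuousWithinAt
    have c1 := (hasDerivAt_exp_hypAngle hβ hw κ hu).continuousAt
    have c2 := (hasDerivAt_log_sector hβ hw hu).continuousAt
    fun_prop
  rw [intervalIntegral.integral_eq_sub_of_hasDerivAt hd hcont.intervalIntegrable, ← sub_div]
  have hneg : hypAngle α β (-w) = -hypAngle α β w := by
    simp only [hypAngle]
    ring_nf
  have : Complex.exp ((κ * hypAngle α β w : ℝ) * Complex.I) =
      Complex.exp ((κ * hypAngle α β (-w) : ℝ) * Complex.I) := by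
    rw [hneg, ← mul_one (Complex.exp ((κ * -hypAngle α β w : ℝ) * Complex.I)), ← hper,
      ← Complex.exp_add]
    congr 1
    push_cast
    ring
  rw [this, sub_self, zero_div]

theorem exists_norm_tsum_sector_le {Q : ℕ} [NeZero Q] (hα : 0 < α) (hβ : 0 < β) (hw0 : 0 < w)
    (hw : β * w < α) {κ : ℝ} (hκ : κ ≠ 0)
    (hper : Complex.exp ((2 * κ * hypAngle α β w : ℝ) * Complex.I) = 1)
    {a : ZMod Q → ZMod Q → ℂ} (ha : ∀ x y, ‖a x y‖ ≤ 1) {N : ℕ → ℤ → ℝ}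
    (hN : ∀ (X : ℕ) (Y : ℤ), N X Y = (α * X + β * Y) * (α * X - β * Y)) :
    ∃ C : ℝ, ∀ s : ℝ, 1 < s → s ≤ 2 →
      ‖∑' i : ℕ, ∑ Y ∈ Finset.Icc (-(⌊w * (i + 1 : ℕ)⌋₊ : ℤ)) ⌊w * (i + 1 : ℕ)⌋₊,
        a ((i + 1 : ℕ) : ZMod Q) Y *
          Complex.exp ((κ * hypAngle α β (Y / (i + 1 : ℕ)) : ℝ) * Complex.I) *
          (N (i + 1) Y ^ (-s) * Real.log (N (i + 1) Y) : ℝ)‖ ≤ C := by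
  have cq : ∀ u ∈ Set.Icc (-w) w, (α + β * u) * (α - β * u) ≠ 0 := fun u hu =>
    (mul_pos (sector_pos hβ hw hu).1 (sector_pos hβ hw hu).2).ne'
  obtain ⟨K₁, hK₁⟩ := isCompact_Icc.exists_bound_of_continuousOn (s := Set.Icc (-w) w)
    (f := fun u => κ * (2 * α * β / ((α + β * u) * (α - β * u))))
    (ContinuousOn.mul continuousOn_const (ContinuousOn.div (by fun_prop) (by fun_prop) cq))
  obtain ⟨K₂, hK₂⟩ := isCompact_Icc.exists_bound_of_continuousOn (s := Set.Icc (-w) w)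
    (f := fun u => -(2 * β ^ 2 * u) / ((α + β * u) * (α - β * u)))
    (ContinuousOn.div (by fun_prop) (by fun_prop) cq)
  obtain ⟨K₃, hK₃⟩ := isCompact_Icc.exists_bound_of_continuousOn (s := Set.Icc (-w) w)
    (f := fun u => Real.log ((α + β * u) * (α - β * u))) (ContinuousOn.log (by fun_prop) cq)
  set K := 1 + |K₁| + |K₂| + |K₃| with hK
  have a1 := le_abs_self K₁
  have a2 := le_abs_self K₂
  have a3 := le_abs_self K₃
  have b1 := abs_nonneg K₁
  have b2 := abs_nonneg K₂
  have b3 := abs_nonneg K₃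
  refine exists_norm_tsum_cone_le hw0 (K := K) (by linarith)
    (fun u hu => hasDerivAt_exp_hypAngle hβ hw κ hu)
    (fun u hu => hasDerivAt_log_sector hβ hw hu)
    (fun u _ => by rw [Complex.norm_exp_ofReal_mul_I]; linarith) (fun u hu => ?_)
    (fun u hu => (hK₃ u hu).trans (by linarith)) (fun u hu => (hK₂ u hu).trans (by linarith))
    (integral_exp_hypAngle_eq_zero hα hβ hw0 hw hκ hper) ha ?_
  · rw [norm_mul, Complex.norm_exp_ofReal_mul_I, one_mul, norm_mul, Complex.norm_I, mul_one,
      Complex.norm_real]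
    exact (hK₁ u hu).trans (by linarith)
  · intro X hX Y hY
    have hX' : (0 : ℝ) < X := by exact_mod_cast hX
    have hu : (Y / X : ℝ) ∈ Set.Icc (-w) w := by
      have hf := Nat.floor_le (show 0 ≤ w * X by positivity)
      obtain ⟨y1, y2⟩ := Finset.mem_Icc.1 hY
      have y1' : -(⌊w * X⌋₊ : ℝ) ≤ Y := by exact_mod_cast y1
      have y2' : (Y : ℝ) ≤ (⌊w * X⌋₊ : ℝ) := by exact_mod_cast y2
      rw [Set.mem_Icc, le_div_iff₀ hX', div_le_iff₀ hX']
      constructor <;> linarith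
    obtain ⟨h1, h2⟩ := sector_pos hβ hw hu
    rw [hN, Real.exp_log (mul_pos h1 h2)]
    field_simp

end Hyperbola

section SectorSeries

variable {α β w : ℝ} {D : Set (ℕ × ℤ)} {n : ℕ × ℤ → ℕ}

theorem abs_le_of_mem_Icc_floor (hw0 : 0 < w) {X : ℕ} {Y : ℤ}
    (hY : Y ∈ Finset.Icc (-(⌊w * X⌋₊ : ℤ)) ⌊w * X⌋₊) : |(Y : ℝ)| ≤ w * X := by
  have hf := Nat.floor_le (show 0 ≤ w * X by positivity)
  obtain ⟨y1, y2⟩ := Finset.mem_Icc.1 hY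
  have y1' : -(⌊w * X⌋₊ : ℝ) ≤ Y := by exact_mod_cast y1
  have y2' : (Y : ℝ) ≤ (⌊w * X⌋₊ : ℝ) := by exact_mod_cast y2
  exact abs_le.2 ⟨by linarith, by linarith⟩

theorem mem_Icc_floor_of_abs_le {X : ℕ} {Y : ℤ} (h : |(Y : ℝ)| ≤ w * X) :
    Y ∈ Finset.Icc (-(⌊w * X⌋₊ : ℤ)) ⌊w * X⌋₊ := by
  have h1 : Y.natAbs ≤ ⌊w * X⌋₊ := Nat.le_floor (by rwa [Nat.cast_natAbs, Int.cast_abs])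
  rw [Finset.mem_Icc]
  omega

theorem mul_sq_le_of_mem_sector {X Y : ℝ} (h : |Y| ≤ w * X) :
    (α ^ 2 - β ^ 2 * w ^ 2) * X ^ 2 ≤ (α * X + β * Y) * (α * X - β * Y) := by
  have h1 : Y ^ 2 ≤ (w * X) ^ 2 := sq_le_sq' (abs_le.1 h).1 (abs_le.1 h).2
  nlinarith [mul_le_mul_of_nonneg_left h1 (sq_nonneg β)]

theorem indicator_rpow_neg_le (hw0 : 0 < w) (hβ : 0 < β) (hw : β * w < α)
    (hD : ∀ x ∈ D, |(x.2 : ℝ)| ≤ w * (x.1 + 1 : ℕ))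
    (hn : ∀ x ∈ D, (n x : ℝ) = (α * (x.1 + 1 : ℕ) + β * x.2) * (α * (x.1 + 1 : ℕ) - β * x.2))
    {s : ℝ} (h1 : 0 < s) (x : ℕ × ℤ) : D.indicator (fun x => (n x : ℝ) ^ (-s)) x ≤
      (α ^ 2 - β ^ 2 * w ^ 2) ^ (-s) * ((x.1 + 1 : ℕ) : ℝ) ^ (-2 * s) := by
  have hq : 0 < α ^ 2 - β ^ 2 * w ^ 2 := by
    have : 0 < β * w := by positivity
    nlinarith
  have hX : (0 : ℝ) < (x.1 + 1 : ℕ) := by positivity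
  by_cases hx : x ∈ D
  · rw [Set.indicator_of_mem hx, hn x hx]
    calc _ ≤ ((α ^ 2 - β ^ 2 * w ^ 2) * ((x.1 + 1 : ℕ) : ℝ) ^ 2) ^ (-s) :=
          Real.rpow_le_rpow_of_nonpos (by positivity) (mul_sq_le_of_mem_sector (hD x hx))
            (by linarith)
      _ = _ := by
          rw [Real.mul_rpow hq.le (by positivity),
            ← Real.rpow_natCast ((x.1 + 1 : ℕ) : ℝ), ← Real.rpow_mul hX.le]
          congr 2
          push_cast
          ring
  · rw [Set.indicator_of_notMem hx]
    positivity

theorem summable_indicator_rpow_neg (hw0 : 0 < w) (hβ : 0 < β) (hw : β * w < α)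
    (hD : ∀ x ∈ D, |(x.2 : ℝ)| ≤ w * (x.1 + 1 : ℕ))
    (hn : ∀ x ∈ D, (n x : ℝ) = (α * (x.1 + 1 : ℕ) + β * x.2) * (α * (x.1 + 1 : ℕ) - β * x.2)) :
    (∀ s : ℝ, 1 < s → Summable (D.indicator fun x => (n x : ℝ) ^ (-s))) ∧
    ∃ C, ∀ s : ℝ, 1 < s → s ≤ 2 → ∑' x, D.indicator (fun x => (n x : ℝ) ^ (-s)) x ≤ C / (s - 1) := by
  have hq : 0 < α ^ 2 - β ^ 2 * w ^ 2 := by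
    have : 0 < β * w := by positivity
    nlinarith
  have key : ∀ s : ℝ, 1 < s → _ := fun s h1 =>
    summable_cone (w := w) (F := D.indicator fun x => (n x : ℝ) ^ (-s))
      (K := (α ^ 2 - β ^ 2 * w ^ 2) ^ (-s)) hw0 h1 (by positivity)
      (fun x => Set.indicator_nonneg (fun x _ => by positivity) x)
      (fun i Y hY => Set.indicator_of_notMem (fun h => hY (mem_Icc_floor_of_abs_le (hD _ h))) _)
      (fun i Y => indicator_rpow_neg_le hw0 hβ hw hD hn (by linarith) (i, Y))
  refine ⟨fun s h1 => (key s h1).1, ?_⟩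
  obtain ⟨C, hC⟩ := exists_tsum_nat_add_one_rpow_le
  set q := α ^ 2 - β ^ 2 * w ^ 2
  refine ⟨(1 + q ^ (-2 : ℝ)) * (2 * w + 1) * C, fun s h1 h2 => (key s h1).2.trans ?_⟩
  rw [mul_div_assoc]
  have hqs : q ^ (-s) ≤ 1 + q ^ (-2 : ℝ) := by
    rcases le_total 1 q with h | h
    · have := Real.rpow_le_one_of_one_le_of_nonpos h (show -s ≤ 0 by linarith)
      have : 0 < q ^ (-2 : ℝ) := by positivity
      linarith
    · have := Real.rpow_le_rpow_of_exponent_ge hq h (show -2 ≤ -s by linarith)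
      linarith
  have hnn : 0 ≤ ∑' i : ℕ, ((i + 1 : ℕ) : ℝ) ^ (1 - 2 * s) := tsum_nonneg fun _ => by positivity
  exact mul_le_mul (mul_le_mul_of_nonneg_right hqs (by positivity)) (hC s h1 h2) hnn
    (by positivity)

theorem exists_norm_tsum_indicator_le {Q : ℕ} [NeZero Q] (hα : 0 < α) (hw0 : 0 < w) (hβ : 0 < β)
    (hw : β * w < α) (hD : ∀ x ∈ D, |(x.2 : ℝ)| ≤ w * (x.1 + 1 : ℕ))
    (hn : ∀ x ∈ D, (n x : ℝ) = (α * (x.1 + 1 : ℕ) + β * x.2) * (α * (x.1 + 1 : ℕ) - β * x.2))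
    {κ : ℝ} (hκ : κ ≠ 0) (hper : Complex.exp ((2 * κ * hypAngle α β w : ℝ) * Complex.I) = 1)
    {a : ZMod Q → ZMod Q → ℂ} (ha : ∀ x y, ‖a x y‖ ≤ 1) {g : ℕ × ℤ → ℂ}
    (hg : ∀ (i : ℕ) (Y : ℤ), |(Y : ℝ)| ≤ w * (i + 1 : ℕ) → D.indicator g (i, Y) =
      a ((i + 1 : ℕ) : ZMod Q) Y *
        Complex.exp ((κ * hypAngle α β (Y / (i + 1 : ℕ)) : ℝ) * Complex.I)) :
    (∀ s : ℝ, 1 < s → Summable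
      (D.indicator fun x => g x * ((n x : ℝ) ^ (-s) * Real.log (n x) : ℝ))) ∧
    ∃ C, ∀ s : ℝ, 1 < s → s ≤ 2 →
      ‖∑' x, D.indicator (fun x => g x * ((n x : ℝ) ^ (-s) * Real.log (n x) : ℝ)) x‖ ≤ C := by
  have hsum : ∀ s : ℝ, 1 < s → Summable
      (D.indicator fun x => g x * ((n x : ℝ) ^ (-s) * Real.log (n x) : ℝ)) := by
    intro s h1
    obtain ⟨σ, hσ1, hσ⟩ := exists_between h1
    refine Summable.of_norm_bounded
      (((summable_indicator_rpow_neg hw0 hβ hw hD hn).1 σ hσ1).mul_left ((s - σ)⁻¹)) fun x => ?_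
    by_cases hx : x ∈ D
    · rw [Set.indicator_of_mem hx, Set.indicator_of_mem hx, norm_mul, Complex.norm_real,
        Real.norm_of_nonneg (mul_nonneg (by positivity) (Real.log_natCast_nonneg _))]
      have h2 := hg x.1 x.2 (hD x hx)
      rw [Prod.mk.eta, Set.indicator_of_mem hx] at h2
      have h3 : ‖g x‖ ≤ 1 := by
        rw [h2, norm_mul, Complex.norm_exp_ofReal_mul_I, mul_one]
        exact ha _ _
      exact (mul_le_of_le_one_left (mul_nonneg (by positivity) (Real.log_natCast_nonneg _))
        h3).trans (rpow_neg_mul_log_le hσ)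
    · rw [Set.indicator_of_notMem hx, Set.indicator_of_notMem hx]
      simp
  refine ⟨hsum, ?_⟩
  obtain ⟨C, hC⟩ := exists_norm_tsum_sector_le hα hβ hw0 hw hκ hper ha
    (N := fun X Y => (α * X + β * Y) * (α * X - β * Y)) fun _ _ => rfl
  refine ⟨C, fun s h1 h2 => ?_⟩
  rw [tsum_cone (w := w) (hsum s h1) fun i Y hY =>
    Set.indicator_of_notMem (fun h => hY (mem_Icc_floor_of_abs_le (hD _ h))) _]
  convert hC s h1 h2 using 5 with i Y hY
  rw [← hg i Y (abs_le_of_mem_Icc_floor hw0 hY)]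
  by_cases hx : (i, Y) ∈ D
  · rw [Set.indicator_of_mem hx, Set.indicator_of_mem hx, hn _ hx]
  · rw [Set.indicator_of_notMem hx, Set.indicator_of_notMem hx, zero_mul]

end SectorSeries

/-- A totally positive fundamental unit `c + d√p` of `ℤ[√p]` with `c` even and `d` odd, for a prime
`p ≡ 3` mod `4`. -/
structure EvenPellUnit (p : ℕ) where
  c : ℤ
  d : ℤ
  c_pos : 0 < c
  d_pos : 0 < d
  pell : c ^ 2 - p * d ^ 2 = 1
  even_c : Even c
  odd_d : Odd d
  prime : p.Prime
  mod_four : p % 4 = 3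
  eq_pow : ∀ u : ℤ√(p : ℤ), u.norm = 1 → ∃ n : ℕ, u = ⟨c, d⟩ ^ n ∨ u = -⟨c, d⟩ ^ n ∨
    u = ⟨c, -d⟩ ^ n ∨ u = -⟨c, -d⟩ ^ n

namespace EvenPellUnit

variable {p : ℕ} (S : EvenPellUnit p)

include S

theorem odd_p : Odd (p : ℤ) := by
  have := S.mod_four
  rw [Int.odd_iff]
  omega

theorem p_pos : (0 : ℝ) < p := by exact_mod_cast S.prime.pos

theorem ne_mul_self (n : ℤ) : (p : ℤ) ≠ n * n := by
  intro h
  have h1 := S.mod_four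
  have h2 : (p : ℤ) % 4 = 3 := by omega
  rw [h] at h2
  have : n % 4 = 0 ∨ n % 4 = 1 ∨ n % 4 = 2 ∨ n % 4 = 3 := by omega
  rcases this with h3 | h3 | h3 | h3 <;> simp [Int.mul_emod, h3] at h2

theorem nonsquare : Zsqrtd.Nonsquare p :=
  ⟨fun n h => S.ne_mul_self n (by exact_mod_cast h)⟩

theorem norm_ne_neg_one (u : ℤ√(p : ℤ)) : u.norm ≠ -1 := by
  intro h
  rw [Zsqrtd.norm_def] at h
  have h1 := S.mod_four
  have h2 : (p : ℤ) % 4 = 3 := by omega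
  have h3 : (u.re * u.re - p * u.im * u.im) % 4 = 3 := by rw [h]; norm_num
  have hr : u.re % 4 = 0 ∨ u.re % 4 = 1 ∨ u.re % 4 = 2 ∨ u.re % 4 = 3 := by omega
  have hi : u.im % 4 = 0 ∨ u.im % 4 = 1 ∨ u.im % 4 = 2 ∨ u.im % 4 = 3 := by omega
  rcases hr with hr | hr | hr | hr <;> rcases hi with hi | hi | hi | hi <;>
    simp [Int.sub_emod, Int.mul_emod, hr, hi, h2] at h3

theorem norm_eq_one_of_isUnit {u : ℤ√(p : ℤ)} (hu : IsUnit u) : u.norm = 1 := by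
  have h := (Zsqrtd.isUnit_iff_norm_isUnit u).1 hu
  rcases Int.isUnit_iff.1 h with h | h
  · exact h
  · exact absurd h (S.norm_ne_neg_one u)

omit S in
/-- The two real embeddings of `ℤ[√p]` are `emb` and `emb ∘ star`. -/
noncomputable def emb : ℤ√(p : ℤ) →+* ℝ := Zsqrtd.toReal (Int.natCast_nonneg p)

omit S in
theorem emb_apply (x : ℤ√(p : ℤ)) : emb x = x.re + x.im * √p := rfl

omit S in
theorem emb_star_apply (x : ℤ√(p : ℤ)) : emb (star x) = x.re - x.im * √p := by
  rw [emb_apply]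
  simp [sub_eq_add_neg]

omit S in
theorem emb_mul_emb_star (x : ℤ√(p : ℤ)) : emb x * emb (star x) = x.norm := by
  rw [emb_apply, emb_star_apply, Zsqrtd.norm_def]
  have : (√p : ℝ) * √p = p := Real.mul_self_sqrt (Nat.cast_nonneg p)
  push_cast
  linear_combination -(x.im : ℝ) ^ 2 * this

theorem emb_ne_zero {x : ℤ√(p : ℤ)} (hx : x ≠ 0) : emb x ≠ 0 :=
  fun h => hx (Zsqrtd.toReal_injective (Int.natCast_nonneg p) S.ne_mul_self
    (h.trans (map_zero _).symm))

omit S in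
/-- The logarithm of the ratio of the two real embeddings. -/
noncomputable def logRatio (x : ℤ√(p : ℤ)) : ℝ := Real.log (emb x) - Real.log (emb (star x))

theorem logRatio_mul {x y : ℤ√(p : ℤ)} (hx : x ≠ 0) (hy : y ≠ 0) :
    logRatio (x * y) = logRatio x + logRatio y := by
  rw [logRatio, logRatio, logRatio, star_mul, map_mul, map_mul,
    Real.log_mul (S.emb_ne_zero hx) (S.emb_ne_zero hy),
    Real.log_mul (S.emb_ne_zero (star_ne_zero.2 hy)) (S.emb_ne_zero (star_ne_zero.2 hx))]
  ring

omit S in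
theorem logRatio_neg (x : ℤ√(p : ℤ)) : logRatio (-x) = logRatio x := by
  simp [logRatio]

omit S in
theorem logRatio_star (x : ℤ√(p : ℤ)) : logRatio (star x) = -logRatio x := by
  simp [logRatio]

/-- The fundamental unit. -/
def unit : ℤ√(p : ℤ) := ⟨S.c, S.d⟩

/-- The regulator, `log (c + d√p)`. -/
noncomputable def reg : ℝ := Real.log (emb S.unit)

theorem norm_unit : S.unit.norm = 1 := by
  rw [Zsqrtd.norm_def, ← S.pell]
  simp only [unit]
  ring

theorem emb_unit_star_pos : 0 < emb (star S.unit) := by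
  have h := emb_mul_emb_star S.unit
  rw [S.norm_unit] at h
  have h1 : 0 < emb S.unit := by
    have := S.c_pos
    have := S.d_pos
    rw [emb_apply]
    simp only [unit]
    positivity
  by_contra h2
  push_cast at h
  nlinarith

theorem emb_unit_star : emb (star S.unit) = (emb S.unit)⁻¹ := by
  have h := emb_mul_emb_star S.unit
  rw [S.norm_unit, Int.cast_one] at h
  exact eq_inv_of_mul_eq_one_right h

theorem reg_pos : 0 < S.reg := by
  apply Real.log_pos
  have h1 : (1 : ℝ) ≤ S.c := by exact_mod_cast S.c_pos
  have h2 : (1 : ℝ) ≤ S.d := by exact_mod_cast S.d_pos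
  have h3 : 0 < √(p : ℝ) := Real.sqrt_pos.2 S.p_pos
  rw [emb_apply]
  simp only [unit]
  nlinarith

theorem logRatio_unit : logRatio S.unit = 2 * S.reg := by
  rw [logRatio, S.emb_unit_star, Real.log_inv, reg]
  ring

/-- The elements of odd norm are those whose two coordinates have opposite parities. -/
theorem odd_norm_iff {x : ℤ√(p : ℤ)} : Odd x.norm ↔ (Even x.re ↔ ¬ Even x.im) := by
  rw [Zsqrtd.norm_def]
  have h := S.odd_p
  by_cases h1 : Even x.re <;> by_cases h2 : Even x.im <;>
    simp [← Int.not_even_iff_odd, Int.even_sub, Int.even_mul, h1, h2, Int.not_even_iff_odd.2 h]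

omit S in
theorem ne_zero_of_odd_norm {x : ℤ√(p : ℤ)} (hx : Odd x.norm) : x ≠ 0 := by
  rintro rfl
  simp at hx

omit S in
/-- The correction by `1 / 2` for elements with even rational part. -/
noncomputable def parityShift (x : ℤ√(p : ℤ)) : ℝ := by
  classical exact if Even x.re then 1 / 2 else 0

/-- The angle of an element of odd norm, which depends only on its associate class. -/
noncomputable def angle (x : ℤ√(p : ℤ)) : AddCircle (1 : ℝ) :=
  ((logRatio x / (4 * S.reg) + parityShift x : ℝ) : AddCircle (1 : ℝ))

omit S in
theorem parityShift_of_even {x : ℤ√(p : ℤ)} (hx : Even x.re) : parityShift x = 1 / 2 := by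
  simp [parityShift, hx]

omit S in
theorem parityShift_of_odd {x : ℤ√(p : ℤ)} (hx : Odd x.re) : parityShift x = 0 := by
  simp [parityShift, Int.not_even_iff_odd.2 hx]

theorem even_re_mul_iff {x y : ℤ√(p : ℤ)} (hx : Odd x.norm) (hy : Odd y.norm) :
    Even (x * y).re ↔ ¬ (Even x.re ↔ Even y.re) := by
  have h := Int.not_even_iff_odd.2 S.odd_p
  have hx' := S.odd_norm_iff.1 hx
  have hy' := S.odd_norm_iff.1 hy
  rw [Zsqrtd.re_mul]
  simp only [Int.even_add, Int.even_mul]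
  tauto

theorem parityShift_mul {x y : ℤ√(p : ℤ)} (hx : Odd x.norm) (hy : Odd y.norm) :
    ∃ n : ℤ, parityShift (x * y) + n = parityShift x + parityShift y := by
  have h := S.even_re_mul_iff hx hy
  rcases Int.even_or_odd x.re with h1 | h1 <;> rcases Int.even_or_odd y.re with h2 | h2
  · refine ⟨1, ?_⟩
    rw [parityShift_of_even h1, parityShift_of_even h2, parityShift_of_odd]
    · norm_num
    · rw [← Int.not_even_iff_odd, h]
      tauto
  · refine ⟨0, ?_⟩
    rw [parityShift_of_even h1, parityShift_of_odd h2, parityShift_of_even]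
    · norm_num
    · rw [h, ← Int.not_even_iff_odd] at *
      tauto
  · refine ⟨0, ?_⟩
    rw [parityShift_of_odd h1, parityShift_of_even h2, parityShift_of_even]
    · norm_num
    · rw [h, ← Int.not_even_iff_odd] at *
      tauto
  · refine ⟨0, ?_⟩
    rw [parityShift_of_odd h1, parityShift_of_odd h2, parityShift_of_odd]
    · norm_num
    · rw [← Int.not_even_iff_odd, h]
      rw [← Int.not_even_iff_odd] at h1 h2
      tauto

omit S in
theorem addCircle_coe_eq_iff {x y : ℝ} :
    (x : AddCircle (1 : ℝ)) = y ↔ ∃ n : ℤ, (n : ℝ) = x - y := by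
  rw [← sub_eq_zero, ← AddCircle.coe_sub, AddCircle.coe_eq_zero_iff]
  simp

theorem angle_mul {x y : ℤ√(p : ℤ)} (hx : Odd x.norm) (hy : Odd y.norm) :
    S.angle (x * y) = S.angle x + S.angle y := by
  obtain ⟨n, hn⟩ := S.parityShift_mul hx hy
  rw [angle, angle, angle, ← AddCircle.coe_add, addCircle_coe_eq_iff]
  refine ⟨-n, ?_⟩
  rw [S.logRatio_mul (ne_zero_of_odd_norm hx) (ne_zero_of_odd_norm hy), add_div]
  push_cast
  linarith

theorem angle_unit : S.angle S.unit = 0 := by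
  rw [angle, S.logRatio_unit, parityShift_of_even (by exact S.even_c), ← AddCircle.coe_zero,
    addCircle_coe_eq_iff]
  have := S.reg_pos
  refine ⟨1, ?_⟩
  field_simp
  norm_num

theorem angle_one : S.angle 1 = 0 := by
  have := S.angle_mul (x := 1) (y := 1) (by simp) (by simp)
  simpa using this

omit S in
theorem parityShift_neg (x : ℤ√(p : ℤ)) : parityShift (-x) = parityShift x := by
  simp [parityShift]

theorem angle_neg (x : ℤ√(p : ℤ)) : S.angle (-x) = S.angle x := by
  rw [angle, logRatio_neg, parityShift_neg, ← angle]

omit S in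
theorem parityShift_star (x : ℤ√(p : ℤ)) : parityShift (star x) = parityShift x := by
  simp [parityShift]

theorem angle_star (x : ℤ√(p : ℤ)) : S.angle (star x) = -S.angle x := by
  rw [angle, angle, logRatio_star, parityShift_star, ← AddCircle.coe_neg, addCircle_coe_eq_iff]
  rcases Int.even_or_odd x.re with h | h
  · rw [parityShift_of_even h]
    exact ⟨1, by push_cast; ring⟩
  · rw [parityShift_of_odd h]
    exact ⟨0, by push_cast; ring⟩

theorem angle_pow {x : ℤ√(p : ℤ)} (hx : x.norm = 1) (h0 : S.angle x = 0) (n : ℕ) :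
    S.angle (x ^ n) = 0 := by
  induction n with
  | zero => simpa using S.angle_one
  | succ n ih =>
    have hn : (x ^ n).norm = 1 := by
      change Zsqrtd.normMonoidHom (x ^ n) = 1
      rw [map_pow, show Zsqrtd.normMonoidHom x = 1 from hx, one_pow]
    rw [pow_succ, S.angle_mul (by simp [hn]) (by simp [hx]), ih, h0, add_zero]

theorem angle_of_isUnit {u : ℤ√(p : ℤ)} (hu : IsUnit u) : S.angle u = 0 := by
  have h1 := S.angle_pow S.norm_unit S.angle_unit
  have h2 := S.angle_pow (x := star S.unit) (by rw [Zsqrtd.norm_conj, S.norm_unit])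
    (by rw [angle_star, angle_unit, neg_zero])
  obtain ⟨n, h | h | h | h⟩ := S.eq_pow u (S.norm_eq_one_of_isUnit hu)
  · rw [h]
    exact h1 n
  · rw [h, angle_neg]
    exact h1 n
  · rw [h]
    exact h2 n
  · rw [h, angle_neg]
    exact h2 n

/-- A unit with equal real embeddings is `±1`. -/
theorem eq_one_or_neg_one_of_logRatio_eq_zero {u : ℤ√(p : ℤ)} (hu : IsUnit u)
    (h0 : logRatio u = 0) : u = 1 ∨ u = -1 := by
  have key : ∀ n : ℕ, logRatio (S.unit ^ n) = n * (2 * S.reg) := by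
    intro n
    have := S.nonsquare
    induction n with
    | zero => simp [logRatio]
    | succ n ih =>
      have h1 : S.unit ≠ 0 := fun h => by
        have := S.norm_unit
        simp [h] at this
      rw [pow_succ, S.logRatio_mul (pow_ne_zero n h1) h1, ih, S.logRatio_unit]
      push_cast
      ring
  have key' : ∀ n : ℕ, logRatio (star S.unit ^ n) = -(n * (2 * S.reg)) := by
    intro n
    rw [← star_pow, logRatio_star, key]
  have hr := S.reg_pos
  have hn : ∀ n : ℕ, (n : ℝ) * (2 * S.reg) = 0 → n = 0 := by
    intro n h
    rcases mul_eq_zero.1 h with h | h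
    · exact_mod_cast h
    · linarith
  obtain ⟨n, h | h | h | h⟩ := S.eq_pow u (S.norm_eq_one_of_isUnit hu)
  · have h2 : logRatio (S.unit ^ n) = 0 := by rw [← h0, h]; rfl
    rw [key] at h2
    simp [h, hn n h2]
  · have h2 : logRatio (S.unit ^ n) = 0 := by rw [← h0, h, logRatio_neg]; rfl
    rw [key] at h2
    simp [h, hn n h2]
  · have h2 : logRatio (star S.unit ^ n) = 0 := by rw [← h0, h]; rfl
    rw [key', neg_eq_zero] at h2
    simp [h, hn n h2]
  · have h2 : logRatio (star S.unit ^ n) = 0 := by rw [← h0, h, logRatio_neg]; rfl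
    rw [key', neg_eq_zero] at h2
    simp [h, hn n h2]

end EvenPellUnit

namespace EvenPellUnit

variable {p : ℕ} (S : EvenPellUnit p)

/-- The elements `X + Y√p` with `X > 0` odd and `|Y| / X ≤ d / c`. -/
def PosReduced (x : ℤ√(p : ℤ)) : Prop :=
  Odd x.re ∧ 0 < x.re ∧ S.c * |x.im| ≤ S.d * x.re

/-- The elements `Y + X√p` with `Y` odd, `X > 0` and `|Y| / X ≤ p * d / c`. -/
def NegReduced (x : ℤ√(p : ℤ)) : Prop :=
  Odd x.re ∧ 0 < x.im ∧ S.c * |x.re| ≤ p * S.d * x.im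

variable {S}

theorem PosReduced.norm_pos {x : ℤ√(p : ℤ)} (hx : S.PosReduced x) :
    0 < x.norm := by
  obtain ⟨-, h1, h2⟩ := hx
  have hc := S.c_pos
  have h3 : (S.c * |x.im|) ^ 2 ≤ (S.d * x.re) ^ 2 := by gcongr
  rw [mul_pow, sq_abs] at h3
  rw [Zsqrtd.norm_def]
  have h4 : 0 < S.c ^ 2 * (x.re * x.re - p * x.im * x.im) := by
    have := S.pell
    have hp := Int.natCast_nonneg p
    nlinarith [mul_pos h1 h1]
  exact pos_of_mul_pos_right h4 (by positivity)

theorem NegReduced.norm_neg {x : ℤ√(p : ℤ)} (hx : S.NegReduced x) :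
    x.norm < 0 := by
  obtain ⟨-, h1, h2⟩ := hx
  have hc := S.c_pos
  have h3 : (S.c * |x.re|) ^ 2 ≤ (p * S.d * x.im) ^ 2 := by gcongr
  rw [mul_pow, sq_abs] at h3
  rw [Zsqrtd.norm_def]
  have hp : (0 : ℤ) < p := by exact_mod_cast S.prime.pos
  have h4 : 0 < S.c ^ 2 * (p * x.im * x.im - x.re * x.re) := by
    have h5 : (p * S.d * x.im) ^ 2 = p * (S.c ^ 2 - 1) * x.im ^ 2 := by
      rw [← S.pell]
      ring
    rw [h5] at h3
    nlinarith [mul_pos hp (mul_pos h1 h1)]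
  have := pos_of_mul_pos_right h4 (by positivity)
  linarith

theorem PosReduced.lt {x : ℤ√(p : ℤ)} (hx : S.PosReduced x) :
    S.c * |x.im| < S.d * x.re := by
  refine lt_of_le_of_ne hx.2.2 fun h => ?_
  have h1 : Even (S.d * x.re) := h ▸ S.even_c.mul_right _
  exact Int.not_even_iff_odd.2 (S.odd_d.mul hx.1) h1

variable (S) in
theorem not_dvd_c : ¬ (p : ℤ) ∣ S.c := by
  intro h
  have h1 : (p : ℤ) ∣ 1 := by
    rw [← S.pell]
    exact dvd_sub (dvd_pow h two_ne_zero) (dvd_mul_right _ _)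
  exact S.prime.one_lt.ne' (Nat.dvd_one.1 (by exact_mod_cast h1))

theorem NegReduced.lt {x : ℤ√(p : ℤ)} (hx : S.NegReduced x)
    (hn : ¬ (p : ℤ) ∣ x.norm) : S.c * |x.re| < p * S.d * x.im := by
  refine lt_of_le_of_ne hx.2.2 fun h => hn ?_
  have hp := Nat.prime_iff_prime_int.1 S.prime
  have h1 : (p : ℤ) ∣ S.c * |x.re| := by
    rw [h, mul_assoc]
    exact dvd_mul_right _ _
  have h2 := (dvd_abs _ _).1 ((hp.dvd_or_dvd h1).resolve_left S.not_dvd_c)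
  rw [Zsqrtd.norm_def, mul_assoc]
  exact dvd_sub (h2.mul_left _) (dvd_mul_right _ _)

variable (S) in
theorem log_emb_unit_star : Real.log (emb (star S.unit)) = -S.reg := by
  rw [S.emb_unit_star, Real.log_inv, reg]

theorem PosReduced.emb_pos {x : ℤ√(p : ℤ)} (hx : S.PosReduced x) :
    0 < emb x ∧ 0 < emb (star x) := by
  have h1 : 0 < emb x * emb (star x) := by
    rw [emb_mul_emb_star]
    exact_mod_cast hx.norm_pos
  have h2 : emb x + emb (star x) = 2 * x.re := by
    rw [emb_apply, emb_star_apply]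
    ring
  have h3 : (0 : ℝ) < x.re := by exact_mod_cast hx.2.1
  rcases mul_pos_iff.1 h1 with h | h
  · exact h
  · linarith

theorem NegReduced.emb_pos {x : ℤ√(p : ℤ)} (hx : S.NegReduced x) :
    0 < emb x ∧ emb (star x) < 0 := by
  have h1 : emb x * emb (star x) < 0 := by
    rw [emb_mul_emb_star]
    exact_mod_cast hx.norm_neg
  have h2 : emb x - emb (star x) = 2 * x.im * √p := by
    rw [emb_apply, emb_star_apply]
    ring
  have h3 : (0 : ℝ) < x.im := by exact_mod_cast hx.2.1
  have h4 : 0 < √(p : ℝ) := Real.sqrt_pos.2 S.p_pos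
  rcases mul_neg_iff.1 h1 with h | h
  · exact h
  · have : (0 : ℝ) < 2 * x.im * √p := by positivity
    linarith

theorem PosReduced.logRatio_lt {x : ℤ√(p : ℤ)} (hx : S.PosReduced x) :
    logRatio x < 2 * S.reg := by
  obtain ⟨ha, hb⟩ := hx.emb_pos
  have he := S.emb_unit_star_pos
  have he' : 0 < emb S.unit := inv_pos.1 (S.emb_unit_star ▸ he)
  have h4 : 0 < √(p : ℝ) := Real.sqrt_pos.2 S.p_pos
  have hlt : (S.c * x.im : ℝ) < S.d * x.re := by
    exact_mod_cast (mul_le_mul_of_nonneg_left (le_abs_self x.im) S.c_pos.le).trans_lt hx.lt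
  have key : emb x * emb (star S.unit) < emb (star x) * emb S.unit := by
    rw [emb_star_apply, emb_star_apply, emb_apply, emb_apply]
    simp only [unit]
    nlinarith
  have := Real.log_lt_log (mul_pos ha he) key
  rw [Real.log_mul ha.ne' he.ne', Real.log_mul hb.ne' he'.ne', S.log_emb_unit_star, ← reg] at this
  rw [logRatio]
  linarith

theorem NegReduced.logRatio_lt {x : ℤ√(p : ℤ)} (hx : S.NegReduced x)
    (hn : ¬ (p : ℤ) ∣ x.norm) : logRatio x < 2 * S.reg := by
  obtain ⟨ha, hb⟩ := hx.emb_pos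
  have he := S.emb_unit_star_pos
  have he' : 0 < emb S.unit := inv_pos.1 (S.emb_unit_star ▸ he)
  have h4 : √(p : ℝ) * √p = p := Real.mul_self_sqrt (Nat.cast_nonneg p)
  have hlt : (S.c * x.re : ℝ) < p * S.d * x.im := by
    exact_mod_cast (mul_le_mul_of_nonneg_left (le_abs_self x.re) S.c_pos.le).trans_lt (hx.lt hn)
  have key : emb x * emb (star S.unit) < -emb (star x) * emb S.unit := by
    rw [emb_star_apply, emb_star_apply, emb_apply, emb_apply]
    simp only [unit]
    have e : (x.re + x.im * √p) * (S.c - S.d * √p) - -(x.re - x.im * √p) * (S.c + S.d * √p) =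
      2 * (S.c * x.re - p * S.d * x.im) := by
      linear_combination (-2 * x.im * S.d : ℝ) * h4
    linarith
  have := Real.log_lt_log (mul_pos ha he) key
  rw [Real.log_mul ha.ne' he.ne', Real.log_mul (neg_pos.2 hb).ne' he'.ne', S.log_emb_unit_star,
    ← reg, Real.log_neg_eq_log] at this
  rw [logRatio]
  linarith

theorem PosReduced.star {x : ℤ√(p : ℤ)} (hx : S.PosReduced x) :
    S.PosReduced (star x) := by
  simpa [PosReduced] using hx

theorem NegReduced.neg_star {x : ℤ√(p : ℤ)} (hx : S.NegReduced x) :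
    S.NegReduced (-star x) := by
  simpa [NegReduced] using hx

theorem PosReduced.abs_logRatio_lt {x : ℤ√(p : ℤ)} (hx : S.PosReduced x) :
    |logRatio x| < 2 * S.reg := by
  have h := hx.star.logRatio_lt
  rw [logRatio_star] at h
  exact abs_lt.2 ⟨by linarith, hx.logRatio_lt⟩

theorem NegReduced.abs_logRatio_lt {x : ℤ√(p : ℤ)} (hx : S.NegReduced x)
    (hn : ¬ (p : ℤ) ∣ x.norm) : |logRatio x| < 2 * S.reg := by
  have h := hx.neg_star.logRatio_lt (by rwa [Zsqrtd.norm_neg, Zsqrtd.norm_conj])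
  rw [logRatio_neg, logRatio_star] at h
  exact abs_lt.2 ⟨by linarith, hx.logRatio_lt hn⟩

variable (S) in
include S in
theorem coprime_iff {n : ℤ} :
    n.natAbs.Coprime (2 * p) ↔ Odd n ∧ ¬ (p : ℤ) ∣ n := by
  rw [Nat.coprime_mul_iff_right, Nat.coprime_two_right, Int.natAbs_odd, Nat.coprime_comm,
    (Nat.Prime.coprime_iff_not_dvd S.prime), Int.natCast_dvd]

/-- Two reduced associates are equal. -/
theorem eq_of_associated {x y : ℤ√(p : ℤ)} (h : Associated x y)
    (hn : x.norm.natAbs.Coprime (2 * p)) (hx : S.PosReduced x ∨ S.NegReduced x)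
    (hy : S.PosReduced y ∨ S.NegReduced y) : x = y := by
  obtain ⟨hodd, hdvd⟩ := S.coprime_iff.1 hn
  obtain ⟨u, hu⟩ := h
  have hu1 := S.norm_eq_one_of_isUnit u.isUnit
  have hnorm : y.norm = x.norm := by rw [← hu, Zsqrtd.norm_mul, hu1, mul_one]
  have hxl : |logRatio x| < 2 * S.reg := hx.elim (·.abs_logRatio_lt) (·.abs_logRatio_lt hdvd)
  have hyl : |logRatio y| < 2 * S.reg :=
    hy.elim (·.abs_logRatio_lt) (·.abs_logRatio_lt (hnorm ▸ hdvd))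
  have hxo : Odd x.re := hx.elim (·.1) (·.1)
  have hyo : Odd y.re := hy.elim (·.1) (·.1)
  have hang : S.angle y = S.angle x := by
    rw [← hu, S.angle_mul hodd (by simp [hu1]), S.angle_of_isUnit u.isUnit, add_zero]
  have hr := S.reg_pos
  rw [angle, angle, parityShift_of_odd hxo, parityShift_of_odd hyo, addCircle_coe_eq_iff] at hang
  obtain ⟨n, hn⟩ := hang
  have hn' : (n : ℝ) * (4 * S.reg) = logRatio y - logRatio x := by
    rw [hn]
    field_simp
    ring
  have hn0 : n = 0 := by
    rw [abs_lt] at hxl hyl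
    have h1 : (n : ℝ) < 1 := by nlinarith
    have h2 : (-1 : ℝ) < n := by nlinarith
    have h1' : n < 1 := by exact_mod_cast h1
    have h2' : -1 < n := by exact_mod_cast h2
    omega
  have hlu : logRatio (u : ℤ√(p : ℤ)) = 0 := by
    have := S.logRatio_mul (ne_zero_of_odd_norm hodd) (ne_zero_of_odd_norm (x := u) (by simp [hu1]))
    rw [hu] at this
    simp only [hn0, Int.cast_zero, zero_mul] at hn'
    linarith
  rcases S.eq_one_or_neg_one_of_logRatio_eq_zero u.isUnit hlu with h | h
  · rw [← hu, h, mul_one]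
  · exfalso
    have hyx : y = -x := by rw [← hu, h, mul_neg_one]
    have hre : y.re = -x.re := by rw [hyx]; simp
    have him : y.im = -x.im := by rw [hyx]; simp
    rcases hx with hx | hx <;> rcases hy with hy | hy
    · have := hx.2.1
      have := hy.2.1
      omega
    · have := hx.norm_pos
      have := hy.norm_neg
      omega
    · have := hy.norm_pos
      have := hx.norm_neg
      omega
    · have := hx.2.1
      have := hy.2.1
      omega


theorem odd_re_mul_unit_iff {x : ℤ√(p : ℤ)} (hx : Odd x.norm) :
    Odd (x * S.unit).re ↔ Even x.re := by
  rw [← Int.not_even_iff_odd, S.even_re_mul_iff hx (by simp [S.norm_unit])]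
  have : Even S.unit.re := S.even_c
  tauto

variable (S) in
theorem isUnit_unit : IsUnit S.unit :=
  (Zsqrtd.isUnit_iff_norm_isUnit _).2 (by simp [S.norm_unit])

variable (S) in
include S in
theorem exists_associated_odd_re {x : ℤ√(p : ℤ)} (hx : Odd x.norm) :
    ∃ y, Associated x y ∧ Odd y.re ∧ y.norm = x.norm := by
  by_cases h : Odd x.re
  · exact ⟨x, .refl x, h, rfl⟩
  · refine ⟨x * S.unit, (associated_mul_unit_left _ _ S.isUnit_unit).symm, ?_, ?_⟩
    · rw [S.odd_re_mul_unit_iff hx]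
      exact Int.not_odd_iff_even.1 h
    · rw [Zsqrtd.norm_mul, S.norm_unit, mul_one]

theorem re_mul_unit_sq (x : ℤ√(p : ℤ)) :
    (x * S.unit ^ 2).re = (1 + 2 * p * S.d ^ 2) * x.re + 2 * S.c * S.d * p * x.im := by
  have := S.pell
  simp only [unit, pow_two, Zsqrtd.re_mul, Zsqrtd.im_mul]
  linear_combination x.re * this

theorem im_mul_unit_sq (x : ℤ√(p : ℤ)) :
    (x * S.unit ^ 2).im = (1 + 2 * p * S.d ^ 2) * x.im + 2 * S.c * S.d * x.re := by
  have := S.pell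
  simp only [unit, pow_two, Zsqrtd.re_mul, Zsqrtd.im_mul]
  linear_combination x.im * this

theorem re_mul_star_unit_sq (x : ℤ√(p : ℤ)) :
    (x * star S.unit ^ 2).re = (1 + 2 * p * S.d ^ 2) * x.re - 2 * S.c * S.d * p * x.im := by
  have := S.pell
  simp only [unit, pow_two, Zsqrtd.re_mul, Zsqrtd.im_mul, Zsqrtd.star_mk]
  linear_combination x.re * this

theorem im_mul_star_unit_sq (x : ℤ√(p : ℤ)) :
    (x * star S.unit ^ 2).im = (1 + 2 * p * S.d ^ 2) * x.im - 2 * S.c * S.d * x.re := by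
  have := S.pell
  simp only [unit, pow_two, Zsqrtd.re_mul, Zsqrtd.im_mul, Zsqrtd.star_mk]
  linear_combination x.im * this

variable (S) in
include S in
theorem odd_re_mul_sq {x u : ℤ√(p : ℤ)} (hx : Odd x.norm) (hr : Odd x.re) (hu : u.norm = 1) :
    Odd (x * u ^ 2).re := by
  have h1 : Odd u.norm := by simp [hu]
  have h2 : Odd (u ^ 2).norm := by simp [pow_two, hu]
  have h3 : ¬ Even (u ^ 2).re := by
    rw [pow_two, S.even_re_mul_iff h1 h1]
    tauto
  rw [← Int.not_even_iff_odd, S.even_re_mul_iff hx h2]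
  rw [← Int.not_even_iff_odd] at hr
  tauto

variable (S) in
theorem exists_associated_of_forall_le {x : ℤ√(p : ℤ)} (hx : Odd x.norm)
    (g : ℤ√(p : ℤ) → ℕ) :
    ∃ y, Associated x y ∧ Odd y.re ∧ y.norm = x.norm ∧
      g y ≤ g (y * S.unit ^ 2) ∧ g y ≤ g (y * star S.unit ^ 2) := by
  classical
  have hex : ∃ n, ∃ y, Associated x y ∧ Odd y.re ∧ y.norm = x.norm ∧ g y = n := by
    obtain ⟨y, h1, h2, h3⟩ := S.exists_associated_odd_re hx
    exact ⟨g y, y, h1, h2, h3, rfl⟩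
  obtain ⟨y, h1, h2, h3, h4⟩ := Nat.find_spec hex
  have key : ∀ u : ℤ√(p : ℤ), IsUnit u → g y ≤ g (y * u ^ 2) := by
    intro u hu
    have hu1 := S.norm_eq_one_of_isUnit hu
    rw [h4]
    refine Nat.find_min' hex ⟨_, h1.trans (associated_mul_unit_left _ _ (hu.pow 2)).symm,
      S.odd_re_mul_sq (h3 ▸ hx) h2 hu1, ?_, rfl⟩
    rw [← h3, Zsqrtd.norm_mul, pow_two, Zsqrtd.norm_mul, hu1, mul_one, mul_one]
  exact ⟨y, h1, h2, h3, key _ S.isUnit_unit, key _ S.isUnit_unit.star⟩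

/-- If the two shifts of a dominant coordinate do not decrease it, then the other coordinate is
small. -/
theorem mul_abs_le_of_natAbs_le {A B D E : ℤ} (hA : 0 < A) (hD : 0 ≤ D)
    (hEB : (E * B) ^ 2 ≤ ((1 + D) * A) ^ 2)
    (h1 : A.natAbs ≤ ((1 + D) * A + E * B).natAbs) (h2 : A.natAbs ≤ ((1 + D) * A - E * B).natAbs) :
    |E * B| ≤ D * A := by
  have h3 := abs_le_of_sq_le_sq' hEB (by positivity)
  have h4 : A ≤ (1 + D) * A + E * B := by
    zify at h1
    rwa [abs_of_pos hA, abs_of_nonneg (by linarith [h3.1])] at h1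
  have h5 : A ≤ (1 + D) * A - E * B := by
    zify at h2
    rwa [abs_of_pos hA, abs_of_nonneg (by linarith [h3.2])] at h2
  rw [abs_le]
  constructor <;> linarith

variable (S) in
theorem exists_posReduced {x : ℤ√(p : ℤ)} (hx : Odd x.norm) (hpos : 0 < x.norm) :
    ∃ y, Associated x y ∧ S.PosReduced y := by
  obtain ⟨y, h1, h2, h3, h4, h5⟩ := S.exists_associated_of_forall_le hx fun y => y.re.natAbs
  wlog hre : 0 < y.re generalizing y
  · have hne : y.re ≠ 0 := by
      rintro h
      simp [h] at h2
    refine this (-y) (h1.trans (Associated.refl y).neg_right) (by simpa using h2)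
      (by rw [Zsqrtd.norm_neg, h3]) (by simpa only [neg_mul, Zsqrtd.re_neg, Int.natAbs_neg] using h4)
      (by simpa only [neg_mul, Zsqrtd.re_neg, Int.natAbs_neg] using h5) ?_
    simp only [Zsqrtd.re_neg]
    omega
  refine ⟨y, h1, h2, hre, ?_⟩
  rw [re_mul_unit_sq] at h4
  rw [re_mul_star_unit_sq] at h5
  have hp : (0 : ℤ) < p := by exact_mod_cast S.prime.pos
  have hd := S.d_pos
  have hc := S.c_pos
  have h6 := mul_abs_le_of_natAbs_le hre (D := 2 * p * S.d ^ 2) (E := 2 * S.c * S.d * p)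
    (by positivity) ?_ h4 h5
  · rw [abs_mul, abs_of_pos (by positivity)] at h6
    have : (2 * S.d * p) * (S.c * |y.im|) ≤ (2 * S.d * p) * (S.d * y.re) := by linarith
    exact le_of_mul_le_mul_left this (by positivity)
  · rw [← h3, Zsqrtd.norm_def] at hpos
    have e : (1 + 2 * p * S.d ^ 2) ^ 2 = 1 + 4 * S.c ^ 2 * S.d ^ 2 * p := by
      rw [show S.c ^ 2 = 1 + p * S.d ^ 2 by linarith [S.pell]]
      ring
    rw [mul_pow, mul_pow _ y.re, e]
    have : 0 ≤ 4 * S.c ^ 2 * S.d ^ 2 * p * (y.re * y.re - p * y.im * y.im) := by positivity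
    nlinarith [sq_nonneg y.re]

variable (S) in
theorem exists_negReduced {x : ℤ√(p : ℤ)} (hx : Odd x.norm) (hneg : x.norm < 0) :
    ∃ y, Associated x y ∧ S.NegReduced y := by
  obtain ⟨y, h1, h2, h3, h4, h5⟩ := S.exists_associated_of_forall_le hx fun y => y.im.natAbs
  wlog him : 0 < y.im generalizing y
  · have hne : y.im ≠ 0 := by
      rintro h
      rw [← h3, Zsqrtd.norm_def, h] at hneg
      nlinarith [mul_self_nonneg y.re]
    refine this (-y) (h1.trans (Associated.refl y).neg_right) (by simpa using h2)
      (by rw [Zsqrtd.norm_neg, h3]) (by simpa only [neg_mul, Zsqrtd.im_neg, Int.natAbs_neg] using h4)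
      (by simpa only [neg_mul, Zsqrtd.im_neg, Int.natAbs_neg] using h5) ?_
    simp only [Zsqrtd.im_neg]
    omega
  refine ⟨y, h1, h2, him, ?_⟩
  rw [im_mul_unit_sq] at h4
  rw [im_mul_star_unit_sq] at h5
  have hp : (0 : ℤ) < p := by exact_mod_cast S.prime.pos
  have hd := S.d_pos
  have hc := S.c_pos
  have h6 := mul_abs_le_of_natAbs_le him (D := 2 * p * S.d ^ 2) (E := 2 * S.c * S.d)
    (by positivity) ?_ h4 h5
  · rw [abs_mul, abs_of_pos (by positivity)] at h6
    have : (2 * S.d) * (S.c * |y.re|) ≤ (2 * S.d) * (p * S.d * y.im) := by linarith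
    exact le_of_mul_le_mul_left this (by positivity)
  · rw [← h3, Zsqrtd.norm_def] at hneg
    have e : (1 + 2 * p * S.d ^ 2) ^ 2 = 1 + 4 * S.c ^ 2 * S.d ^ 2 * p := by
      rw [show S.c ^ 2 = 1 + p * S.d ^ 2 by linarith [S.pell]]
      ring
    rw [mul_pow, mul_pow _ y.im, e]
    have : 0 ≤ 4 * S.c ^ 2 * S.d ^ 2 * -(y.re * y.re - p * y.im * y.im) :=
      mul_nonneg (by positivity) (by linarith)
    nlinarith [sq_nonneg y.im]

end EvenPellUnit

/-- A multiplicative map which is trivial on units descends to associate classes. -/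
def Associates.liftMonoidWithZeroHom {R A : Type*} [CommMonoidWithZero R] [MulZeroOneClass A]
    (f : R →*₀ A) (hf : ∀ u, IsUnit u → f u = 1) : Associates R →*₀ A where
  toFun := Quotient.lift f fun x y ⟨u, hu⟩ => by rw [← hu, map_mul, hf u u.isUnit, mul_one]
  map_zero' := map_zero f
  map_one' := map_one f
  map_mul' x y := Quotient.inductionOn₂ x y fun x y => map_mul f x y

namespace EvenPellUnit

variable {p : ℕ} (S : EvenPellUnit p)

/-- The absolute norm of an associate class in `ℤ[√p]`. -/
def absNorm : Associates (ℤ√(p : ℤ)) →*₀ ℕ :=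
  Associates.liftMonoidWithZeroHom
    { toFun := fun x => x.norm.natAbs
      map_zero' := by simp
      map_one' := by simp
      map_mul' := fun x y => by rw [Zsqrtd.norm_mul, Int.natAbs_mul] }
    fun u hu => Zsqrtd.norm_eq_one_iff.2 hu

theorem absNorm_mk (x : ℤ√(p : ℤ)) : absNorm (Associates.mk x) = x.norm.natAbs := rfl

/-- The elements `X + Y√p` with `X` positive. -/
def posPoint (p : ℕ) (x : ℕ × ℤ) : ℤ√(p : ℤ) := ⟨x.1 + 1, x.2⟩

/-- The elements `Y + X√p` with `X` positive. -/
def negPoint (p : ℕ) (x : ℕ × ℤ) : ℤ√(p : ℤ) := ⟨x.2, x.1 + 1⟩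

theorem posPoint_injective : Function.Injective (posPoint p) := by
  intro x y h
  simp only [posPoint, Zsqrtd.ext_iff] at h
  exact Prod.ext (by omega) h.2

theorem negPoint_injective : Function.Injective (negPoint p) := by
  intro x y h
  simp only [negPoint, Zsqrtd.ext_iff] at h
  exact Prod.ext (by omega) h.1

theorem exists_posPoint {y : ℤ√(p : ℤ)} (hy : S.PosReduced y) : ∃ x, posPoint p x = y := by
  refine ⟨(y.re.natAbs - 1, y.im), ?_⟩
  have := hy.2.1
  ext
  · simp only [posPoint]
    omega
  · rfl

theorem exists_negPoint {y : ℤ√(p : ℤ)} (hy : S.NegReduced y) : ∃ x, negPoint p x = y := by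
  refine ⟨(y.im.natAbs - 1, y.re), ?_⟩
  have := hy.2.1
  ext
  · rfl
  · simp only [negPoint]
    omega

/-- A sum over associate classes, supported on norms coprime to `2 * p`, decomposes into two sums
over lattice points in sectors. -/
theorem hasSum_associates {E : Type*} [AddCommMonoid E] [TopologicalSpace E] [ContinuousAdd E]
    {G : Associates (ℤ√(p : ℤ)) → E} (hG : ∀ x, ¬ (absNorm x).Coprime (2 * p) → G x = 0) {a b : E}
    (ha : HasSum ({x | S.PosReduced (posPoint p x)}.indicator
      fun x => G (Associates.mk (posPoint p x))) a)
    (hb : HasSum ({x | S.NegReduced (negPoint p x)}.indicator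
      fun x => G (Associates.mk (negPoint p x))) b) : HasSum G (a + b) := by
  set P : Set (ℕ × ℤ) := {x | S.PosReduced (posPoint p x) ∧
    (posPoint p x).norm.natAbs.Coprime (2 * p)}
  set P' : Set (ℕ × ℤ) := {x | S.NegReduced (negPoint p x) ∧
    (negPoint p x).norm.natAbs.Coprime (2 * p)}
  have ha' : HasSum (fun x : P => G (Associates.mk (posPoint p x))) a := by
    refine (hasSum_subtype_iff_indicator (s := P)
      (f := fun x => G (Associates.mk (posPoint p x)))).2 ?_
    convert ha using 1
    funext x
    by_cases h1 : S.PosReduced (posPoint p x) <;>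
      by_cases h2 : (posPoint p x).norm.natAbs.Coprime (2 * p)
    · rw [Set.indicator_of_mem (show x ∈ P from ⟨h1, h2⟩), Set.indicator_of_mem (by exact h1)]
    · rw [Set.indicator_of_notMem (fun h : x ∈ P => h2 h.2), Set.indicator_of_mem (by exact h1),
        hG _ h2]
    · rw [Set.indicator_of_notMem (fun h : x ∈ P => h1 h.1), Set.indicator_of_notMem (by exact h1)]
    · rw [Set.indicator_of_notMem (fun h : x ∈ P => h1 h.1), Set.indicator_of_notMem (by exact h1)]
  have hb' : HasSum (fun x : P' => G (Associates.mk (negPoint p x))) b := by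
    refine (hasSum_subtype_iff_indicator (s := P')
      (f := fun x => G (Associates.mk (negPoint p x)))).2 ?_
    convert hb using 1
    funext x
    by_cases h1 : S.NegReduced (negPoint p x) <;>
      by_cases h2 : (negPoint p x).norm.natAbs.Coprime (2 * p)
    · rw [Set.indicator_of_mem (show x ∈ P' from ⟨h1, h2⟩), Set.indicator_of_mem (by exact h1)]
    · rw [Set.indicator_of_notMem (fun h : x ∈ P' => h2 h.2), Set.indicator_of_mem (by exact h1),
        hG _ h2]
    · rw [Set.indicator_of_notMem (fun h : x ∈ P' => h1 h.1),
        Set.indicator_of_notMem (by exact h1)]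
    · rw [Set.indicator_of_notMem (fun h : x ∈ P' => h1 h.1),
        Set.indicator_of_notMem (by exact h1)]
  set g : P ⊕ P' → Associates (ℤ√(p : ℤ)) :=
    Sum.elim (fun x => Associates.mk (posPoint p x)) (fun x => Associates.mk (negPoint p x)) with hg
  have hinj : Function.Injective g := by
    rintro (⟨x, hx, hxc⟩ | ⟨x, hx, hxc⟩) (⟨y, hy, hyc⟩ | ⟨y, hy, hyc⟩) h <;>
      have h' := Associates.mk_eq_mk_iff_associated.1 h
    · have := posPoint_injective (eq_of_associated h' hxc (.inl hx) (.inl hy))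
      subst this
      rfl
    · have h1 := eq_of_associated h' hxc (.inl hx) (.inr hy)
      have h2 := hx.norm_pos
      have h3 := hy.norm_neg
      dsimp only at h1 h2 h3
      rw [h1] at h2
      omega
    · have h1 := eq_of_associated h' hxc (.inr hx) (.inl hy)
      have h2 := hx.norm_neg
      have h3 := hy.norm_pos
      dsimp only at h1 h2 h3
      rw [h1] at h2
      omega
    · have := negPoint_injective (eq_of_associated h' hxc (.inr hx) (.inr hy))
      subst this
      rfl
  refine (hinj.hasSum_iff fun x hx => hG x fun hc => hx ?_).1 (HasSum.sum ha' hb')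
  obtain ⟨y, rfl⟩ := Associates.mk_surjective x
  rw [absNorm_mk] at hc
  have hodd := (S.coprime_iff.1 hc).1
  rcases lt_trichotomy y.norm 0 with hn | hn | hn
  · obtain ⟨z, hz, hz'⟩ := S.exists_negReduced hodd hn
    obtain ⟨t, rfl⟩ := S.exists_negPoint hz'
    have hmk := Associates.mk_eq_mk_iff_associated.2 hz
    refine ⟨.inr ⟨t, hz', ?_⟩, hmk.symm⟩
    rwa [← absNorm_mk, ← hmk]
  · simp [hn] at hodd
  · obtain ⟨z, hz, hz'⟩ := S.exists_posReduced hodd hn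
    obtain ⟨t, rfl⟩ := S.exists_posPoint hz'
    have hmk := Associates.mk_eq_mk_iff_associated.2 hz
    refine ⟨.inl ⟨t, hz', ?_⟩, hmk.symm⟩
    rwa [← absNorm_mk, ← hmk]

end EvenPellUnit

namespace EvenPellUnit

variable {p : ℕ} (S : EvenPellUnit p) {Q : ℕ}

omit S in
theorem odd_norm_of_isUnit_natCast (h2 : 2 ∣ Q) {x : ℤ√(p : ℤ)}
    (hx : IsUnit ((x.norm.natAbs : ℕ) : ZMod Q)) : Odd x.norm := by
  rw [ZMod.isUnit_iff_coprime] at hx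
  exact Int.natAbs_odd.1 (Nat.coprime_two_right.1 (hx.coprime_dvd_right h2))

/-- The character `x ↦ χ(|N x|) * exp (2 * π * i * k * angle x)` of associate classes. -/
noncomputable def twist (h2 : 2 ∣ Q) (χ : DirichletCharacter ℂ Q) (k : ℤ) :
    Associates (ℤ√(p : ℤ)) →*₀ ℂ :=
  Associates.liftMonoidWithZeroHom
    { toFun := fun x => χ (x.norm.natAbs : ℕ) * fourier k (S.angle x)
      map_zero' := by
        rw [MulChar.map_nonunit, zero_mul]
        intro h
        simpa using odd_norm_of_isUnit_natCast h2 h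
      map_one' := by simp [S.angle_one, fourier_eval_zero, -fourier_apply]
      map_mul' := fun x y => by
        rw [Zsqrtd.norm_mul, Int.natAbs_mul, Nat.cast_mul, map_mul]
        by_cases hx : IsUnit ((x.norm.natAbs : ℕ) : ZMod Q)
        · by_cases hy : IsUnit ((y.norm.natAbs : ℕ) : ZMod Q)
          · rw [S.angle_mul (odd_norm_of_isUnit_natCast h2 hx) (odd_norm_of_isUnit_natCast h2 hy),
              fourier_apply, smul_add, AddCircle.toCircle_add, Circle.coe_mul, ← fourier_apply,
              ← fourier_apply]
            ring
          · rw [MulChar.map_nonunit χ hy, mul_zero, zero_mul, zero_mul, mul_zero]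
        · rw [MulChar.map_nonunit χ hx, zero_mul, zero_mul, zero_mul, zero_mul] }
    fun u hu => by
      change χ (u.norm.natAbs : ℕ) * fourier k (S.angle u) = 1
      simp [S.angle_of_isUnit hu, S.norm_eq_one_of_isUnit hu, fourier_eval_zero, -fourier_apply]

theorem twist_mk (h2 : 2 ∣ Q) (χ : DirichletCharacter ℂ Q) (k : ℤ) (x : ℤ√(p : ℤ)) :
    S.twist h2 χ k (Associates.mk x) = χ (x.norm.natAbs : ℕ) * fourier k (S.angle x) := rfl

omit S in
theorem norm_fourier_eq_one (k : ℤ) (x : AddCircle (1 : ℝ)) : ‖fourier k x‖ = 1 := by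
  rw [fourier_apply, Circle.norm_coe]

theorem twist_eq_zero_or (h2 : 2 ∣ Q) (χ : DirichletCharacter ℂ Q) (k : ℤ)
    (x : Associates (ℤ√(p : ℤ))) : S.twist h2 χ k x = 0 ∨ ‖S.twist h2 χ k x‖ = 1 := by
  obtain ⟨x, rfl⟩ := Associates.mk_surjective x
  rw [twist_mk]
  by_cases hx : IsUnit ((x.norm.natAbs : ℕ) : ZMod Q)
  · obtain ⟨u, hu⟩ := hx
    right
    rw [norm_mul, norm_fourier_eq_one, mul_one, ← hu, χ.unit_norm_eq_one]
  · left
    rw [MulChar.map_nonunit χ hx, zero_mul]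

theorem norm_twist_le (h2 : 2 ∣ Q) (χ : DirichletCharacter ℂ Q) (k : ℤ)
    (x : Associates (ℤ√(p : ℤ))) : ‖S.twist h2 χ k x‖ ≤ 1 := by
  rcases S.twist_eq_zero_or h2 χ k x with h | h <;> simp [h]

theorem twist_one_zero (h2 : 2 ∣ Q) (χ : DirichletCharacter ℂ Q) (k : ℤ)
    (x : Associates (ℤ√(p : ℤ))) : S.twist h2 1 0 x = (‖S.twist h2 χ k x‖ : ℂ) := by
  obtain ⟨x, rfl⟩ := Associates.mk_surjective x
  rw [twist_mk, twist_mk, fourier_zero, mul_one, norm_mul, norm_fourier_eq_one, mul_one]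
  by_cases hx : IsUnit ((x.norm.natAbs : ℕ) : ZMod Q)
  · obtain ⟨u, hu⟩ := hx
    rw [← hu, χ.unit_norm_eq_one, MulChar.one_apply u.isUnit, Complex.ofReal_one]
  · rw [MulChar.map_nonunit χ hx, MulChar.map_nonunit _ hx, norm_zero, Complex.ofReal_zero]

theorem twist_sq (h2 : 2 ∣ Q) (χ : DirichletCharacter ℂ Q) (k : ℤ)
    (x : Associates (ℤ√(p : ℤ))) : S.twist h2 (χ ^ 2) (2 * k) x = S.twist h2 χ k x ^ 2 := by
  obtain ⟨x, rfl⟩ := Associates.mk_surjective x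
  rw [twist_mk, twist_mk, two_mul, fourier_add, pow_two, MulChar.mul_apply]
  ring

theorem twist_eq_zero_of_not_coprime (h2 : 2 ∣ Q) (hpQ : 2 * p ∣ Q) (χ : DirichletCharacter ℂ Q)
    (k : ℤ) {x : Associates (ℤ√(p : ℤ))} (hx : ¬ (absNorm x).Coprime (2 * p)) :
    S.twist h2 χ k x = 0 := by
  obtain ⟨x, rfl⟩ := Associates.mk_surjective x
  rw [twist_mk, MulChar.map_nonunit, zero_mul]
  rw [ZMod.isUnit_iff_coprime]
  exact fun h => hx (h.coprime_dvd_right hpQ)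

omit S in
theorem logRatio_eq_hypAngle_of_pos {X Y : ℤ} (hX : (0 : ℝ) < X)
    (h : 0 < emb (⟨X, Y⟩ : ℤ√(p : ℤ)) ∧ 0 < emb (star (⟨X, Y⟩ : ℤ√(p : ℤ)))) :
    logRatio (⟨X, Y⟩ : ℤ√(p : ℤ)) = hypAngle 1 √p (Y / X) := by
  rw [emb_star_apply, emb_apply] at h
  dsimp only at h
  rw [logRatio, hypAngle, emb_star_apply, emb_apply]
  dsimp only
  have e1 : (1 + √p * (Y / X) : ℝ) = (X + Y * √p) / X := by field_simp
  have e2 : (1 - √p * (Y / X) : ℝ) = (X - Y * √p) / X := by field_simp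
  rw [e1, e2, Real.log_div h.1.ne' hX.ne', Real.log_div h.2.ne' hX.ne']
  ring

omit S in
theorem logRatio_eq_hypAngle_of_neg {X Y : ℤ} (hX : (0 : ℝ) < X)
    (h : 0 < emb (⟨Y, X⟩ : ℤ√(p : ℤ)) ∧ emb (star (⟨Y, X⟩ : ℤ√(p : ℤ))) < 0) :
    logRatio (⟨Y, X⟩ : ℤ√(p : ℤ)) = hypAngle √p 1 (Y / X) := by
  rw [emb_star_apply, emb_apply] at h
  dsimp only at h
  rw [logRatio, hypAngle, emb_star_apply, emb_apply]
  dsimp only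
  have e1 : (√p + 1 * (Y / X) : ℝ) = (Y + X * √p) / X := by
    field_simp
    ring
  have e2 : (√p - 1 * (Y / X) : ℝ) = -(Y - X * √p) / X := by
    field_simp
    ring
  rw [e1, e2, Real.log_div h.1.ne' hX.ne', Real.log_div (by linarith) hX.ne', Real.log_neg_eq_log]
  ring

theorem hypAngle_pos_eq : hypAngle 1 √p (S.d / S.c) = 2 * S.reg := by
  have hc : (0 : ℝ) < S.c := by exact_mod_cast S.c_pos
  have he := S.emb_unit_star_pos
  have he' : 0 < emb S.unit := inv_pos.1 (S.emb_unit_star ▸ he)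
  rw [← S.logRatio_unit, unit, logRatio_eq_hypAngle_of_pos hc ⟨he', he⟩]

theorem hypAngle_neg_eq : hypAngle √p 1 (p * S.d / S.c) = 2 * S.reg := by
  have hp : 0 < √(p : ℝ) := Real.sqrt_pos.2 S.p_pos
  have h4 : √(p : ℝ) * √p = p := Real.mul_self_sqrt (Nat.cast_nonneg p)
  have hc : (0 : ℝ) < S.c := by exact_mod_cast S.c_pos
  have he := S.emb_unit_star_pos
  have he' : 0 < emb S.unit := inv_pos.1 (S.emb_unit_star ▸ he)
  rw [← S.hypAngle_pos_eq, hypAngle, hypAngle]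
  rw [emb_star_apply] at he
  rw [emb_apply] at he'
  simp only [unit] at he he'
  have e1 : √p + 1 * (p * S.d / S.c) = √p * ((S.c + S.d * √p) / S.c) := by
    field_simp
    linear_combination -(S.d : ℝ) * h4
  have e2 : √p - 1 * (p * S.d / S.c) = √p * ((S.c - S.d * √p) / S.c) := by
    field_simp
    linear_combination (S.d : ℝ) * h4
  have e3 : 1 + √p * (S.d / S.c) = (S.c + S.d * √p) / S.c := by field_simp
  have e4 : 1 - √p * (S.d / S.c) = (S.c - S.d * √p) / S.c := by field_simp
  rw [e1, e2, e3, e4, Real.log_mul hp.ne' (div_pos he' hc).ne',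
    Real.log_mul hp.ne' (div_pos he hc).ne']
  ring

omit S in
theorem natAbs_norm_posPoint {x : ℕ × ℤ} (h : 0 < (posPoint p x).norm) :
    ((posPoint p x).norm.natAbs : ℝ) =
      (1 * (x.1 + 1 : ℕ) + √p * x.2) * (1 * (x.1 + 1 : ℕ) - √p * x.2) := by
  have h4 : √(p : ℝ) * √p = p := Real.mul_self_sqrt (Nat.cast_nonneg p)
  rw [Nat.cast_natAbs, abs_of_pos h, Zsqrtd.norm_def]
  simp only [posPoint]
  push_cast
  linear_combination (x.2 : ℝ) ^ 2 * h4

omit S in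
theorem natAbs_norm_negPoint {x : ℕ × ℤ} (h : (negPoint p x).norm < 0) :
    ((negPoint p x).norm.natAbs : ℝ) =
      (√p * (x.1 + 1 : ℕ) + 1 * x.2) * (√p * (x.1 + 1 : ℕ) - 1 * x.2) := by
  have h4 : √(p : ℝ) * √p = p := Real.mul_self_sqrt (Nat.cast_nonneg p)
  rw [Nat.cast_natAbs, abs_of_neg h, Zsqrtd.norm_def]
  simp only [negPoint]
  push_cast
  linear_combination -((x.1 : ℝ) + 1) ^ 2 * h4

theorem posReduced_posPoint_iff {x : ℕ × ℤ} : S.PosReduced (posPoint p x) ↔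
    Odd (x.1 + 1) ∧ |(x.2 : ℝ)| ≤ S.d / S.c * (x.1 + 1 : ℕ) := by
  have hc : (0 : ℝ) < S.c := by exact_mod_cast S.c_pos
  rw [PosReduced, div_mul_eq_mul_div, le_div_iff₀ hc, posPoint]
  dsimp only
  have e : (|(x.2 : ℝ)| * S.c ≤ S.d * (x.1 + 1 : ℕ)) ↔ S.c * |x.2| ≤ S.d * (x.1 + 1) := by
    rw [mul_comm]
    exact_mod_cast Iff.rfl
  have e' : Odd ((x.1 : ℤ) + 1) ↔ Odd (x.1 + 1) := by exact_mod_cast Int.odd_coe_nat (x.1 + 1)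
  rw [e, e']
  exact ⟨fun h => ⟨h.1, h.2.2⟩, fun h => ⟨h.1, by omega, h.2⟩⟩

theorem negReduced_negPoint_iff {x : ℕ × ℤ} : S.NegReduced (negPoint p x) ↔
    Odd x.2 ∧ |(x.2 : ℝ)| ≤ p * S.d / S.c * (x.1 + 1 : ℕ) := by
  have hc : (0 : ℝ) < S.c := by exact_mod_cast S.c_pos
  rw [NegReduced, div_mul_eq_mul_div, le_div_iff₀ hc, negPoint]
  dsimp only
  have e : (|(x.2 : ℝ)| * S.c ≤ p * S.d * (x.1 + 1 : ℕ)) ↔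
      S.c * |x.2| ≤ p * S.d * (x.1 + 1) := by
    rw [mul_comm]
    exact_mod_cast Iff.rfl
  rw [e]
  exact ⟨fun h => ⟨h.1, h.2.2⟩, fun h => ⟨h.1, by omega, h.2⟩⟩

theorem sqrt_mul_div_lt_one : √p * (S.d / S.c) < (1 : ℝ) := by
  have hc : (0 : ℝ) < S.c := by exact_mod_cast S.c_pos
  have he := S.emb_unit_star_pos
  rw [emb_star_apply] at he
  simp only [unit] at he
  rw [← mul_div_assoc, div_lt_one hc]
  linarith

theorem one_mul_div_lt_sqrt : 1 * (p * S.d / S.c) < √(p : ℝ) := by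
  have h4 : √(p : ℝ) * √p = p := Real.mul_self_sqrt (Nat.cast_nonneg p)
  have hp : 0 < √(p : ℝ) := Real.sqrt_pos.2 S.p_pos
  calc 1 * (p * S.d / S.c) = √(p : ℝ) * (√p * (S.d / S.c)) := by
        rw [← mul_assoc, h4]
        ring
    _ < √(p : ℝ) * 1 := by
        gcongr
        exact S.sqrt_mul_div_lt_one
    _ = _ := mul_one _

theorem summable_norm_twist (h2 : 2 ∣ Q) (hpQ : 2 * p ∣ Q) (χ : DirichletCharacter ℂ Q) (k : ℤ) :
    (∀ s : ℝ, 1 < s → Summable fun x => ‖S.twist h2 χ k x‖ * (absNorm x : ℝ) ^ (-s)) ∧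
    ∃ C, ∀ s : ℝ, 1 < s → s ≤ 2 →
      ∑' x, ‖S.twist h2 χ k x‖ * (absNorm x : ℝ) ^ (-s) ≤ C / (s - 1) := by
  have hc : (0 : ℝ) < S.c := by exact_mod_cast S.c_pos
  have hd : (0 : ℝ) < S.d := by exact_mod_cast S.d_pos
  have hp : 0 < √(p : ℝ) := Real.sqrt_pos.2 S.p_pos
  have hp' := S.p_pos
  obtain ⟨a1, C, a2⟩ := summable_indicator_rpow_neg (D := {x | S.PosReduced (posPoint p x)})
    (n := fun x => (posPoint p x).norm.natAbs) (div_pos hd hc) hp S.sqrt_mul_div_lt_one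
    (fun x hx => (S.posReduced_posPoint_iff.1 hx).2)
    (fun x hx => natAbs_norm_posPoint (PosReduced.norm_pos hx))
  obtain ⟨b1, C', b2⟩ := summable_indicator_rpow_neg (D := {x | S.NegReduced (negPoint p x)})
    (n := fun x => (negPoint p x).norm.natAbs) (w := p * S.d / S.c) (by positivity) one_pos
    S.one_mul_div_lt_sqrt (fun x hx => (S.negReduced_negPoint_iff.1 hx).2)
    (fun x hx => natAbs_norm_negPoint (NegReduced.norm_neg hx))
  have hle : ∀ (D : Set (ℕ × ℤ)) (f : ℕ × ℤ → ℤ√(p : ℤ)) (s : ℝ) (x : ℕ × ℤ),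
      0 ≤ D.indicator (fun x => ‖S.twist h2 χ k (Associates.mk (f x))‖ *
        (absNorm (Associates.mk (f x)) : ℝ) ^ (-s)) x ∧
      D.indicator (fun x => ‖S.twist h2 χ k (Associates.mk (f x))‖ *
        (absNorm (Associates.mk (f x)) : ℝ) ^ (-s)) x ≤
      D.indicator (fun x => ((f x).norm.natAbs : ℝ) ^ (-s)) x := by
    intro D f s x
    by_cases hx : x ∈ D
    · rw [Set.indicator_of_mem hx, Set.indicator_of_mem hx]
      exact ⟨by positivity, mul_le_of_le_one_left (by positivity) (S.norm_twist_le h2 χ k _)⟩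
    · simp [Set.indicator_of_notMem hx]
  have hG : ∀ (s : ℝ) (x : Associates (ℤ√(p : ℤ))), ¬ (absNorm x).Coprime (2 * p) →
      ‖S.twist h2 χ k x‖ * (absNorm x : ℝ) ^ (-s) = 0 := fun s x hx => by
    rw [S.twist_eq_zero_of_not_coprime h2 hpQ χ k hx, norm_zero, zero_mul]
  have key : ∀ s : ℝ, 1 < s → _ := fun s h1 => S.hasSum_associates (hG s)
    (Summable.of_nonneg_of_le (fun x => (hle _ _ s x).1) (fun x => (hle _ _ s x).2)
      (a1 s h1)).hasSum
    (Summable.of_nonneg_of_le (fun x => (hle _ _ s x).1) (fun x => (hle _ _ s x).2)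
      (b1 s h1)).hasSum
  refine ⟨fun s h1 => (key s h1).summable, C + C', fun s h1 h2 => ?_⟩
  rw [(key s h1).tsum_eq, add_div]
  refine add_le_add (le_trans ?_ (a2 s h1 h2)) (le_trans ?_ (b2 s h1 h2))
  · exact Summable.tsum_le_tsum (fun x => (hle _ _ s x).2) (Summable.of_nonneg_of_le
      (fun x => (hle _ _ s x).1) (fun x => (hle _ _ s x).2) (a1 s h1)) (a1 s h1)
  · exact Summable.tsum_le_tsum (fun x => (hle _ _ s x).2) (Summable.of_nonneg_of_le
      (fun x => (hle _ _ s x).1) (fun x => (hle _ _ s x).2) (b1 s h1)) (b1 s h1)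

theorem exp_two_mul_reg_eq_one (k : ℤ) :
    Complex.exp ((2 * (Real.pi * k / (2 * S.reg)) * (2 * S.reg) : ℝ) * Complex.I) = 1 := by
  have := S.reg_pos.ne'
  rw [Complex.exp_eq_one_iff]
  refine ⟨k, ?_⟩
  have e : 2 * (Real.pi * k / (2 * S.reg)) * (2 * S.reg) = k * (2 * Real.pi) := by
    field_simp
  rw [e]
  push_cast
  ring

theorem fourier_angle (k : ℤ) {x : ℤ√(p : ℤ)} (hx : Odd x.re) : fourier k (S.angle x) =
    Complex.exp ((Real.pi * k / (2 * S.reg) * logRatio x : ℝ) * Complex.I) := by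
  have := S.reg_pos.ne'
  rw [angle, parityShift_of_odd hx, add_zero, fourier_coe_apply]
  congr 1
  have e : Real.pi * k / (2 * S.reg) * logRatio x =
      2 * Real.pi * k * (logRatio x / (4 * S.reg)) := by
    field_simp
    ring
  rw [e]
  push_cast
  ring

theorem exists_norm_tsum_normTwist_twist_le [NeZero Q] (h2 : 2 ∣ Q) (hpQ : 2 * p ∣ Q)
    (χ : DirichletCharacter ℂ Q) {k : ℤ} (hk : k ≠ 0) : ∃ C, ∀ s : ℝ, 1 < s → s ≤ 2 →
      ‖∑' x, normTwist absNorm (S.twist h2 χ k) s x * (Real.log (absNorm x) : ℂ)‖ ≤ C := by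
  have hc : (0 : ℝ) < S.c := by exact_mod_cast S.c_pos
  have hd : (0 : ℝ) < S.d := by exact_mod_cast S.d_pos
  have hp : 0 < √(p : ℝ) := Real.sqrt_pos.2 S.p_pos
  have hp' := S.p_pos
  have hκ : Real.pi * k / (2 * S.reg) ≠ 0 := by
    have := S.reg_pos
    have := Real.pi_pos
    have : (k : ℝ) ≠ 0 := by exact_mod_cast hk
    positivity
  classical
  obtain ⟨a1, C, a2⟩ := exists_norm_tsum_indicator_le (D := {x | S.PosReduced (posPoint p x)})
    (n := fun x => (posPoint p x).norm.natAbs) (α := 1) (β := √p) (w := S.d / S.c)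
    (κ := Real.pi * k / (2 * S.reg)) (Q := Q)
    (a := fun x y => if ZMod.castHom h2 (ZMod 2) x = 1 then χ (x ^ 2 - p * y ^ 2) else 0)
    (g := fun x => S.twist h2 χ k (Associates.mk (posPoint p x))) one_pos
    (div_pos hd hc) hp S.sqrt_mul_div_lt_one
    (fun x hx => (S.posReduced_posPoint_iff.1 hx).2)
    (fun x hx => natAbs_norm_posPoint (PosReduced.norm_pos hx)) hκ
    (by rw [hypAngle_pos_eq, exp_two_mul_reg_eq_one])
    (fun x y => by
      split_ifs
      · exact χ.norm_le_one _
      · simp)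
    (fun i Y hY => by
      rw [map_natCast]
      by_cases hi : Odd (i + 1)
      · have hx : S.PosReduced (posPoint p (i, Y)) := S.posReduced_posPoint_iff.2 ⟨hi, hY⟩
        have hX : (0 : ℝ) < ((i + 1 : ℤ) : ℝ) := by exact_mod_cast Nat.succ_pos i
        rw [Set.indicator_of_mem (by exact hx), if_pos (ZMod.natCast_eq_one_iff_odd.2 hi),
          twist_mk, S.fourier_angle k hx.1]
        congr 2
        · rw [← Int.cast_natCast (R := ZMod Q), Int.natCast_natAbs, abs_of_pos hx.norm_pos,
            Zsqrtd.norm_def]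
          simp only [posPoint]
          push_cast
          ring
        · have := logRatio_eq_hypAngle_of_pos hX hx.emb_pos
          rw [posPoint, this]
          push_cast
          ring
      · have hx : ¬ S.PosReduced (posPoint p (i, Y)) :=
          fun h => hi (S.posReduced_posPoint_iff.1 h).1
        rw [Set.indicator_of_notMem (by exact hx),
          if_neg (mt ZMod.natCast_eq_one_iff_odd.1 hi), zero_mul])
  obtain ⟨b1, C', b2⟩ := exists_norm_tsum_indicator_le (D := {x | S.NegReduced (negPoint p x)})
    (n := fun x => (negPoint p x).norm.natAbs) (α := √p) (β := 1) (w := p * S.d / S.c)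
    (κ := Real.pi * k / (2 * S.reg)) (Q := Q)
    (a := fun x y => if ZMod.castHom h2 (ZMod 2) y = 1 then χ (p * x ^ 2 - y ^ 2) else 0)
    (g := fun x => S.twist h2 χ k (Associates.mk (negPoint p x))) hp
    (by positivity) one_pos S.one_mul_div_lt_sqrt
    (fun x hx => (S.negReduced_negPoint_iff.1 hx).2)
    (fun x hx => natAbs_norm_negPoint (NegReduced.norm_neg hx)) hκ
    (by rw [hypAngle_neg_eq, exp_two_mul_reg_eq_one])
    (fun x y => by
      split_ifs
      · exact χ.norm_le_one _
      · simp)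
    (fun i Y hY => by
      rw [map_intCast]
      by_cases hi : Odd Y
      · have hx : S.NegReduced (negPoint p (i, Y)) := S.negReduced_negPoint_iff.2 ⟨hi, hY⟩
        have hX : (0 : ℝ) < ((i + 1 : ℤ) : ℝ) := by exact_mod_cast Nat.succ_pos i
        rw [Set.indicator_of_mem (by exact hx), if_pos (ZMod.intCast_eq_one_iff_odd.2 hi),
          twist_mk, S.fourier_angle k hx.1]
        congr 2
        · rw [← Int.cast_natCast (R := ZMod Q), Int.natCast_natAbs, abs_of_neg hx.norm_neg,
            Zsqrtd.norm_def]
          simp only [negPoint]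
          push_cast
          ring
        · have := logRatio_eq_hypAngle_of_neg hX hx.emb_pos
          rw [negPoint, this]
          push_cast
          ring
      · have hx : ¬ S.NegReduced (negPoint p (i, Y)) :=
          fun h => hi (S.negReduced_negPoint_iff.1 h).1
        rw [Set.indicator_of_notMem (by exact hx),
          if_neg (mt ZMod.intCast_eq_one_iff_odd.1 hi), zero_mul])
  refine ⟨C + C', fun s h1 h2' => ?_⟩
  have hG : ∀ x : Associates (ℤ√(p : ℤ)), ¬ (absNorm x).Coprime (2 * p) →
      normTwist absNorm (S.twist h2 χ k) s x * (Real.log (absNorm x) : ℂ) = 0 := fun x hx => by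
    rw [normTwist_apply, S.twist_eq_zero_of_not_coprime h2 hpQ χ k hx, zero_mul, zero_mul]
  have e : ∀ y : ℤ√(p : ℤ), normTwist absNorm (S.twist h2 χ k) s (Associates.mk y) *
      (Real.log (absNorm (Associates.mk y)) : ℂ) = S.twist h2 χ k (Associates.mk y) *
        ((y.norm.natAbs : ℝ) ^ (-s) * Real.log y.norm.natAbs : ℝ) := fun y => by
    rw [normTwist_apply, absNorm_mk]
    push_cast
    ring
  have key := S.hasSum_associates hG (a := ∑' x, _) (b := ∑' x, _)
    (by simp_rw [e]; exact (a1 s h1).hasSum) (by simp_rw [e]; exact (b1 s h1).hasSum)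
  rw [key.tsum_eq]
  exact (norm_add_le _ _).trans (add_le_add (a2 s h1 h2') (b2 s h1 h2'))

end EvenPellUnit

section WeightedEquidistribution

open Filter Topology AddCircle

variable {ι : Type*} {θ : ι → AddCircle (1 : ℝ)} {w : ℝ → ι → ℝ}

theorem norm_apply_mul_le (h : C(AddCircle (1 : ℝ), ℂ)) {x : AddCircle (1 : ℝ)} {r : ℝ}
    (hr : 0 ≤ r) : ‖h x * r‖ ≤ ‖h‖ * r := by
  rw [norm_mul, Complex.norm_real, Real.norm_of_nonneg hr]
  exact mul_le_mul_of_nonneg_right (h.norm_coe_le_norm x) hr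

theorem summable_apply_mul (h : C(AddCircle (1 : ℝ), ℂ)) {v : ι → ℝ} (hv : ∀ i, 0 ≤ v i)
    (hs : Summable v) : Summable fun i => h (θ i) * (v i : ℂ) :=
  (hs.mul_left ‖h‖).of_norm_bounded fun i => norm_apply_mul_le h (hv i)

theorem integral_fourier_eq (k : ℤ) :
    ∫ x : AddCircle (1 : ℝ), fourier k x ∂haarAddCircle = if k = 0 then 1 else 0 := by
  have h := congrFun (fourierCoeff_fourier (T := 1) k) 0
  rw [Pi.single_apply] at h
  simp only [fourierCoeff, neg_zero, fourier_zero, one_smul] at h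
  rw [h]
  simp only [eq_comm]

theorem integrable_circle (h : C(AddCircle (1 : ℝ), ℂ)) :
    MeasureTheory.Integrable h (haarAddCircle (T := 1)) :=
  h.continuous.integrable_of_hasCompactSupport (HasCompactSupport.of_compactSpace _)

/-- If all nontrivial exponential sums are bounded, then sums of trigonometric polynomials are
determined by their mean up to bounded error. -/
theorem exists_norm_tsum_sub_integral_le (hw : ∀ s i, 0 ≤ w s i)
    (hs : ∀ s, 1 < s → Summable (w s))
    (hk : ∀ k : ℤ, k ≠ 0 → ∃ C, ∀ᶠ s in 𝓝[>] 1, ‖∑' i, fourier k (θ i) * (w s i : ℂ)‖ ≤ C)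
    {h : C(AddCircle (1 : ℝ), ℂ)} (hh : h ∈ Submodule.span ℂ (Set.range fourier)) :
    ∃ C, ∀ᶠ s in 𝓝[>] 1, ‖∑' i, h (θ i) * (w s i : ℂ) -
      (∫ x, h x ∂haarAddCircle) * ∑' i, (w s i : ℂ)‖ ≤ C := by
  induction hh using Submodule.span_induction with
  | mem h hh =>
    obtain ⟨k, rfl⟩ := hh
    rw [integral_fourier_eq]
    rcases eq_or_ne k 0 with rfl | hk0
    · exact ⟨0, .of_forall fun s => by simp [fourier_zero, -fourier_apply]⟩
    · simpa only [hk0, if_false, zero_mul, sub_zero] using hk k hk0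
  | zero => exact ⟨0, .of_forall fun s => by simp⟩
  | add f g _ _ hf hg =>
    obtain ⟨C, hC⟩ := hf
    obtain ⟨C', hC'⟩ := hg
    refine ⟨C + C', ?_⟩
    filter_upwards [hC, hC', self_mem_nhdsWithin] with s h1 h2 h3
    have e1 : ∑' i, (f + g) (θ i) * (w s i : ℂ) =
        ∑' i, f (θ i) * (w s i : ℂ) + ∑' i, g (θ i) * (w s i : ℂ) := by
      rw [← (summable_apply_mul f (hw s) (hs s h3)).tsum_add
        (summable_apply_mul g (hw s) (hs s h3))]
      simp only [ContinuousMap.add_apply, add_mul]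
    have e2 : ∫ x, (f + g) x ∂haarAddCircle =
        ∫ x, f x ∂haarAddCircle + ∫ x, g x ∂haarAddCircle :=
      MeasureTheory.integral_add (integrable_circle f) (integrable_circle g)
    rw [e1, e2, add_mul, add_sub_add_comm]
    exact (norm_add_le _ _).trans (add_le_add h1 h2)
  | smul a f _ hf =>
    obtain ⟨C, hC⟩ := hf
    refine ⟨‖a‖ * C, ?_⟩
    filter_upwards [hC] with s h1
    have e1 : ∑' i, (a • f) (θ i) * (w s i : ℂ) = a * ∑' i, f (θ i) * (w s i : ℂ) := by
      rw [← tsum_mul_left]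
      simp only [ContinuousMap.smul_apply, smul_eq_mul, mul_assoc]
    have e2 : ∫ x, (a • f) x ∂haarAddCircle = a * ∫ x, f x ∂haarAddCircle :=
      MeasureTheory.integral_const_mul a _
    rw [e1, e2, mul_assoc, ← mul_sub, norm_mul]
    exact mul_le_mul_of_nonneg_left h1 (norm_nonneg a)

/-- If all nontrivial exponential sums are bounded and the points in some nonempty open set have
bounded total weight, then the total weight is bounded. -/
theorem exists_tsum_le_of_isOpen (hw : ∀ s i, 0 ≤ w s i) (hs : ∀ s, 1 < s → Summable (w s))
    (hk : ∀ k : ℤ, k ≠ 0 → ∃ C, ∀ᶠ s in 𝓝[>] 1, ‖∑' i, fourier k (θ i) * (w s i : ℂ)‖ ≤ C)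
    {U : Set (AddCircle (1 : ℝ))} (hU : IsOpen U) (hne : U.Nonempty)
    (hb : ∃ C, ∀ᶠ s in 𝓝[>] 1, ∑' i, (θ ⁻¹' U).indicator (w s) i ≤ C) :
    ∃ C, ∀ᶠ s in 𝓝[>] 1, ∑' i, w s i ≤ C := by
  obtain ⟨x₀, hx₀⟩ := hne
  obtain ⟨g, hg0, hg1, hg⟩ := exists_continuous_zero_one_of_isClosed hU.isClosed_compl
    (isClosed_singleton (x := x₀)) (by simpa using hx₀)
  have hpos : 0 < ∫ x, g x ∂haarAddCircle (T := 1) :=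
    g.continuous.integral_pos_of_hasCompactSupport_nonneg_nonzero
      (HasCompactSupport.of_compactSpace _) (fun x => (hg x).1) (x := x₀)
      (by rw [hg1 rfl]; exact one_ne_zero)
  set I := ∫ x, g x ∂haarAddCircle (T := 1) with hI
  let G : C(AddCircle (1 : ℝ), ℂ) := ⟨fun x => (g x : ℂ), by fun_prop⟩
  have hGI : ∫ x, G x ∂haarAddCircle = (I : ℂ) := integral_ofReal
  obtain ⟨h, hh, hhG⟩ : ∃ h ∈ Submodule.span ℂ (Set.range (fourier (T := 1))),
      ‖h - G‖ ≤ I / 4 := by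
    have h1 : G ∈ closure (Submodule.span ℂ (Set.range (fourier (T := 1))) :
        Set C(AddCircle (1 : ℝ), ℂ)) := by
      rw [← Submodule.topologicalClosure_coe, span_fourier_closure_eq_top]
      trivial
    obtain ⟨h, hh, hd⟩ := Metric.mem_closure_iff.1 h1 (I / 4) (by positivity)
    refine ⟨h, hh, ?_⟩
    rw [← dist_eq_norm, dist_comm]
    exact hd.le
  obtain ⟨C, hC⟩ := exists_norm_tsum_sub_integral_le hw hs hk hh
  obtain ⟨B, hB⟩ := hb
  refine ⟨(C + B) / (I / 2), ?_⟩
  filter_upwards [hC, hB, self_mem_nhdsWithin] with s h1 h2 h3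
  have hws := hs s h3
  have hmean : 3 * I / 4 ≤ ‖∫ x, h x ∂haarAddCircle‖ := by
    have e : ‖∫ x, (h - G) x ∂haarAddCircle‖ ≤ I / 4 := by
      refine (MeasureTheory.norm_integral_le_of_norm_le_const (C := I / 4)
        (.of_forall fun x => ((h - G).norm_coe_le_norm x).trans hhG)).trans ?_
      simp
    have e' : ∫ x, (h - G) x ∂haarAddCircle = ∫ x, h x ∂haarAddCircle - (I : ℂ) := by
      rw [← hGI]
      exact MeasureTheory.integral_sub (integrable_circle h) (integrable_circle G)
    rw [e'] at e
    have h4 := norm_sub_norm_le (I : ℂ) (∫ x, h x ∂haarAddCircle)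
    rw [norm_sub_rev, Complex.norm_real, Real.norm_of_nonneg hpos.le] at h4
    linarith
  have hGle : ‖∑' i, G (θ i) * (w s i : ℂ)‖ ≤ B := by
    refine le_trans (tsum_of_norm_bounded (hws.indicator (θ ⁻¹' U)).hasSum fun i => ?_) h2
    by_cases hi : θ i ∈ U
    · rw [Set.indicator_of_mem (by exact hi), norm_mul,
        show G (θ i) = (g (θ i) : ℂ) from rfl, Complex.norm_real, Complex.norm_real,
        Real.norm_of_nonneg (hw s i), Real.norm_of_nonneg (hg _).1]
      exact mul_le_of_le_one_left (hw s i) (hg _).2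
    · rw [Set.indicator_of_notMem (by exact hi)]
      simp [G, hg0 hi]
  have hdiff : ‖∑' i, h (θ i) * (w s i : ℂ) - ∑' i, G (θ i) * (w s i : ℂ)‖ ≤
      I / 4 * ∑' i, w s i := by
    rw [← (summable_apply_mul h (hw s) hws).tsum_sub (summable_apply_mul G (hw s) hws)]
    refine tsum_of_norm_bounded (hws.hasSum.mul_left (I / 4)) fun i => ?_
    rw [← sub_mul]
    exact (norm_apply_mul_le (h - G) (hw s i)).trans (mul_le_mul_of_nonneg_right hhG (hw s i))
  have hW : 0 ≤ ∑' i, w s i := tsum_nonneg (hw s)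
  have hlow : 3 * I / 4 * ∑' i, w s i ≤ ‖(∫ x, h x ∂haarAddCircle) * ∑' i, (w s i : ℂ)‖ := by
    rw [norm_mul, ← Complex.ofReal_tsum, Complex.norm_real, Real.norm_of_nonneg hW]
    exact mul_le_mul_of_nonneg_right hmean hW
  have h5 := norm_sub_norm_le ((∫ x, h x ∂haarAddCircle) * ∑' i, (w s i : ℂ))
    (∑' i, h (θ i) * (w s i : ℂ))
  rw [norm_sub_rev] at h5
  have h6 := norm_sub_norm_le (∑' i, h (θ i) * (w s i : ℂ)) (∑' i, G (θ i) * (w s i : ℂ))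
  rw [le_div_iff₀ (by positivity)]
  linarith

end WeightedEquidistribution

namespace EvenPellUnit

open Filter Topology

variable {p : ℕ} (S : EvenPellUnit p) {Q : ℕ}

include S in
theorem absNorm_ne_zero {x : Associates (ℤ√(p : ℤ))} (hx : x ≠ 0) : absNorm x ≠ 0 := by
  obtain ⟨x, rfl⟩ := Associates.mk_surjective x
  rw [Associates.mk_ne_zero] at hx
  rwa [absNorm_mk, Int.natAbs_ne_zero, Ne, Zsqrtd.norm_eq_zero S.ne_mul_self]

omit S in
theorem eq_one_of_absNorm_eq_one {x : Associates (ℤ√(p : ℤ))} (hx : absNorm x = 1) : x = 1 := by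
  obtain ⟨x, rfl⟩ := Associates.mk_surjective x
  rw [absNorm_mk] at hx
  exact Associates.mk_eq_one.2 (Zsqrtd.norm_eq_one_iff.1 hx)

include S in
theorem one_lt_absNorm_of_prime {P : Associates (ℤ√(p : ℤ))} (hP : Prime P) : 1 < absNorm P := by
  have h0 := S.absNorm_ne_zero hP.ne_zero
  have h1 : absNorm P ≠ 1 := fun h => hP.ne_one (eq_one_of_absNorm_eq_one h)
  omega

/-- The angle of a chosen representative of an associate class. -/
noncomputable def angleOut (x : Associates (ℤ√(p : ℤ))) : AddCircle (1 : ℝ) :=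
  S.angle (Quot.out x)

theorem twist_apply (h2 : 2 ∣ Q) (χ : DirichletCharacter ℂ Q) (k : ℤ)
    (x : Associates (ℤ√(p : ℤ))) :
    S.twist h2 χ k x = χ (absNorm x : ℕ) * fourier k (S.angleOut x) := by
  conv_lhs => rw [← Associates.quot_out x]
  rw [twist_mk, angleOut, ← absNorm_mk, Associates.quot_out]

omit S in
/-- The weight of an associate class whose norm lies in a residue class. -/
noncomputable def residueWeight (b : ZMod Q) (s : ℝ) (x : Associates (ℤ√(p : ℤ))) : ℝ :=
  if ((absNorm x : ℕ) : ZMod Q) = b then (absNorm x : ℝ) ^ (-s) * Real.log (absNorm x) else 0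

omit S in
theorem residueWeight_nonneg (b : ZMod Q) (s : ℝ) (x : Associates (ℤ√(p : ℤ))) :
    0 ≤ residueWeight b s x := by
  rw [residueWeight]
  split_ifs
  · exact mul_nonneg (by positivity) (Real.log_natCast_nonneg _)
  · rfl

theorem residueWeight_le (h2 : 2 ∣ Q) {b : ZMod Q} (hb : IsUnit b) (s : ℝ)
    (x : Associates (ℤ√(p : ℤ))) : residueWeight b s x ≤
      ‖S.twist h2 1 0 x‖ * (absNorm x : ℝ) ^ (-s) * Real.log (absNorm x) := by
  rw [residueWeight]
  split_ifs with h
  · rw [S.twist_apply, fourier_zero, h, MulChar.one_apply hb]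
    simp
  · exact mul_nonneg (by positivity) (Real.log_natCast_nonneg _)

include S in
theorem summable_residueWeight (h2 : 2 ∣ Q) (hpQ : 2 * p ∣ Q) {b : ZMod Q} (hb : IsUnit b) {s : ℝ}
    (hs : 1 < s) : Summable fun P : {P : Associates (ℤ√(p : ℤ)) // Prime P} =>
      residueWeight b s P.1 :=
  Summable.of_nonneg_of_le (fun _ => residueWeight_nonneg b s _)
    (fun P => S.residueWeight_le h2 hb s P.1)
    (summable_prime_norm_mul_rpow_mul_log (S.summable_norm_twist h2 hpQ 1 0).1 hs)

variable [UniqueFactorizationMonoid (ℤ√(p : ℤ))]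

theorem exists_norm_tsum_prime_twist_le [NeZero Q] (h2 : 2 ∣ Q) (hpQ : 2 * p ∣ Q)
    (χ : DirichletCharacter ℂ Q) {k : ℤ} (hk : k ≠ 0) : ∃ C, ∀ᶠ s in 𝓝[>] (1 : ℝ),
      ‖∑' P : {P : Associates (ℤ√(p : ℤ)) // Prime P},
        (Real.log (absNorm P.1) : ℂ) * normTwist absNorm (S.twist h2 χ k) s P.1‖ ≤ C := by
  obtain ⟨hs, h0⟩ := S.summable_norm_twist h2 hpQ χ k
  obtain ⟨C, δ, hδ, h⟩ := exists_norm_tsum_prime_normTwist_le (fun _ => S.absNorm_ne_zero)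
    (fun _ => S.one_lt_absNorm_of_prime) (fun _ => eq_one_of_absNorm_eq_one)
    (S.twist_eq_zero_or h2 χ k) (S.twist_one_zero h2 χ k) (S.twist_sq h2 χ k) hs h0
    (S.exists_norm_tsum_normTwist_twist_le h2 hpQ χ hk)
    (S.exists_norm_tsum_normTwist_twist_le h2 hpQ (χ ^ 2) (mul_ne_zero two_ne_zero hk))
  refine ⟨C, ?_⟩
  filter_upwards [Ioo_mem_nhdsGT (show (1 : ℝ) < 1 + δ by linarith)] with s hs
  exact h s hs.1 hs.2

theorem exists_norm_tsum_fourier_residueWeight_le [NeZero Q] (h2 : 2 ∣ Q) (hpQ : 2 * p ∣ Q)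
    {b : ZMod Q} (hb : IsUnit b) {k : ℤ} (hk : k ≠ 0) : ∃ C, ∀ᶠ s in 𝓝[>] (1 : ℝ),
      ‖∑' P : {P : Associates (ℤ√(p : ℤ)) // Prime P},
        fourier k (S.angleOut P.1) * (residueWeight b s P.1 : ℂ)‖ ≤ C := by
  choose C hC using fun χ : DirichletCharacter ℂ Q => S.exists_norm_tsum_prime_twist_le h2 hpQ χ hk
  have hφ : (Q.totient : ℂ) ≠ 0 := by
    exact_mod_cast (Nat.totient_pos.2 (NeZero.pos Q)).ne'
  refine ⟨‖(Q.totient : ℂ)⁻¹‖ * ∑ χ : DirichletCharacter ℂ Q, ‖χ b⁻¹‖ * C χ, ?_⟩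
  filter_upwards [eventually_all.2 hC, self_mem_nhdsWithin] with s h1 hs
  have hsum : ∀ χ : DirichletCharacter ℂ Q,
      Summable fun P : {P : Associates (ℤ√(p : ℤ)) // Prime P} =>
        (Real.log (absNorm P.1) : ℂ) * normTwist absNorm (S.twist h2 χ k) s P.1 := fun χ =>
    (summable_prime_norm_mul_rpow_mul_log (S.summable_norm_twist h2 hpQ χ k).1 hs).of_norm_bounded
      fun P => by
        rw [norm_mul, norm_normTwist, Complex.norm_real,
          Real.norm_of_nonneg (Real.log_natCast_nonneg _), mul_comm]
  have e : ∀ P : {P : Associates (ℤ√(p : ℤ)) // Prime P},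
      fourier k (S.angleOut P.1) * (residueWeight b s P.1 : ℂ) =
        (Q.totient : ℂ)⁻¹ * ∑ χ : DirichletCharacter ℂ Q, χ b⁻¹ *
          ((Real.log (absNorm P.1) : ℂ) * normTwist absNorm (S.twist h2 χ k) s P.1) := by
    intro P
    have h3 := DirichletCharacter.sum_char_inv_mul_char_eq ℂ hb ((absNorm P.1 : ℕ) : ZMod Q)
    calc _ = (Q.totient : ℂ)⁻¹ * ((if b = ((absNorm P.1 : ℕ) : ZMod Q) then
          (Q.totient : ℂ) else 0) * (fourier k (S.angleOut P.1) *
          (Real.log (absNorm P.1) * ((absNorm P.1 : ℝ) ^ (-s) : ℝ)))) := by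
          rw [residueWeight]
          by_cases h : ((absNorm P.1 : ℕ) : ZMod Q) = b
          · rw [if_pos h, if_pos h.symm, inv_mul_cancel_left₀ hφ]
            push_cast
            ring
          · rw [if_neg h, if_neg (Ne.symm h)]
            simp
      _ = _ := by
          rw [← h3, Finset.sum_mul]
          congr 1
          refine Finset.sum_congr rfl fun χ _ => ?_
          rw [normTwist_apply, S.twist_apply]
          ring
  simp_rw [e]
  rw [tsum_mul_left, Summable.tsum_finsetSum fun χ _ => (hsum χ).mul_left _, norm_mul]
  refine mul_le_mul_of_nonneg_left ((norm_sum_le _ _).trans (Finset.sum_le_sum fun χ _ => ?_))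
    (norm_nonneg _)
  rw [tsum_mul_left, norm_mul]
  exact mul_le_mul_of_nonneg_left (h1 χ) (norm_nonneg _)

theorem exists_tsum_residueWeight_le [NeZero Q] (h2 : 2 ∣ Q) (hpQ : 2 * p ∣ Q)
    {b : ZMod Q} (hb : IsUnit b) {U : Set (AddCircle (1 : ℝ))} (hU : IsOpen U) (hne : U.Nonempty)
    {m : {P : Associates (ℤ√(p : ℤ)) // Prime P} → ℝ} (hm : Summable m) (hm0 : ∀ P, 0 ≤ m P)
    (hle : ∀ s, 1 < s → ∀ P, S.angleOut P.1 ∈ U → residueWeight b s P.1 ≤ m P) :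
    ∃ C, ∀ᶠ s in 𝓝[>] (1 : ℝ), ∑' P : {P : Associates (ℤ√(p : ℤ)) // Prime P},
      residueWeight b s P.1 ≤ C := by
  have hw := fun (k : ℤ) (hk : k ≠ 0) =>
    S.exists_norm_tsum_fourier_residueWeight_le h2 hpQ hb hk
  refine exists_tsum_le_of_isOpen (ι := {P : Associates (ℤ√(p : ℤ)) // Prime P})
    (θ := fun P => S.angleOut P.1) (w := fun s P => residueWeight b s P.1)
    (fun s P => residueWeight_nonneg b s P.1) (fun s hs => S.summable_residueWeight h2 hpQ hb hs)
    hw hU hne ⟨∑' P, m P, ?_⟩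
  filter_upwards [self_mem_nhdsWithin] with s hs
  have hsum := (S.summable_residueWeight h2 hpQ hb hs).indicator
    ((fun P : {P : Associates (ℤ√(p : ℤ)) // Prime P} => S.angleOut P.1) ⁻¹' U)
  refine hsum.tsum_le_tsum (fun P => ?_) hm
  by_cases hP : S.angleOut P.1 ∈ U
  · rw [Set.indicator_of_mem (by exact hP)]
    exact hle s hs P hP
  · rw [Set.indicator_of_notMem (by exact hP)]
    exact hm0 P

end EvenPellUnit

namespace Zsqrtd

theorem exists_prime_dvd_natCast {d : ℤ} {π : ℤ√d} (hπ : Prime π) {n : ℕ} (hn : n ≠ 0)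
    (h : π ∣ (n : ℤ√d)) : ∃ q : ℕ, q.Prime ∧ π ∣ (q : ℤ√d) := by
  induction n using Nat.recOnMul with
  | zero => exact absurd rfl hn
  | one => exact absurd (isUnit_of_dvd_one (by simpa using h)) hπ.not_isUnit
  | prime q hq => exact ⟨q, hq, h⟩
  | mul a b ha hb =>
    rw [Nat.cast_mul] at h
    rcases hπ.dvd_or_dvd h with h | h
    · exact ha (left_ne_zero_of_mul hn) h
    · exact hb (right_ne_zero_of_mul hn) h

/-- A prime element of `ℤ[√d]` has prime norm or is associated to a rational prime. -/
theorem natAbs_norm_prime_or_associated {d : ℤ} (hd : ∀ n : ℤ, d ≠ n * n) {π : ℤ√d}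
    (hπ : Prime π) :
    π.norm.natAbs.Prime ∨ ∃ q : ℕ, q.Prime ∧ π.norm.natAbs = q ^ 2 ∧ Associated π (q : ℤ√d) := by
  have h0 : π.norm.natAbs ≠ 0 := by
    rw [Int.natAbs_ne_zero, Ne, norm_eq_zero hd]
    exact hπ.ne_zero
  have hdvd : π ∣ (π.norm.natAbs : ℤ√d) := by
    have h1 : π ∣ ((π.norm : ℤ) : ℤ√d) := ⟨star π, norm_eq_mul_conj π⟩
    rcases Int.natAbs_eq π.norm with h | h
    · rw [h] at h1
      simpa using h1
    · rw [h] at h1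
      simpa using h1
  obtain ⟨q, hq, t, ht⟩ := exists_prime_dvd_natCast hπ h0 hdvd
  have hN : π.norm.natAbs * t.norm.natAbs = q ^ 2 := by
    rw [← Int.natAbs_mul, ← norm_mul, ← ht, norm_natCast, Int.natAbs_mul, Int.natAbs_natCast, sq]
  obtain ⟨i, hi, hi'⟩ := (Nat.dvd_prime_pow hq).1 (Dvd.intro _ hN)
  interval_cases i
  · exact absurd (norm_eq_one_iff.1 (by simpa using hi')) hπ.not_isUnit
  · left
    rwa [hi', pow_one]
  · refine .inr ⟨q, hq, hi', ?_⟩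
    have h1 : t.norm.natAbs = 1 := by
      rw [hi'] at hN
      exact Nat.eq_of_mul_eq_mul_left (pow_pos hq.pos 2) (by rw [hN, mul_one])
    exact ht ▸ (associated_mul_isUnit_right_iff (norm_eq_one_iff.1 h1)).2 (Associated.refl π)

end Zsqrtd

namespace EvenPellUnit

open Filter Topology

variable {p : ℕ} (S : EvenPellUnit p) {Q : ℕ}

include S in
theorem exists_associates_natCast {P : Associates (ℤ√(p : ℤ))} (hP : Prime P)
    (h : ¬ (absNorm P).Prime) : ∃ q : ℕ, absNorm P = q ^ 2 ∧ P = Associates.mk (q : ℤ√(p : ℤ)) := by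
  obtain ⟨π, rfl⟩ := Associates.mk_surjective P
  rw [Associates.prime_mk] at hP
  rcases Zsqrtd.natAbs_norm_prime_or_associated S.ne_mul_self hP with h' | ⟨q, -, hq, hq'⟩
  · exact absurd h' h
  · exact ⟨q, hq, Associates.mk_eq_mk_iff_associated.2 hq'⟩

include S in
theorem summable_indicator_not_prime : Summable (Set.indicator
    {P : {P : Associates (ℤ√(p : ℤ)) // Prime P} | ¬ (absNorm P.1).Prime}
    fun P => (absNorm P.1 : ℝ)⁻¹ * Real.log (absNorm P.1)) := by
  rw [← summable_subtype_iff_indicator]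
  choose q hq hq' using fun P : {P : {P : Associates (ℤ√(p : ℤ)) // Prime P} //
    ¬ (absNorm P.1).Prime} => S.exists_associates_natCast P.1.2 P.2
  have hinj : Function.Injective q := fun P P' h =>
    Subtype.ext (Subtype.ext (by rw [hq' P, hq' P', h]))
  have hs : Summable fun n : ℕ => ((n ^ 2 : ℕ) : ℝ)⁻¹ * Real.log (n ^ 2 : ℕ) := by
    refine Summable.of_nonneg_of_le
      (fun n => mul_nonneg (by positivity) (Real.log_natCast_nonneg _)) (fun n => ?_)
      ((Real.summable_nat_rpow.2 (show (-(3 / 2) : ℝ) < -1 by norm_num)).mul_left (2 * (1 / 2)⁻¹))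
    have h := rpow_neg_mul_log_le (n := n) (show (3 / 2 : ℝ) < 2 by norm_num)
    rw [Real.rpow_neg (Nat.cast_nonneg n), Real.rpow_two] at h
    push_cast
    rw [Real.log_pow]
    norm_num at h ⊢
    linarith
  refine (hs.comp_injective hinj).congr fun P => ?_
  simp only [Function.comp_apply]
  rw [← hq P]

include S in
/-- A total weight bounded near `1` contradicts the divergence of `∑ log ℓ / ℓ` over primes `ℓ` in
a residue class. -/
theorem not_exists_tsum_residueWeight_le [NeZero Q] (h2 : 2 ∣ Q) (hpQ : 2 * p ∣ Q)
    {b : ZMod Q} (hb : IsUnit b)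
    (hex : ∀ ℓ : ℕ, ℓ.Prime → (ℓ : ZMod Q) = b → ∃ x : ℤ√(p : ℤ), x.norm.natAbs = ℓ) :
    ¬ ∃ C, ∀ᶠ s in 𝓝[>] (1 : ℝ), ∑' P : {P : Associates (ℤ√(p : ℤ)) // Prime P},
      residueWeight b s P.1 ≤ C := by
  rintro ⟨C, hC⟩
  refine ArithmeticFunction.vonMangoldt.not_summable_residueClass_prime_div hb ?_
  set A : Set ℕ := {ℓ | ℓ.Prime ∧ (ℓ : ZMod Q) = b} with hA
  have hex' : ∀ ℓ : A, ∃ P : {P : Associates (ℤ√(p : ℤ)) // Prime P}, absNorm P.1 = ℓ := by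
    rintro ⟨ℓ, hℓ, hℓb⟩
    obtain ⟨x, hx⟩ := hex ℓ hℓ hℓb
    exact ⟨⟨Associates.mk x, Associates.prime_mk.2
      (Zsqrtd.prime_of_natAbs_norm_prime (hx ▸ hℓ))⟩, hx⟩
  choose P hP using hex'
  have hinj : Function.Injective P := fun ℓ ℓ' h => Subtype.ext (by rw [← hP ℓ, ← hP ℓ', h])
  have hw : ∀ (s : ℝ) (ℓ : A), residueWeight b s (P ℓ).1 = (ℓ : ℝ) ^ (-s) * Real.log ℓ := by
    intro s ℓ
    rw [residueWeight, hP, if_pos ℓ.2.2]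
  have hsum : Summable fun ℓ : A => (ℓ : ℝ)⁻¹ * Real.log ℓ := by
    refine summable_of_sum_le (c := C)
      (fun ℓ => mul_nonneg (by positivity) (Real.log_natCast_nonneg _)) fun u => ?_
    have ht : Tendsto (fun s : ℝ => ∑ ℓ ∈ u, (ℓ : ℝ) ^ (-s) * Real.log ℓ) (𝓝[>] 1)
        (𝓝 (∑ ℓ ∈ u, (ℓ : ℝ)⁻¹ * Real.log ℓ)) := by
      refine tendsto_finsetSum _ fun ℓ _ => Tendsto.mul_const _ ?_
      have h0 : ((ℓ : ℕ) : ℝ) ≠ 0 := by exact_mod_cast ℓ.2.1.ne_zero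
      have : ContinuousAt (fun s : ℝ => (ℓ : ℝ) ^ (-s)) 1 :=
        (Real.continuousAt_const_rpow h0).comp continuousAt_neg
      have h1 := this.tendsto.mono_left (nhdsWithin_le_nhds (s := Set.Ioi 1))
      rwa [Real.rpow_neg_one] at h1
    refine le_of_tendsto ht ?_
    filter_upwards [hC, self_mem_nhdsWithin] with s h1 hs
    refine le_trans ?_ h1
    simp_rw [← hw s]
    refine le_trans ?_ ((S.summable_residueWeight h2 hpQ hb hs).sum_le_tsum (u.map ⟨P, hinj⟩)
      fun _ _ => residueWeight_nonneg b s _)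
    rw [Finset.sum_map]
    rfl
  rw [show (fun ℓ : A => (ℓ : ℝ)⁻¹ * Real.log ℓ) =
    (fun ℓ : ℕ => (ℓ : ℝ)⁻¹ * Real.log ℓ) ∘ ((↑) : A → ℕ) from rfl,
    summable_subtype_iff_indicator] at hsum
  convert hsum using 1
  funext n
  by_cases hn : n.Prime
  · by_cases hnb : (n : ZMod Q) = b
    · rw [Set.indicator_of_mem (show n ∈ A from ⟨hn, hnb⟩), if_pos hn,
        ArithmeticFunction.vonMangoldt.residueClass, Set.indicator_of_mem (by exact hnb),
        ArithmeticFunction.vonMangoldt_apply_prime hn]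
      ring
    · rw [Set.indicator_of_notMem (fun h : n ∈ A => hnb h.2), if_pos hn,
        ArithmeticFunction.vonMangoldt.residueClass, Set.indicator_of_notMem (by exact hnb),
        zero_div]
  · rw [Set.indicator_of_notMem (fun h : n ∈ A => hn h.1), if_neg hn, zero_div]

/-- The angles of elements whose norm is a prime in a residue class are dense. -/
theorem infinite_setOf_prime_angle [UniqueFactorizationMonoid (ℤ√(p : ℤ))] [NeZero Q] (h2 : 2 ∣ Q)
    (hpQ : 2 * p ∣ Q) {b : ZMod Q} (hb : IsUnit b)
    (hex : ∀ ℓ : ℕ, ℓ.Prime → (ℓ : ZMod Q) = b → ∃ x : ℤ√(p : ℤ), x.norm.natAbs = ℓ)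
    {U : Set (AddCircle (1 : ℝ))} (hU : IsOpen U) (hne : U.Nonempty) :
    {ℓ : ℕ | ℓ.Prime ∧ (ℓ : ZMod Q) = b ∧
      ∃ x : ℤ√(p : ℤ), x.norm.natAbs = ℓ ∧ S.angle x ∈ U}.Infinite := by
  intro hfin
  obtain ⟨M, hM⟩ := hfin.bddAbove
  refine S.not_exists_tsum_residueWeight_le h2 hpQ hb hex ?_
  refine S.exists_tsum_residueWeight_le h2 hpQ hb hU hne
    (((S.summable_residueWeight h2 hpQ hb one_lt_two).mul_left (M : ℝ)).add
      S.summable_indicator_not_prime) (fun P => ?_) fun s hs P hP => ?_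
  · exact add_nonneg (mul_nonneg (Nat.cast_nonneg M) (residueWeight_nonneg b 2 _))
      (Set.indicator_nonneg (fun _ _ => mul_nonneg (by positivity) (Real.log_natCast_nonneg _)) _)
  have hN : (1 : ℝ) ≤ absNorm P.1 := by exact_mod_cast (S.one_lt_absNorm_of_prime P.2).le
  have hlog := Real.log_natCast_nonneg (absNorm P.1)
  have hpow : (absNorm P.1 : ℝ) ^ (-s) ≤ (absNorm P.1 : ℝ)⁻¹ := by
    rw [← Real.rpow_neg_one]
    exact Real.rpow_le_rpow_of_exponent_le hN (by linarith)
  by_cases hbP : ((absNorm P.1 : ℕ) : ZMod Q) = b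
  · rw [residueWeight, residueWeight, if_pos hbP, if_pos hbP]
    by_cases hpr : (absNorm P.1).Prime
    · rw [Set.indicator_of_notMem (by simpa using hpr), add_zero, ← mul_assoc]
      refine mul_le_mul_of_nonneg_right (hpow.trans ?_) hlog
      have hle : absNorm P.1 ≤ M := hM ⟨hpr, hbP, Quot.out P.1,
        by rw [← absNorm_mk, Associates.quot_out], hP⟩
      have hle' : (absNorm P.1 : ℝ) ≤ M := by exact_mod_cast hle
      have h0 : (absNorm P.1 : ℝ) ≠ 0 := by positivity
      calc (absNorm P.1 : ℝ)⁻¹ = absNorm P.1 * (absNorm P.1 : ℝ) ^ (-2 : ℝ) := by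
            rw [Real.rpow_neg (by positivity), Real.rpow_two]
            field_simp
        _ ≤ _ := by gcongr
    · rw [Set.indicator_of_mem (by exact hpr)]
      have h1 := mul_le_mul_of_nonneg_right hpow hlog
      have h3 : 0 ≤ (M : ℝ) * ((absNorm P.1 : ℝ) ^ (-2 : ℝ) * Real.log (absNorm P.1)) := by
        positivity
      linarith
  · rw [residueWeight, if_neg hbP]
    exact add_nonneg (mul_nonneg (Nat.cast_nonneg M) (residueWeight_nonneg b 2 _))
      (Set.indicator_nonneg (fun _ _ => mul_nonneg (by positivity) (Real.log_natCast_nonneg _)) _)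

end EvenPellUnit

theorem even_and_odd_of_minimal_pell {p : ℕ} (hp : p = 3 ∨ p = 7 ∨ p = 11 ∨ p = 19) {c d : ℤ}
    (hd : 0 < d) (hpell : c ^ 2 - (p : ℤ) * d ^ 2 = 1)
    (hmin : ∀ c' d' : ℤ, 0 < c' → 0 < d' → c' ^ 2 - (p : ℤ) * d' ^ 2 = 1 → d ≤ d') :
    Even c ∧ Odd d := by
  have hodd : Odd d := by
    have hsqrt : Nat.sqrt (p * d.natAbs ^ 2 + 1) * Nat.sqrt (p * d.natAbs ^ 2 + 1) =
        p * d.natAbs ^ 2 + 1 := by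
      refine Nat.exists_mul_self _ |>.1 ⟨c.natAbs, ?_⟩
      zify
      rw [abs_mul_abs_self, sq_abs]
      linarith
    have hd' : 0 < d.natAbs := by omega
    rw [← Int.natAbs_odd]
    rcases hp with rfl | rfl | rfl | rfl
    · have h : d ≤ 1 := hmin 2 1 (by norm_num) (by norm_num) (by norm_num)
      have key : ∀ n ≤ 1, 0 < n →
          Nat.sqrt (3 * n ^ 2 + 1) * Nat.sqrt (3 * n ^ 2 + 1) = 3 * n ^ 2 + 1 → Odd n := by
        decide +kernel
      exact key _ (by omega) hd' hsqrt
    · have h : d ≤ 3 := hmin 8 3 (by norm_num) (by norm_num) (by norm_num)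
      have key : ∀ n ≤ 3, 0 < n →
          Nat.sqrt (7 * n ^ 2 + 1) * Nat.sqrt (7 * n ^ 2 + 1) = 7 * n ^ 2 + 1 → Odd n := by
        decide +kernel
      exact key _ (by omega) hd' hsqrt
    · have h : d ≤ 3 := hmin 10 3 (by norm_num) (by norm_num) (by norm_num)
      have key : ∀ n ≤ 3, 0 < n →
          Nat.sqrt (11 * n ^ 2 + 1) * Nat.sqrt (11 * n ^ 2 + 1) = 11 * n ^ 2 + 1 → Odd n := by
        decide +kernel
      exact key _ (by omega) hd' hsqrt
    · have h : d ≤ 39 := hmin 170 39 (by norm_num) (by norm_num) (by norm_num)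
      have key : ∀ n ≤ 39, 0 < n →
          Nat.sqrt (19 * n ^ 2 + 1) * Nat.sqrt (19 * n ^ 2 + 1) = 19 * n ^ 2 + 1 → Odd n := by
        decide +kernel
      exact key _ (by omega) hd' hsqrt
  refine ⟨?_, hodd⟩
  have hpo : Odd (p : ℤ) := by
    rcases hp with rfl | rfl | rfl | rfl <;> decide
  have h : Even (c ^ 2) := by
    rw [show c ^ 2 = p * d ^ 2 + 1 by linarith]
    exact (hpo.mul hodd.pow).add_one
  exact (Int.even_pow.1 h).1

theorem isFundamental_of_minimal_pell {p : ℕ} {c d : ℤ} (hc : 0 < c) (hd : 0 < d)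
    (hpell : c ^ 2 - (p : ℤ) * d ^ 2 = 1) (hp : 0 < p)
    (hmin : ∀ c' d' : ℤ, 0 < c' → 0 < d' → c' ^ 2 - (p : ℤ) * d' ^ 2 = 1 → d ≤ d') :
    Pell.IsFundamental (Pell.Solution₁.mk c d hpell) := by
  have hp' : (0 : ℤ) < p := by exact_mod_cast hp
  refine ⟨?_, by simpa using hd, fun {b} hb => ?_⟩
  · rw [Pell.Solution₁.x_mk]
    nlinarith [mul_pos hp' (pow_pos hd 2)]
  · rw [Pell.Solution₁.x_mk]
    have hb' := b.prop
    have hy : b.y ≠ 0 := fun h => by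
      rw [h] at hb'
      nlinarith
    have h := hmin b.x |b.y| (by linarith) (abs_pos.2 hy) (by rw [sq_abs]; exact hb')
    have h2 : d ^ 2 ≤ b.y ^ 2 := by
      rw [← sq_abs b.y]
      gcongr
    refine le_of_sq_le_sq ?_ (by linarith)
    nlinarith

/-- The minimal solution of the Pell equation as a fundamental unit. -/
def EvenPellUnit.ofMinimalPell {p : ℕ} (hp : p = 3 ∨ p = 7 ∨ p = 11 ∨ p = 19) {c d : ℤ}
    (hc : 0 < c) (hd : 0 < d) (hpell : c ^ 2 - (p : ℤ) * d ^ 2 = 1)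
    (hmin : ∀ c' d' : ℤ, 0 < c' → 0 < d' → c' ^ 2 - (p : ℤ) * d' ^ 2 = 1 → d ≤ d') :
    EvenPellUnit p where
  c := c
  d := d
  c_pos := hc
  d_pos := hd
  pell := hpell
  even_c := (even_and_odd_of_minimal_pell hp hd hpell hmin).1
  odd_d := (even_and_odd_of_minimal_pell hp hd hpell hmin).2
  prime := by rcases hp with rfl | rfl | rfl | rfl <;> norm_num
  mod_four := by rcases hp with rfl | rfl | rfl | rfl <;> rfl
  eq_pow := by
    intro u hu
    have hfund := isFundamental_of_minimal_pell hc hd hpell (by omega) hmin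
    have hu' : u.re ^ 2 - (p : ℤ) * u.im ^ 2 = 1 := by
      rw [Zsqrtd.norm_def] at hu
      linarith
    have hpow : ∀ n : ℤ, ∃ k : ℕ,
        ((Pell.Solution₁.mk c d hpell ^ n : Pell.Solution₁ (p : ℤ)) : ℤ√(p : ℤ)) = ⟨c, d⟩ ^ k ∨
        ((Pell.Solution₁.mk c d hpell ^ n : Pell.Solution₁ (p : ℤ)) : ℤ√(p : ℤ)) =
          ⟨c, -d⟩ ^ k := by
      intro n
      obtain ⟨k, rfl | rfl⟩ := n.eq_nat_or_neg
      · exact ⟨k, .inl (by rw [zpow_natCast]; rfl)⟩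
      · exact ⟨k, .inr (by rw [zpow_neg, zpow_natCast, ← inv_pow]; rfl)⟩
    obtain ⟨n, h⟩ := hfund.eq_zpow_or_neg_zpow (Pell.Solution₁.mk u.re u.im hu')
    obtain ⟨k, hk⟩ := hpow n
    refine ⟨k, ?_⟩
    have hcoe : ((Pell.Solution₁.mk u.re u.im hu' : Pell.Solution₁ (p : ℤ)) : ℤ√(p : ℤ)) = u := rfl
    rw [← hcoe]
    rcases h with h | h <;> rcases hk with hk | hk <;> rw [h]
    · exact .inl hk
    · exact .inr (.inr (.inl hk))
    · exact .inr (.inl (congrArg Neg.neg hk))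
    · exact .inr (.inr (.inr (congrArg Neg.neg hk)))

theorem strictMonoOn_hypAngle {α β w : ℝ} (hβ : 0 < β) (hw : β * w < α) :
    StrictMonoOn (hypAngle α β) (Set.Icc (-w) w) := by
  intro u hu v hv huv
  obtain ⟨h1, -⟩ := sector_pos hβ hw hu
  obtain ⟨-, h2⟩ := sector_pos hβ hw hv
  have h3 : Real.log (α + β * u) < Real.log (α + β * v) := Real.log_lt_log h1 (by nlinarith)
  have h4 : Real.log (α - β * v) < Real.log (α - β * u) := Real.log_lt_log h2 (by nlinarith)
  rw [hypAngle, hypAngle]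
  linarith

/-- For primes `ℓ ≡ 1` mod `4`, being a square modulo `ℓ` only depends on `ℓ` mod `p`. -/
theorem isSquare_natCast_of_modEq {p ℓ ℓ₀ : ℕ} [Fact p.Prime] [Fact ℓ.Prime] [Fact ℓ₀.Prime]
    (hp2 : p ≠ 2) (hℓ : ℓ % 4 = 1) (hℓ₀ : ℓ₀ % 4 = 1) (h : ℓ ≡ ℓ₀ [MOD p])
    (hs : IsSquare (p : ZMod ℓ₀)) : IsSquare (p : ZMod ℓ) := by
  rw [ZMod.exists_sq_eq_prime_iff_of_mod_four_eq_one hℓ hp2,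
    (ZMod.natCast_eq_natCast_iff _ _ _).2 h]
  exact (ZMod.exists_sq_eq_prime_iff_of_mod_four_eq_one hℓ₀ hp2).1 hs

theorem isSquare_neg_iff_of_mod_four_eq_one {ℓ : ℕ} [Fact ℓ.Prime] (hℓ : ℓ % 4 = 1)
    {x : ZMod ℓ} : IsSquare (-x) ↔ IsSquare x := by
  have h1 : IsSquare (-1 : ZMod ℓ) := ZMod.exists_sq_eq_neg_one_iff.2 (by omega)
  refine ⟨fun h => ?_, fun h => ?_⟩
  · simpa using h1.mul h
  · simpa using h1.mul h

namespace EvenPellUnit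

variable {p : ℕ} (S : EvenPellUnit p)

theorem angle_eq_of_associated {x y : ℤ√(p : ℤ)} (hx : Odd x.norm) (h : Associated x y) :
    S.angle y = S.angle x := by
  obtain ⟨u, rfl⟩ := h
  have hu := S.norm_eq_one_of_isUnit u.isUnit
  rw [S.angle_mul hx (by simp [hu]), S.angle_of_isUnit u.isUnit, add_zero]

include S in
theorem norm_eq_of_associated {x y : ℤ√(p : ℤ)} (h : Associated x y) : y.norm = x.norm := by
  obtain ⟨u, rfl⟩ := h
  rw [Zsqrtd.norm_mul, S.norm_eq_one_of_isUnit u.isUnit, mul_one]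

include S in
theorem norm_eq_of_natAbs {x : ℤ√(p : ℤ)} {ℓ : ℕ} (hℓ : ℓ % 4 = 1) (hx : x.norm.natAbs = ℓ) :
    x.norm = ℓ := by
  rcases Int.natAbs_eq x.norm with h | h
  · rw [h, hx]
  exfalso
  rw [hx] at h
  have h3 : x.norm % 4 = 3 := by omega
  rw [Zsqrtd.norm_def] at h3
  have h1 := S.mod_four
  have h2 : (p : ℤ) % 4 = 3 := by omega
  have hr : x.re % 4 = 0 ∨ x.re % 4 = 1 ∨ x.re % 4 = 2 ∨ x.re % 4 = 3 := by omega
  have hi : x.im % 4 = 0 ∨ x.im % 4 = 1 ∨ x.im % 4 = 2 ∨ x.im % 4 = 3 := by omega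
  rcases hr with hr | hr | hr | hr <;> rcases hi with hi | hi | hi | hi <;>
    simp [Int.sub_emod, Int.mul_emod, hr, hi, h2] at h3

/-- The open arc of angles of the points with `α < Y / X < β`. -/
def arc (α β : ℝ) : Set (AddCircle (1 : ℝ)) :=
  (fun t : ℝ => (t : AddCircle (1 : ℝ))) ''
    Set.Ioo (hypAngle 1 √p α / (4 * S.reg)) (hypAngle 1 √p β / (4 * S.reg))

theorem isOpen_arc (α β : ℝ) : IsOpen (S.arc α β) :=
  QuotientAddGroup.isOpenMap_coe _ isOpen_Ioo

variable {S} {α β : ℝ}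

theorem mem_Icc_of_nonneg (h0 : 0 ≤ α) (hβ : α ≤ S.d / S.c) :
    α ∈ Set.Icc (-(S.d / S.c : ℝ)) (S.d / S.c) :=
  ⟨by linarith, hβ⟩

variable (S) in
theorem strictMonoOn_hypAngle :
    StrictMonoOn (hypAngle 1 √p) (Set.Icc (-(S.d / S.c : ℝ)) (S.d / S.c)) :=
  _root_.strictMonoOn_hypAngle (Real.sqrt_pos.2 S.p_pos) S.sqrt_mul_div_lt_one

theorem arc_nonempty (h0 : 0 ≤ α) (hαβ : α < β) (hβ : β ≤ S.d / S.c) : (S.arc α β).Nonempty := by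
  refine (Set.nonempty_Ioo.2 ?_).image _
  have := S.reg_pos
  gcongr
  exact S.strictMonoOn_hypAngle (mem_Icc_of_nonneg h0 (hαβ.le.trans hβ))
    (mem_Icc_of_nonneg (h0.trans hαβ.le) hβ) hαβ

theorem PosReduced.abs_div_le {y : ℤ√(p : ℤ)} (hy : S.PosReduced y) :
    |(y.im / y.re : ℝ)| ≤ S.d / S.c := by
  have hc : (0 : ℝ) < S.c := by exact_mod_cast S.c_pos
  have hre : (0 : ℝ) < y.re := by exact_mod_cast hy.2.1
  rw [abs_div, abs_of_pos hre, div_le_div_iff₀ hre hc]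
  have := hy.2.2
  rw [mul_comm] at this
  exact_mod_cast this

theorem PosReduced.div_mem_Ioo {y : ℤ√(p : ℤ)} (hy : S.PosReduced y) (h0 : 0 ≤ α)
    (hαβ : α < β) (hβ : β ≤ S.d / S.c) (h : S.angle y ∈ S.arc α β) :
    (y.im / y.re : ℝ) ∈ Set.Ioo α β := by
  obtain ⟨t, ⟨ht1, ht2⟩, ht⟩ := h
  have hr := S.reg_pos
  have hmono := S.strictMonoOn_hypAngle
  have hα' := mem_Icc_of_nonneg h0 (hαβ.le.trans hβ)
  have hβ' := mem_Icc_of_nonneg (h0.trans hαβ.le) hβ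
  have hw : 0 ≤ (S.d / S.c : ℝ) := (h0.trans hαβ.le).trans hβ
  have hlt := hy.abs_logRatio_lt
  rw [abs_lt] at hlt
  have hre : (0 : ℝ) < y.re := by exact_mod_cast hy.2.1
  have hlog : logRatio y = hypAngle 1 √p (y.im / y.re) :=
    logRatio_eq_hypAngle_of_pos hre hy.emb_pos
  have hα0 : 0 ≤ hypAngle 1 √p α := by
    rw [show (0 : ℝ) = hypAngle 1 √p 0 by simp [hypAngle]]
    exact hmono.monotoneOn ⟨by linarith, hw⟩ hα' h0
  have hβ1 : hypAngle 1 √p β ≤ 2 * S.reg := by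
    rw [← S.hypAngle_pos_eq]
    exact hmono.monotoneOn hβ' ⟨by linarith, le_rfl⟩ hβ
  rw [div_lt_iff₀ (by positivity)] at ht1
  rw [lt_div_iff₀ (by positivity)] at ht2
  change ((t : ℝ) : AddCircle (1 : ℝ)) = _ at ht
  rw [angle, parityShift_of_odd hy.1, add_zero, addCircle_coe_eq_iff] at ht
  obtain ⟨n, hn⟩ := ht
  have hn' : (n : ℝ) * (4 * S.reg) = t * (4 * S.reg) - logRatio y := by
    rw [hn]
    field_simp
  have hn1 : n < 1 := by
    have : (n : ℝ) < 1 := by nlinarith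
    exact_mod_cast this
  have hn2 : -1 < n := by
    have : (-1 : ℝ) < n := by nlinarith
    exact_mod_cast this
  obtain rfl : n = 0 := by omega
  rw [Int.cast_zero, zero_mul] at hn'
  have he : t * (4 * S.reg) = hypAngle 1 √p (y.im / y.re) := by rw [← hlog]; linarith
  rw [he] at ht1 ht2
  have hmem := abs_le.1 hy.abs_div_le
  exact ⟨(hmono.lt_iff_lt hα' hmem).1 ht1, (hmono.lt_iff_lt hmem hβ').1 ht2⟩

end EvenPellUnit

theorem stmt_12 (p : ℕ) (hp : p = 3 ∨ p = 7 ∨ p = 11 ∨ p = 19)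
    (c d : ℤ) (hc : 0 < c) (hd : 0 < d) (hpell : c ^ 2 - (p : ℤ) * d ^ 2 = 1)
    (hmin : ∀ c' d' : ℤ, 0 < c' → 0 < d' →
      c' ^ 2 - (p : ℤ) * d' ^ 2 = 1 → d ≤ d')
    (a m : ℕ)
    (hinf : {ℓ : ℕ | ℓ.Prime ∧ ℓ % m = a ∧ ℓ % 4 = 1 ∧
      IsSquare (-(p : ZMod ℓ))}.Infinite) :
    ∀ α β : ℝ, 0 ≤ α → α < β → β ≤ (d : ℝ) / (c : ℝ) →
      {ℓ : ℕ | ℓ.Prime ∧ ℓ % m = a ∧ ℓ % 4 = 1 ∧ IsSquare (-(p : ZMod ℓ)) ∧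
        ∃ A B : ℤ, 0 < A ∧ 0 < B ∧ Odd A ∧ c * B < d * A ∧
          α < (B : ℝ) / (A : ℝ) ∧ (B : ℝ) / (A : ℝ) < β ∧
          (ℓ : ℤ) = A ^ 2 - (p : ℤ) * B ^ 2}.Infinite := by
  intro α β h0 hαβ hβ
  let S := EvenPellUnit.ofMinimalPell hp hc hd hpell hmin
  have := S.nonsquare
  have hUFM : UniqueFactorizationMonoid (ℤ√(p : ℤ)) :=
    Zsqrtd.uniqueFactorizationMonoid_of_forall_prime S.ne_mul_self
      fun q hq hs => Zsqrtd.exists_natAbs_norm_eq hp hq hs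
  have hpp : Fact p.Prime := ⟨S.prime⟩
  have hp2 : p ≠ 2 := by omega
  have hm : m ≠ 0 := by
    rintro rfl
    refine hinf ((Set.finite_singleton a).subset fun ℓ hℓ => ?_)
    simpa using hℓ.2.1
  have hQ0 : 4 * p * m ≠ 0 := by
    have := S.prime.ne_zero
    positivity
  have : NeZero (4 * p * m) := ⟨hQ0⟩
  obtain ⟨ℓ₀, ⟨hℓ₀, ha, h41, hsq⟩, hgt⟩ := hinf.exists_gt (4 * p * m)
  have hℓ₀' : Fact ℓ₀.Prime := ⟨hℓ₀⟩
  have hb : IsUnit (ℓ₀ : ZMod (4 * p * m)) := by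
    rw [ZMod.isUnit_iff_coprime]
    exact Nat.coprime_of_lt_prime hQ0 hgt hℓ₀
  have hclass : ∀ ℓ : ℕ, ℓ.Prime → (ℓ : ZMod (4 * p * m)) = ℓ₀ →
      ℓ % m = a ∧ ℓ % 4 = 1 ∧ IsSquare (p : ZMod ℓ) := by
    intro ℓ hℓ h
    have hℓ' : Fact ℓ.Prime := ⟨hℓ⟩
    rw [ZMod.natCast_eq_natCast_iff] at h
    have h4 : ℓ % 4 = 1 := Eq.trans (h.of_dvd ⟨p * m, by ring⟩) h41
    exact ⟨Eq.trans (h.of_dvd ⟨4 * p, by ring⟩) ha, h4,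
      isSquare_natCast_of_modEq hp2 h4 h41 (h.of_dvd ⟨4 * m, by ring⟩)
        ((isSquare_neg_iff_of_mod_four_eq_one h41).1 hsq)⟩
  refine (S.infinite_setOf_prime_angle (Q := 4 * p * m) ⟨2 * p * m, by ring⟩ ⟨2 * m, by ring⟩ hb
    (fun ℓ hℓ h => ?_) (S.isOpen_arc α β) (EvenPellUnit.arc_nonempty h0 hαβ hβ)).mono ?_
  · exact Zsqrtd.exists_natAbs_norm_eq hp hℓ (by simpa using (hclass ℓ hℓ h).2.2)
  · rintro ℓ ⟨hℓ, hb, x, hx, hang⟩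
    obtain ⟨h1, h4, hs⟩ := hclass ℓ hℓ hb
    have hℓ' : Fact ℓ.Prime := ⟨hℓ⟩
    have hnorm := S.norm_eq_of_natAbs h4 hx
    have hodd : Odd x.norm := by
      rw [hnorm, Int.odd_iff]
      omega
    obtain ⟨y, hxy, hy⟩ := S.exists_posReduced hodd (by rw [hnorm]; exact_mod_cast hℓ.pos)
    rw [← S.angle_eq_of_associated hodd hxy] at hang
    obtain ⟨hα', hβ'⟩ := hy.div_mem_Ioo h0 hαβ hβ hang
    have hre : (0 : ℝ) < y.re := by exact_mod_cast hy.2.1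
    have him : (0 : ℝ) < y.im := by
      have := mul_pos (h0.trans_lt hα') hre
      rwa [div_mul_cancel₀ _ hre.ne'] at this
    refine ⟨hℓ, h1, h4, (isSquare_neg_iff_of_mod_four_eq_one h4).2 hs, y.re, y.im, hy.2.1,
      by exact_mod_cast him, hy.1, ?_, hα', hβ', ?_⟩
    · exact (mul_le_mul_of_nonneg_left (le_abs_self _) hc.le).trans_lt hy.lt
    · rw [← hnorm, ← S.norm_eq_of_associated hxy, Zsqrtd.norm_def]
      ring
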